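/- For every β > 0 there exists a constant C > 0 depending only on β such that for every integer n ≥ 1 and all a, b ∈ [0,2π) with a ≠ b, | E[ Ñ_n(a,b)² ] − 2 ln n /(π²β) | ≤ C (1 − ln sin(|a−b|/2)), where E denotes expectation with respect to μ_{β,n}. -/

import Mathlib

open MeasureTheory ProbabilityTheory Filter

noncomputable section

/-- The normalization constant `C_{β,n} = (2π)^n Γ(1+βn/2)/Γ(1+β/2)^n`. -/
def cbeConst (β : ℝ) (n : ℕ) : ℝ :=
  (2 * Real.pi) ^ n * Real.Gamma (1 + β * n / 2) / Real.Gamma (1 + β / 2) ^ n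

/-- The circular β-ensemble: the measure on `[0,2π)^n` with density
`(1/C_{β,n}) ∏_{j<k} |e^{iθ_j} − e^{iθ_k}|^β` with respect to Lebesgue measure. -/
def cbe (β : ℝ) (n : ℕ) : Measure (Fin n → ℝ) :=
  ((volume : Measure (Fin n → ℝ)).restrict
      (Set.univ.pi fun _ => Set.Ico 0 (2 * Real.pi))).withDensity
    (fun y => ENNReal.ofReal ((1 / cbeConst β n) *
      ∏ p ∈ Finset.univ.filter (fun p : Fin n × Fin n => p.1 < p.2),
        ‖Complex.exp (Complex.I * (y p.1 : ℂ)) - Complex.exp (Complex.I * (y p.2 : ℂ))‖ ^ β))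

/-- `countIn a b y` is the number of indices `j` with `y j ∈ [a, b)`. -/
def countIn {n : ℕ} (a b : ℝ) (y : Fin n → ℝ) : ℕ :=
  (Finset.univ.filter fun j => a ≤ y j ∧ y j < b).card

/-- The centered counting function `Ñ_n(a,b) = N_n(a,b) − n(b−a)/(2π)` for `a ≤ b`,
with the convention `Ñ_n(b,a) = −Ñ_n(a,b)`. -/
def centeredCount (n : ℕ) (a b : ℝ) (y : Fin n → ℝ) : ℝ :=
  if a ≤ b then (countIn a b y : ℝ) - n * (b - a) / (2 * Real.pi)
  else -((countIn b a y : ℝ) - n * (a - b) / (2 * Real.pi))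

/-- The character `x ↦ e^{ikx}`. -/
def en (k : ℤ) (x : ℝ) : ℂ := Complex.exp (Complex.I * (k * x))

lemma en_mul (k l : ℤ) (x : ℝ) : en k x * en l x = en (k + l) x := by
  unfold en
  rw [← Complex.exp_add]
  congr 1
  push_cast
  ring

lemma en_mul_sub (k : ℤ) (x y : ℝ) : en k (x - y) = en k x * en (-k) y := by
  unfold en
  rw [← Complex.exp_add]
  congr 1
  push_cast
  ring

@[simp] lemma en_zero (x : ℝ) : en 0 x = 1 := by simp [en]

lemma en_natCast (k : ℕ) (x : ℝ) : en k x = en 1 x ^ k := by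
  unfold en
  rw [← Complex.exp_nat_mul]
  congr 1
  push_cast
  ring

lemma norm_en (k : ℤ) (x : ℝ) : ‖en k x‖ = 1 := by
  have : Complex.I * (k * x) = ((k * x : ℝ) : ℂ) * Complex.I := by push_cast; ring
  rw [en, this, Complex.norm_exp_ofReal_mul_I]

lemma star_en (k : ℤ) (x : ℝ) : star (en k x) = en (-k) x := by
  simp only [en, Complex.star_def, ← Complex.exp_conj]
  congr 1
  simp

lemma en_add_two_pi (k : ℤ) (x : ℝ) : en k (x + 2 * Real.pi) = en k x := by
  unfold en
  have : Complex.I * (k * ((x + 2 * Real.pi : ℝ) : ℂ))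
      = Complex.I * (k * x) + k * (2 * Real.pi * Complex.I) := by
    push_cast; ring
  rw [this, Complex.exp_add, Complex.exp_int_mul_two_pi_mul_I, mul_one]

lemma hasDerivAt_en (k : ℤ) (x : ℝ) : HasDerivAt (en k) (Complex.I * k * en k x) x := by
  have h : HasDerivAt (fun x : ℝ => Complex.I * (k * (x : ℂ))) (Complex.I * (k * 1)) x :=
    ((Complex.ofRealCLM.hasDerivAt (x := x)).const_mul (k : ℂ)).const_mul Complex.I
  have := h.cexp
  have e : Complex.I * k * en k x
      = Complex.exp (Complex.I * (k * x)) * (Complex.I * (k * 1)) := by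
    simp only [en]
    ring
  rw [e]
  exact this

lemma contDiff_en (k : ℤ) : ContDiff ℝ 1 (en k) := by
  unfold en
  have : ContDiff ℝ 1 (fun x : ℝ => (x : ℂ)) := Complex.ofRealCLM.contDiff
  fun_prop

lemma en_one_eq (x : ℝ) : en 1 x = Real.cos x + Real.sin x * Complex.I := by
  simp only [en]
  rw [show Complex.I * (((1 : ℤ) : ℂ) * x) = x * Complex.I by push_cast; ring, Complex.exp_mul_I,
    Complex.ofReal_cos, Complex.ofReal_sin]

lemma en_sub_en_mul_sin (m : ℕ) (x y : ℝ) :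
    (en m x - en m y) * ((2 * Real.sin (x - y) : ℝ) : ℂ)
      = ((2 - 2 * Real.cos (x - y) : ℝ) : ℂ)
        * (Complex.I * ((en 1 x + en 1 y) * ∑ r ∈ Finset.range m, en r x * en (m - 1 - r : ℕ) y)) := by
  have h1 : en 1 x * en (-1) x = 1 := by rw [en_mul]; simp
  have h2 : en 1 y * en (-1) y = 1 := by rw [en_mul]; simp
  have hs : ((2 * Real.sin (x - y) : ℝ) : ℂ)
      = -Complex.I * (en 1 x * en (-1) y - en (-1) x * en 1 y) := by
    rw [← en_mul_sub, mul_comm (en (-1) x), show en 1 y * en (-1) x = en 1 (y - x) by rw [en_mul_sub]]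
    rw [en_one_eq, en_one_eq, ← neg_sub x y, Real.cos_neg, Real.sin_neg]
    push_cast
    linear_combination (2 * Complex.sin (x - y)) * Complex.I_sq
  have hc : ((2 - 2 * Real.cos (x - y) : ℝ) : ℂ)
      = 2 - en 1 x * en (-1) y - en (-1) x * en 1 y := by
    rw [← en_mul_sub, mul_comm (en (-1) x), show en 1 y * en (-1) x = en 1 (y - x) by rw [en_mul_sub]]
    rw [en_one_eq, en_one_eq, ← neg_sub x y, Real.cos_neg, Real.sin_neg]
    push_cast
    ring
  have hg : (∑ r ∈ Finset.range m, en r x * en (m - 1 - r : ℕ) y) * (en 1 x - en 1 y)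
      = en m x - en m y := by
    simp only [en_natCast]
    exact Commute.geom_sum₂_mul (Commute.all _ _) m
  rw [hs, hc, ← hg]
  set u := en 1 x
  set v := en 1 y
  set u' := en (-1) x
  set v' := en (-1) y
  set S := ∑ r ∈ Finset.range m, en r x * en (m - 1 - r : ℕ) y
  linear_combination (2 * Complex.I * S * v) * h1 + (2 * Complex.I * S * u) * h2

/-- The box `[0,2π)^n` with Lebesgue measure. -/
def boxMeasure (n : ℕ) : Measure (Fin n → ℝ) :=
  (volume : Measure (Fin n → ℝ)).restrict (Set.univ.pi fun _ => Set.Ico 0 (2 * Real.pi))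

/-- Continuously differentiable functions that are `2π`-periodic in each coordinate. -/
structure TorusC1 {n : ℕ} (F : (Fin n → ℝ) → ℂ) : Prop where
  contDiff : ContDiff ℝ 1 F
  periodic : ∀ i y, F (y + Pi.single i (2 * Real.pi)) = F y

/-- The partial derivative in the `j`-th coordinate. -/
def pd {n : ℕ} (j : Fin n) (F : (Fin n → ℝ) → ℂ) (y : Fin n → ℝ) : ℂ :=
  fderiv ℝ F y (Pi.single j 1)

namespace TorusC1

variable {n : ℕ} {F G : (Fin n → ℝ) → ℂ}

lemma continuous (hF : TorusC1 F) : Continuous F := hF.contDiff.continuous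

lemma differentiableAt (hF : TorusC1 F) (y : Fin n → ℝ) : DifferentiableAt ℝ F y :=
  hF.contDiff.differentiable one_ne_zero y

lemma continuous_pd (hF : TorusC1 F) (j : Fin n) : Continuous (pd j F) :=
  (hF.contDiff.continuous_fderiv one_ne_zero).clm_apply continuous_const

lemma const (c : ℂ) : TorusC1 (fun _ : Fin n → ℝ => c) := ⟨contDiff_const, fun _ _ => rfl⟩

lemma add (hF : TorusC1 F) (hG : TorusC1 G) : TorusC1 (fun y => F y + G y) :=
  ⟨hF.contDiff.add hG.contDiff, fun i y => by rw [hF.periodic, hG.periodic]⟩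

lemma mul (hF : TorusC1 F) (hG : TorusC1 G) : TorusC1 (fun y => F y * G y) :=
  ⟨hF.contDiff.mul hG.contDiff, fun i y => by rw [hF.periodic, hG.periodic]⟩

lemma star (hF : TorusC1 F) : TorusC1 (fun y => star (F y)) :=
  ⟨Complex.conjCLE.contDiff.comp hF.contDiff, fun i y => by rw [hF.periodic]⟩

lemma sum {ι : Type*} {s : Finset ι} {F : ι → (Fin n → ℝ) → ℂ} (hF : ∀ i ∈ s, TorusC1 (F i)) :
    TorusC1 (fun y => ∑ i ∈ s, F i y) :=
  ⟨ContDiff.sum fun i hi => (hF i hi).contDiff,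
    fun i y => Finset.sum_congr rfl fun j hj => (hF j hj).periodic i y⟩

lemma prod {ι : Type*} {s : Finset ι} {F : ι → (Fin n → ℝ) → ℂ} (hF : ∀ i ∈ s, TorusC1 (F i)) :
    TorusC1 (fun y => ∏ i ∈ s, F i y) :=
  ⟨contDiff_prod fun i hi => (hF i hi).contDiff,
    fun i y => Finset.prod_congr rfl fun j hj => (hF j hj).periodic i y⟩

lemma en (k : ℤ) (j : Fin n) : TorusC1 (fun y => en k (y j)) := by
  refine ⟨(contDiff_en k).comp (contDiff_apply ℝ ℝ j), fun i y => ?_⟩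
  rcases eq_or_ne j i with rfl | h
  · simp [en_add_two_pi]
  · simp [Pi.single_eq_of_ne h]

end TorusC1

section pd

variable {n : ℕ} {F G : (Fin n → ℝ) → ℂ}

lemma pd_const (j : Fin n) (c : ℂ) (y : Fin n → ℝ) : pd j (fun _ => c) y = 0 := by
  simp [pd]

lemma pd_add (hF : TorusC1 F) (hG : TorusC1 G) (j : Fin n) (y : Fin n → ℝ) :
    pd j (fun y => F y + G y) y = pd j F y + pd j G y := by
  simp [pd, fderiv_fun_add (hF.differentiableAt y) (hG.differentiableAt y)]

lemma pd_mul (hF : TorusC1 F) (hG : TorusC1 G) (j : Fin n) (y : Fin n → ℝ) :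
    pd j (fun y => F y * G y) y = pd j F y * G y + F y * pd j G y := by
  simp [pd, fderiv_fun_mul (hF.differentiableAt y) (hG.differentiableAt y)]
  ring

lemma pd_sum {ι : Type*} {s : Finset ι} {F : ι → (Fin n → ℝ) → ℂ}
    (hF : ∀ i ∈ s, TorusC1 (F i)) (j : Fin n) (y : Fin n → ℝ) :
    pd j (fun y => ∑ i ∈ s, F i y) y = ∑ i ∈ s, pd j (F i) y := by
  simp [pd, fderiv_fun_sum fun i hi => (hF i hi).differentiableAt y]

lemma pd_star (hF : TorusC1 F) (j : Fin n) (y : Fin n → ℝ) :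
    pd j (fun y => star (F y)) y = star (pd j F y) := by
  have h : HasFDerivAt (fun y => star (F y))
      ((Complex.conjCLE : ℂ →L[ℝ] ℂ).comp (fderiv ℝ F y)) y :=
    (Complex.conjCLE : ℂ →L[ℝ] ℂ).hasFDerivAt.comp y (hF.differentiableAt y).hasFDerivAt
  rw [pd, h.fderiv]
  rfl

lemma pd_en (k : ℤ) (i j : Fin n) (y : Fin n → ℝ) :
    pd j (fun y => en k (y i)) y = if i = j then Complex.I * k * en k (y i) else 0 := by
  have h : HasFDerivAt (fun y : Fin n → ℝ => en k (y i))
      ((Complex.I * k * en k (y i)) •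
        (Complex.ofRealCLM.comp (ContinuousLinearMap.proj (R := ℝ) (φ := fun _ => ℝ) i))) y := by
    have h1 := (hasDerivAt_en k (y i)).hasFDerivAt.comp y
      (ContinuousLinearMap.proj (R := ℝ) (φ := fun _ => ℝ) i).hasFDerivAt
    convert! h1 using 1
    ext v
    simp [mul_comm]
  rw [pd, h.fderiv]
  split_ifs with hij
  · subst hij; simp
  · simp [Pi.single_eq_of_ne hij]

end pd

lemma Continuous.integrable_boxMeasure {n : ℕ} {E : Type*} [NormedAddCommGroup E]
    {F : (Fin n → ℝ) → E} (hF : Continuous F) : Integrable F (boxMeasure n) := by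
  have h : IntegrableOn F (Set.Icc (fun _ : Fin n => (0 : ℝ)) (fun _ => 2 * Real.pi)) volume :=
    hF.continuousOn.integrableOn_compact isCompact_Icc
  refine h.mono_set fun y hy => ?_
  rw [Set.mem_univ_pi] at hy
  exact ⟨fun i => (hy i).1, fun i => (hy i).2.le⟩

instance (n : ℕ) : IsFiniteMeasure (boxMeasure n) := by
  refine ⟨?_⟩
  rw [boxMeasure, Measure.restrict_apply_univ, Real.volume_pi_Ico]
  exact ENNReal.prod_lt_top fun _ _ => ENNReal.ofReal_lt_top

lemma integral_sum_pd_eq_zero {n : ℕ} {G : Fin n → (Fin n → ℝ) → ℂ} (hG : ∀ j, TorusC1 (G j)) :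
    ∫ y, ∑ j, pd j (G j) y ∂(boxMeasure n) = 0 := by
  cases n with
  | zero => simp
  | succ n =>
    have hpi : (0 : ℝ) ≤ 2 * Real.pi := by positivity
    have hbox : boxMeasure (n + 1) = (volume : Measure (Fin (n + 1) → ℝ)).restrict
        (Set.Icc (fun _ => (0 : ℝ)) (fun _ => 2 * Real.pi)) := by
      unfold boxMeasure
      exact Measure.restrict_congr_set
        (Measure.univ_pi_Ico_ae_eq_Icc (μ := fun _ : Fin (n + 1) => (volume : Measure ℝ))
          (f := fun _ => (0 : ℝ)) (g := fun _ => 2 * Real.pi))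
    rw [hbox]
    have key := integral_divergence_of_hasFDerivAt_off_countable'
      (fun _ : Fin (n + 1) => (0 : ℝ)) (fun _ => 2 * Real.pi) (fun _ => hpi) G
      (fun i y => fderiv ℝ (G i) y) ∅ Set.countable_empty
      (fun i => (hG i).continuous.continuousOn)
      (fun y _ i => ((hG i).differentiableAt y).hasFDerivAt)
      ((continuous_finsetSum _ fun j _ => (hG j).continuous_pd j).continuousOn.integrableOn_compact
        isCompact_Icc)
    refine key.trans (Finset.sum_eq_zero fun i _ => ?_)
    rw [sub_eq_zero]
    congr 1
    funext x
    have : Fin.insertNth (α := fun _ => ℝ) i (2 * Real.pi) x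
        = Fin.insertNth (α := fun _ => ℝ) i 0 x + Pi.single i (2 * Real.pi) := by
      funext j
      rcases Fin.eq_self_or_eq_succAbove i j with rfl | ⟨k, rfl⟩
      · simp
      · simp [Pi.single_eq_of_ne]
    simp only [this]
    exact (hG i).periodic i _

/-- The squared length of the chord between `e^{ix}` and `e^{iy}`. -/
def chordSq (x y : ℝ) : ℝ := 2 - 2 * Real.cos (x - y)

lemma chordSq_nonneg (x y : ℝ) : 0 ≤ chordSq x y := by
  have := Real.cos_le_one (x - y)
  unfold chordSq; linarith

lemma continuous_chordSq {n : ℕ} (i j : Fin n) :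
    Continuous fun y : Fin n → ℝ => chordSq (y i) (y j) := by
  unfold chordSq; fun_prop

/-- The pairs of indices `j < k`. -/
def pairs (n : ℕ) : Finset (Fin n × Fin n) := Finset.univ.filter fun p => p.1 < p.2

/-- The product of regularized chord lengths `∏_{j<k} (ε + |e^{iy_j} - e^{iy_k}|²)^{c_{jk}}`. -/
def weight {n : ℕ} (ε : ℝ) (c : Fin n × Fin n → ℝ) (y : Fin n → ℝ) : ℝ :=
  ∏ p ∈ pairs n, (ε + chordSq (y p.1) (y p.2)) ^ c p

section weight

variable {n : ℕ} {c : Fin n × Fin n → ℝ}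

lemma weight_nonneg {ε : ℝ} (hε : 0 ≤ ε) (y : Fin n → ℝ) : 0 ≤ weight ε c y :=
  Finset.prod_nonneg fun _ _ => Real.rpow_nonneg (add_nonneg hε (chordSq_nonneg _ _)) _

lemma weight_le_weight (hc : ∀ p, 0 ≤ c p) {ε δ : ℝ} (hε : 0 ≤ ε) (h : ε ≤ δ) (y : Fin n → ℝ) :
    weight ε c y ≤ weight δ c y := by
  refine Finset.prod_le_prod
    (fun p _ => Real.rpow_nonneg (add_nonneg hε (chordSq_nonneg _ _)) _) fun p _ => ?_
  exact Real.rpow_le_rpow (add_nonneg hε (chordSq_nonneg _ _)) (by linarith) (hc p)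

lemma continuous_weight (hc : ∀ p, 0 ≤ c p) (ε : ℝ) : Continuous (weight ε c) := by
  refine continuous_finsetProd _ fun p _ => ?_
  exact (continuous_const.add (continuous_chordSq _ _)).rpow_const fun _ => Or.inr (hc p)

lemma tendsto_weight (hc : ∀ p, 0 ≤ c p) (y : Fin n → ℝ) :
    Tendsto (fun ε => weight ε c y) (nhds 0) (nhds (weight 0 c y)) := by
  have : Continuous fun ε => weight ε c y := by
    refine continuous_finsetProd _ fun p _ => ?_
    exact (continuous_id.add continuous_const).rpow_const fun _ => Or.inr (hc p)
  exact this.tendsto 0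

lemma weight_eq_zero {p : Fin n × Fin n} (hp : p ∈ pairs n) (hcp : c p ≠ 0) {y : Fin n → ℝ}
    (hy : chordSq (y p.1) (y p.2) = 0) : weight 0 c y = 0 :=
  Finset.prod_eq_zero hp (by rw [hy, add_zero, Real.zero_rpow hcp])

lemma hasFDerivAt_weight {ε : ℝ} (hε : 0 < ε) (y : Fin n → ℝ) :
    HasFDerivAt (weight ε c)
      (weight ε c y • ∑ p ∈ pairs n,
        (c p * (2 * Real.sin (y p.1 - y p.2)) / (ε + chordSq (y p.1) (y p.2))) •
          (ContinuousLinearMap.proj (R := ℝ) (φ := fun _ : Fin n => ℝ) p.1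
            - ContinuousLinearMap.proj (R := ℝ) (φ := fun _ : Fin n => ℝ) p.2)) y := by
  have hpos : ∀ p : Fin n × Fin n, ∀ y : Fin n → ℝ, 0 < ε + chordSq (y p.1) (y p.2) :=
    fun p y => add_pos_of_pos_of_nonneg hε (chordSq_nonneg _ _)
  have hexp : weight ε c
      = fun y => Real.exp (∑ p ∈ pairs n, c p * Real.log (ε + chordSq (y p.1) (y p.2))) := by
    funext y
    rw [Real.exp_sum]
    refine Finset.prod_congr rfl fun p _ => ?_
    rw [Real.rpow_def_of_pos (hpos p y), mul_comm]
  have hd : HasFDerivAt (fun y : Fin n → ℝ =>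
      ∑ p ∈ pairs n, c p * Real.log (ε + chordSq (y p.1) (y p.2)))
      (∑ p ∈ pairs n,
        (c p * (2 * Real.sin (y p.1 - y p.2)) / (ε + chordSq (y p.1) (y p.2))) •
          (ContinuousLinearMap.proj (R := ℝ) (φ := fun _ : Fin n => ℝ) p.1
            - ContinuousLinearMap.proj (R := ℝ) (φ := fun _ : Fin n => ℝ) p.2)) y := by
    refine HasFDerivAt.fun_sum fun p _ => ?_
    have h1 : HasFDerivAt (fun y : Fin n → ℝ => y p.1 - y p.2)
        (ContinuousLinearMap.proj (R := ℝ) (φ := fun _ : Fin n => ℝ) p.1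
            - ContinuousLinearMap.proj (R := ℝ) (φ := fun _ : Fin n => ℝ) p.2) y :=
      (ContinuousLinearMap.proj (R := ℝ) (φ := fun _ : Fin n => ℝ) p.1
            - ContinuousLinearMap.proj (R := ℝ) (φ := fun _ : Fin n => ℝ) p.2).hasFDerivAt
    have h2 := ((((h1.cos).const_mul 2).const_sub 2).const_add ε |>.log (hpos p y).ne').const_mul (c p)
    refine h2.congr_fderiv ?_
    ext v
    simp [chordSq]
    ring
  have := hd.exp
  rw [hexp]
  exact this

lemma torusC1_weight {ε : ℝ} (hε : 0 < ε) : TorusC1 (fun y => (weight ε c y : ℂ)) := by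
  have hpos : ∀ p : Fin n × Fin n, ∀ y : Fin n → ℝ, ε + chordSq (y p.1) (y p.2) ≠ 0 :=
    fun p y => (add_pos_of_pos_of_nonneg hε (chordSq_nonneg _ _)).ne'
  constructor
  · refine Complex.ofRealCLM.contDiff.comp ?_
    refine contDiff_prod fun p _ => ContDiff.rpow_const_of_ne ?_ (hpos p)
    unfold chordSq
    fun_prop
  · intro i y
    congr 1
    refine Finset.prod_congr rfl fun p _ => ?_
    have hcos : ∀ k j : Fin n, Real.cos ((y + Pi.single i (2 * Real.pi) : Fin n → ℝ) k
        - (y + Pi.single i (2 * Real.pi) : Fin n → ℝ) j) = Real.cos (y k - y j) := by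
      intro k j
      have hk := (TorusC1.en 1 k).periodic i y
      have hj := (TorusC1.en (-1) j).periodic i y
      have := congrArg Complex.re (congrArg₂ (· * ·) hk hj)
      simp only [← en_mul_sub] at this
      simpa only [en_one_eq, Complex.add_re, Complex.ofReal_re, Complex.mul_re, Complex.I_re,
        Complex.I_im, Complex.ofReal_im, mul_zero, zero_mul, sub_zero, add_zero] using this
    simp only [chordSq, hcos]

lemma pd_weight {ε : ℝ} (hε : 0 < ε) (j : Fin n) (y : Fin n → ℝ) :
    pd j (fun y => (weight ε c y : ℂ)) y = weight ε c y * ∑ p ∈ pairs n,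
        (c p : ℂ) * ((2 * Real.sin (y p.1 - y p.2) : ℝ) : ℂ) / (ε + chordSq (y p.1) (y p.2) : ℝ) *
          ((if p.1 = j then 1 else 0) - (if p.2 = j then 1 else 0)) := by
  have h := Complex.ofRealCLM.hasFDerivAt.comp y (hasFDerivAt_weight (c := c) hε y)
  have h' : HasFDerivAt (fun y => (weight ε c y : ℂ)) _ y := h
  rw [pd, h'.fderiv]
  simp only [ContinuousLinearMap.comp_apply, _root_.smul_apply, smul_eq_mul,
    _root_.sum_apply, _root_.sub_apply, ContinuousLinearMap.proj_apply,
    Complex.ofRealCLM_apply, Pi.single_apply]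
  push_cast
  congr 1
  refine Finset.sum_congr rfl fun p _ => ?_
  split_ifs <;> simp

/-- Integration by parts against `weight 0 c`: the vector field `G` is assumed to compensate the
singularities of the logarithmic derivative of the weight. -/
theorem integral_divergence_weight (hc : ∀ p, 0 ≤ c p) {G : Fin n → (Fin n → ℝ) → ℂ}
    (hG : ∀ j, TorusC1 (G j)) {A : Fin n × Fin n → (Fin n → ℝ) → ℂ} (hA : ∀ p, Continuous (A p))
    (hGA : ∀ p ∈ pairs n, ∀ y, (G p.1 y - G p.2 y) * ((2 * Real.sin (y p.1 - y p.2) : ℝ) : ℂ)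
      = (chordSq (y p.1) (y p.2) : ℂ) * A p y) :
    ∫ y, (∑ j, pd j (G j) y + ∑ p ∈ pairs n, c p * A p y) * weight 0 c y ∂(boxMeasure n) = 0 := by
  set Φ : ℝ → (Fin n → ℝ) → ℂ := fun ε y => (∑ j, pd j (G j) y + ∑ p ∈ pairs n,
    c p * ((chordSq (y p.1) (y p.2) / (ε + chordSq (y p.1) (y p.2)) : ℝ) * A p y)) * weight ε c y
    with hΦ
  have hpos : ∀ ε : ℝ, 0 < ε → ∀ p : Fin n × Fin n, ∀ y : Fin n → ℝ,
      0 < ε + chordSq (y p.1) (y p.2) :=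
    fun ε hε p y => add_pos_of_pos_of_nonneg hε (chordSq_nonneg _ _)
  have hcont : ∀ ε : ℝ, 0 < ε → Continuous (Φ ε) := by
    intro ε hε
    refine Continuous.mul (Continuous.add (continuous_finsetSum _ fun j _ => (hG j).continuous_pd j)
      (continuous_finsetSum _ fun p _ => continuous_const.mul (Continuous.mul ?_ (hA p)))) ?_
    · exact Complex.continuous_ofReal.comp ((continuous_chordSq _ _).div
        (continuous_const.add (continuous_chordSq _ _)) fun y => (hpos ε hε p y).ne')
    · exact Complex.continuous_ofReal.comp (continuous_weight hc ε)
  have hzero : ∀ ε : ℝ, 0 < ε → ∫ y, Φ ε y ∂(boxMeasure n) = 0 := by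
    intro ε hε
    rw [← integral_sum_pd_eq_zero fun j => (hG j).mul (torusC1_weight (c := c) hε)]
    congr 1
    funext y
    simp only [pd_mul (hG _) (torusC1_weight (c := c) hε), pd_weight hε, hΦ]
    rw [Finset.sum_add_distrib, ← Finset.sum_mul, add_mul]
    congr 1
    rw [Finset.sum_mul]
    simp only [Finset.mul_sum]
    rw [Finset.sum_comm]
    refine Finset.sum_congr rfl fun p hp => ?_
    have h1 : ∑ j, G j y * ((if p.1 = j then (1 : ℂ) else 0) - (if p.2 = j then 1 else 0))
        = G p.1 y - G p.2 y := by
      simp [mul_sub, Finset.sum_sub_distrib]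
    have h2 : ((ε + chordSq (y p.1) (y p.2) : ℝ) : ℂ) ≠ 0 := by
      exact_mod_cast (hpos ε hε p y).ne'
    calc _ = (c p : ℂ) * ((chordSq (y p.1) (y p.2) : ℂ) * A p y) * (weight ε c y : ℂ)
            / (ε + chordSq (y p.1) (y p.2) : ℝ) := by
          push_cast; ring
      _ = _ := by
          rw [← hGA p hp y, ← h1, Finset.sum_mul, Finset.mul_sum, Finset.sum_mul, Finset.sum_div]
          refine Finset.sum_congr rfl fun j _ => ?_
          ring
  set B : (Fin n → ℝ) → ℝ := fun y =>
    (∑ j, ‖pd j (G j) y‖ + ∑ p ∈ pairs n, c p * ‖A p y‖) * weight 1 c y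
  have hB : Continuous B := by
    refine Continuous.mul (Continuous.add
      (continuous_finsetSum _ fun j _ => ((hG j).continuous_pd j).norm)
      (continuous_finsetSum _ fun p _ => continuous_const.mul (hA p).norm)) (continuous_weight hc 1)
  have hlim : Tendsto (fun k : ℕ => ∫ y, Φ (1 / ((k : ℝ) + 1)) y ∂(boxMeasure n)) atTop
      (nhds (∫ y, (∑ j, pd j (G j) y + ∑ p ∈ pairs n, c p * A p y) * weight 0 c y
        ∂(boxMeasure n))) := by
    refine tendsto_integral_of_dominated_convergence B
      (fun k => (hcont _ Nat.one_div_pos_of_nat).aestronglyMeasurable)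
      hB.integrable_boxMeasure (fun k => Eventually.of_forall fun y => ?_)
      (Eventually.of_forall fun y => ?_)
    · have hε : (0 : ℝ) < 1 / ((k : ℝ) + 1) := Nat.one_div_pos_of_nat
      have hε1 : 1 / ((k : ℝ) + 1) ≤ 1 := by
        rw [div_le_one (by positivity)]; linarith [Nat.cast_nonneg (α := ℝ) k]
      set ε := 1 / ((k : ℝ) + 1)
      simp only [hΦ, norm_mul, Complex.norm_real, Real.norm_of_nonneg (weight_nonneg hε.le y)]
      refine mul_le_mul ((norm_add_le _ _).trans (add_le_add (norm_sum_le _ _)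
        ((norm_sum_le _ _).trans (Finset.sum_le_sum fun p _ => ?_))))
        (weight_le_weight hc hε.le hε1 y) (weight_nonneg hε.le y) ?_
      · rw [norm_mul, norm_mul, Complex.norm_real, Complex.norm_real,
          Real.norm_of_nonneg (hc p), Real.norm_of_nonneg
          (div_nonneg (chordSq_nonneg _ _) (hpos ε hε p y).le)]
        refine mul_le_mul_of_nonneg_left ?_ (hc p)
        refine mul_le_of_le_one_left (norm_nonneg _) ?_
        rw [div_le_one (hpos ε hε p y)]
        linarith
      · exact add_nonneg (Finset.sum_nonneg fun _ _ => norm_nonneg _)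
          (Finset.sum_nonneg fun p _ => mul_nonneg (hc p) (norm_nonneg _))
    · have ht : Tendsto (fun k : ℕ => 1 / ((k : ℝ) + 1)) atTop (nhds 0) :=
        tendsto_one_div_add_atTop_nhds_zero_nat
      have hw : Tendsto (fun k : ℕ => (weight (1 / ((k : ℝ) + 1)) c y : ℂ)) atTop
          (nhds (weight 0 c y : ℂ)) :=
        (Complex.continuous_ofReal.tendsto _).comp ((tendsto_weight hc y).comp ht)
      simp only [hΦ, add_mul, Finset.sum_mul]
      refine Tendsto.add (tendsto_finsetSum _ fun j _ => hw.const_mul _)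
        (tendsto_finsetSum _ fun p hp => ?_)
      · by_cases hcp : c p = 0
        · simp [hcp]
        by_cases hs : chordSq (y p.1) (y p.2) = 0
        · simp [hs, weight_eq_zero hp hcp hs]
        · refine (Tendsto.mul ?_ hw)
          refine Tendsto.const_mul _ ?_
          have : Tendsto (fun k : ℕ => (((chordSq (y p.1) (y p.2)
              / (1 / ((k : ℝ) + 1) + chordSq (y p.1) (y p.2)) : ℝ)) : ℂ)) atTop (nhds ((1 : ℝ) : ℂ)) := by
            refine (Complex.continuous_ofReal.tendsto _).comp ?_
            have := (tendsto_const_nhds (x := chordSq (y p.1) (y p.2))).div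
              (ht.add_const (chordSq (y p.1) (y p.2))) (by simpa using hs)
            rw [zero_add, div_self hs] at this
            exact this
          simpa using this.mul_const (A p y)
  have hconst : (fun k : ℕ => ∫ y, Φ (1 / ((k : ℝ) + 1)) y ∂(boxMeasure n)) = fun _ => 0 :=
    funext fun k => hzero _ Nat.one_div_pos_of_nat
  rw [hconst] at hlim
  exact (tendsto_nhds_unique hlim tendsto_const_nhds)

end weight

/-- The power sum `∑_j e^{iky_j}`. -/
def ps {n : ℕ} (k : ℤ) (y : Fin n → ℝ) : ℂ := ∑ j, en k (y j)

/-- The first order operator `∑_j e^{imy_j} ∂_j`. -/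
def powD {n : ℕ} (m : ℕ) (F : (Fin n → ℝ) → ℂ) (y : Fin n → ℝ) : ℂ := ∑ j, en m (y j) * pd j F y

/-- The unnormalized expectation `∫ F · weight 0 c`. -/
def wInt {n : ℕ} (c : Fin n × Fin n → ℝ) (F : (Fin n → ℝ) → ℂ) : ℂ :=
  ∫ y, F y * weight 0 c y ∂(boxMeasure n)

section wInt

variable {n : ℕ} {c : Fin n × Fin n → ℝ} {F G : (Fin n → ℝ) → ℂ}

lemma integrable_mul_weight (hc : ∀ p, 0 ≤ c p) (hF : Continuous F) :
    Integrable (fun y => F y * (weight 0 c y : ℂ)) (boxMeasure n) :=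
  (hF.mul (Complex.continuous_ofReal.comp (continuous_weight hc 0))).integrable_boxMeasure

lemma wInt_add (hc : ∀ p, 0 ≤ c p) (hF : Continuous F) (hG : Continuous G) :
    wInt c (fun y => F y + G y) = wInt c F + wInt c G := by
  unfold wInt
  rw [← integral_add (integrable_mul_weight hc hF) (integrable_mul_weight hc hG)]
  simp only [add_mul]

lemma wInt_const_mul (z : ℂ) : wInt c (fun y => z * F y) = z * wInt c F := by
  unfold wInt
  rw [← integral_const_mul]
  simp only [mul_assoc]

lemma wInt_sub (hc : ∀ p, 0 ≤ c p) (hF : Continuous F) (hG : Continuous G) :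
    wInt c (fun y => F y - G y) = wInt c F - wInt c G := by
  unfold wInt
  rw [← integral_sub (integrable_mul_weight hc hF) (integrable_mul_weight hc hG)]
  simp only [sub_mul]

lemma wInt_sum (hc : ∀ p, 0 ≤ c p) {ι : Type*} {s : Finset ι} {F : ι → (Fin n → ℝ) → ℂ}
    (hF : ∀ i ∈ s, Continuous (F i)) :
    wInt c (fun y => ∑ i ∈ s, F i y) = ∑ i ∈ s, wInt c (F i) := by
  unfold wInt
  rw [← integral_finsetSum _ fun i hi => integrable_mul_weight hc (hF i hi)]
  simp only [Finset.sum_mul]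

lemma wInt_star : wInt c (fun y => star (F y)) = star (wInt c F) := by
  unfold wInt
  rw [Complex.star_def, ← integral_conj]
  simp

end wInt

section ps

variable {n : ℕ}

lemma torusC1_ps (k : ℤ) : TorusC1 (ps (n := n) k) := TorusC1.sum fun j _ => TorusC1.en k j

lemma pd_ps (k : ℤ) (j : Fin n) (y : Fin n → ℝ) : pd j (ps k) y = Complex.I * k * en k (y j) := by
  unfold ps
  rw [pd_sum fun i _ => TorusC1.en k i]
  simp [pd_en]

lemma ps_zero (y : Fin n → ℝ) : ps 0 y = n := by simp [ps]

lemma star_ps (k : ℤ) (y : Fin n → ℝ) : star (ps k y) = ps (-k) y := by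
  simp only [ps, star_sum, star_en]

lemma norm_ps_le (k : ℤ) (y : Fin n → ℝ) : ‖ps k y‖ ≤ n := by
  refine (norm_sum_le _ _).trans ?_
  simp [norm_en]

lemma continuous_powD (m : ℕ) {F : (Fin n → ℝ) → ℂ} (hF : TorusC1 F) : Continuous (powD m F) :=
  continuous_finsetSum _ fun j _ => (TorusC1.en m j).continuous.mul (hF.continuous_pd j)

lemma powD_mul (m : ℕ) {F G : (Fin n → ℝ) → ℂ} (hF : TorusC1 F) (hG : TorusC1 G)
    (y : Fin n → ℝ) :
    powD m (fun y => F y * G y) y = powD m F y * G y + F y * powD m G y := by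
  simp only [powD, pd_mul hF hG, Finset.sum_mul, Finset.mul_sum, ← Finset.sum_add_distrib]
  exact Finset.sum_congr rfl fun j _ => by ring

lemma powD_ps (m : ℕ) (k : ℤ) (y : Fin n → ℝ) :
    powD m (ps k) y = Complex.I * k * ps (m + k) y := by
  simp only [powD, pd_ps, ps, Finset.mul_sum, ← en_mul]
  exact Finset.sum_congr rfl fun j _ => by ring

lemma sum_sum_eq_two_mul_sum_pairs {f : Fin n → Fin n → ℂ} (hf : ∀ i j, f i j = f j i) :
    ∑ i, ∑ j, f i j = 2 * ∑ p ∈ pairs n, f p.1 p.2 + ∑ i, f i i := by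
  have h1 : ∑ i, ∑ j, f i j = ∑ i, ∑ j, ((if i < j then f i j else 0) + (if j < i then f j i else 0)
      + if i = j then f i i else 0) := by
    refine Finset.sum_congr rfl fun i _ => Finset.sum_congr rfl fun j _ => ?_
    rcases lt_trichotomy i j with h | h | h
    · simp [h, h.not_gt, h.ne]
    · simp [h]
    · simp [h, h.not_gt, h.ne', hf i j]
  have h2 : ∑ p ∈ pairs n, f p.1 p.2 = ∑ i, ∑ j, if i < j then f i j else 0 := by
    rw [pairs, Finset.sum_filter, ← Finset.univ_product_univ, Finset.sum_product]
  rw [h1, h2]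
  simp only [Finset.sum_add_distrib]
  rw [Finset.sum_comm (f := fun i j => if j < i then f j i else 0)]
  simp only [Finset.sum_ite_eq, Finset.mem_univ, if_true]
  ring

lemma sum_pairs_eq (m : ℕ) (y : Fin n → ℝ) :
    ∑ p ∈ pairs n, (en 1 (y p.1) + en 1 (y p.2)) *
      ∑ r ∈ Finset.range m, en r (y p.1) * en (m - 1 - r : ℕ) (y p.2)
      = ∑ r ∈ Finset.range m, ps r y * ps (m - r : ℕ) y - m * ps m y := by
  have hfs : ∀ i j : Fin n, (en 1 (y i) + en 1 (y j)) *
        ∑ r ∈ Finset.range m, en r (y i) * en (m - 1 - r : ℕ) (y j)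
      = (en 1 (y j) + en 1 (y i)) *
        ∑ r ∈ Finset.range m, en r (y j) * en (m - 1 - r : ℕ) (y i) := by
    intro i j
    rw [add_comm, ← Finset.sum_range_reflect]
    congr 1
    refine Finset.sum_congr rfl fun r hr => ?_
    rw [Finset.mem_range] at hr
    rw [mul_comm, show m - 1 - (m - 1 - r) = r by omega]
  have h := sum_sum_eq_two_mul_sum_pairs hfs
  have hd : ∑ i, (en 1 (y i) + en 1 (y i)) *
      ∑ r ∈ Finset.range m, en r (y i) * en (m - 1 - r : ℕ) (y i) = 2 * (m * ps m y) := by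
    simp only [ps, Finset.mul_sum]
    refine Finset.sum_congr rfl fun i _ => ?_
    rw [Finset.sum_congr rfl (g := fun _ => 2 * en m (y i))]
    · simp; ring
    · intro r hr
      rw [Finset.mem_range] at hr
      rw [en_mul, ← two_mul, mul_assoc, en_mul]
      congr 2
      omega
  have hs : ∑ i, ∑ j, (en 1 (y i) + en 1 (y j)) *
      ∑ r ∈ Finset.range m, en r (y i) * en (m - 1 - r : ℕ) (y j)
      = 2 * ∑ r ∈ Finset.range m, ps r y * ps (m - r : ℕ) y := by
    have hr : ∑ r ∈ Finset.range m, ps r y * ps (m - r : ℕ) y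
        = ∑ r ∈ Finset.range m, ps (r + 1 : ℕ) y * ps (m - 1 - r : ℕ) y := by
      rw [← Finset.sum_range_reflect]
      refine Finset.sum_congr rfl fun r hr => ?_
      rw [Finset.mem_range] at hr
      rw [mul_comm, show m - (m - 1 - r) = r + 1 by omega]
    rw [two_mul]
    nth_rw 1 [hr]
    rw [← Finset.sum_add_distrib]
    have : ∀ r ∈ Finset.range m, ps (r + 1 : ℕ) y * ps (m - 1 - r : ℕ) y
        + ps r y * ps (m - r : ℕ) y
        = ∑ i, ∑ j, (en 1 (y i) + en 1 (y j)) * (en r (y i) * en (m - 1 - r : ℕ) (y j)) := by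
      intro r hr
      rw [Finset.mem_range] at hr
      simp only [ps, Finset.sum_mul_sum, ← Finset.sum_add_distrib]
      refine Finset.sum_congr rfl fun i _ => Finset.sum_congr rfl fun j _ => ?_
      rw [show m - r = (m - 1 - r) + 1 by omega]
      push_cast
      rw [← en_mul, ← en_mul]
      ring
    rw [Finset.sum_congr rfl this]
    refine .symm (Finset.sum_comm.trans (Finset.sum_congr rfl fun i _ => ?_))
    refine Finset.sum_comm.trans (Finset.sum_congr rfl fun j _ => ?_)
    rw [Finset.mul_sum]
  rw [hs, hd] at h
  linear_combination -(1 / 2 : ℂ) * h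

/-- The loop equations of the circular ensemble. -/
theorem wInt_powD {l : ℝ} (hl : 0 ≤ l) (m : ℕ) {F : (Fin n → ℝ) → ℂ} (hF : TorusC1 F) :
    wInt (fun _ => l) (powD m F) = -Complex.I * wInt (fun _ => l) (fun y => (m * ps m y
      + l * (∑ r ∈ Finset.range m, ps r y * ps (m - r : ℕ) y - m * ps m y)) * F y) := by
  have hc : ∀ p : Fin n × Fin n, 0 ≤ (fun _ => l : Fin n × Fin n → ℝ) p := fun _ => hl
  have key := integral_divergence_weight hc (G := fun j y => en m (y j) * F y)
    (A := fun p y => Complex.I * ((en 1 (y p.1) + en 1 (y p.2)) *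
      ∑ r ∈ Finset.range m, en r (y p.1) * en (m - 1 - r : ℕ) (y p.2)) * F y)
    (fun j => (TorusC1.en m j).mul hF)
    (fun p => by
      have h : ∀ (k : ℤ) (j : Fin n), Continuous fun y : Fin n → ℝ => en k (y j) :=
        fun k j => (TorusC1.en k j).continuous
      refine Continuous.mul (continuous_const.mul (Continuous.mul ((h _ _).add (h _ _))
        (continuous_finsetSum _ fun r _ => (h _ _).mul (h _ _)))) hF.continuous)
    (fun p _ y => by
      have := en_sub_en_mul_sin m (y p.1) (y p.2)
      rw [chordSq]
      linear_combination F y * this)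
  rw [← wInt_const_mul, ← sub_eq_zero, ← wInt_sub hc (continuous_powD m hF), wInt, ← key]
  · congr 1
    funext y
    congr 1
    rw [← Finset.mul_sum, ← Finset.sum_mul, ← Finset.mul_sum, sum_pairs_eq]
    simp only [pd_mul (TorusC1.en m _) hF, pd_en, if_true]
    rw [Finset.sum_add_distrib, powD, ps, Finset.mul_sum]
    have : ∑ j, Complex.I * ((m : ℤ) : ℂ) * en m (y j) * F y
        = Complex.I * (∑ j, m * en m (y j)) * F y := by
      rw [Finset.mul_sum, Finset.sum_mul]
      exact Finset.sum_congr rfl fun j _ => by push_cast; ring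
    rw [this]
    ring
  · have h : ∀ k : ℤ, Continuous (ps (n := n) k) := fun k => (torusC1_ps k).continuous
    have hsum : Continuous fun y : Fin n → ℝ => ∑ r ∈ Finset.range m, ps r y * ps (m - r : ℕ) y :=
      continuous_finsetSum _ fun r _ => (h _).mul (h _)
    exact continuous_const.mul (((continuous_const.mul (h _)).add (continuous_const.mul
      (hsum.sub (continuous_const.mul (h _))))).mul hF.continuous)

lemma wInt_ps_mul_star_ps {l : ℝ} (hl : 0 ≤ l) {j k : ℤ} (hjk : j ≠ k) :
    wInt (fun _ => l) (fun y : Fin n → ℝ => ps j y * star (ps k y)) = 0 := by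
  have h := wInt_powD (n := n) hl 0 ((torusC1_ps j).mul (torusC1_ps (-k)))
  have h2 : powD 0 (fun y : Fin n → ℝ => ps j y * ps (-k) y)
      = fun y => (Complex.I * (j - k)) * (ps j y * ps (-k) y) := by
    funext y
    rw [powD_mul 0 (torusC1_ps _) (torusC1_ps _), powD_ps, powD_ps]
    simp
    ring
  rw [h2, wInt_const_mul] at h
  simp only [star_ps]
  have h3 : (Complex.I * (j - k) : ℂ) ≠ 0 :=
    mul_ne_zero Complex.I_ne_zero (sub_ne_zero.2 (by exact_mod_cast hjk))
  refine (mul_eq_zero.1 (h.trans ?_)).resolve_left h3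
  simp [wInt]

end ps

/-- `PowerPoly n k A f` means that `f` is a linear combination of products of power sums of total
degree `k`, with coefficients of `ℓ¹` norm at most `A`. -/
inductive PowerPoly (n : ℕ) : ℕ → ℝ → ((Fin n → ℝ) → ℂ) → Prop
  | one : PowerPoly n 0 1 fun _ => 1
  | zero (k : ℕ) : PowerPoly n k 0 fun _ => 0
  | ps_mul {m k : ℕ} {A : ℝ} {f : (Fin n → ℝ) → ℂ} (hm : 1 ≤ m) (hf : PowerPoly n k A f) :
      PowerPoly n (k + m) A fun y => ps m y * f y
  | add {k : ℕ} {A B : ℝ} {f g : (Fin n → ℝ) → ℂ} (hf : PowerPoly n k A f)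
      (hg : PowerPoly n k B g) : PowerPoly n k (A + B) fun y => f y + g y
  | smul {k : ℕ} {A : ℝ} {f : (Fin n → ℝ) → ℂ} (z : ℂ) (hf : PowerPoly n k A f) :
      PowerPoly n k (‖z‖ * A) fun y => z * f y
  | mono {k : ℕ} {A B : ℝ} {f : (Fin n → ℝ) → ℂ} (hAB : A ≤ B) (hf : PowerPoly n k A f) :
      PowerPoly n k B f

namespace PowerPoly

variable {n k : ℕ} {A : ℝ} {f : (Fin n → ℝ) → ℂ}

lemma nonneg (hf : PowerPoly n k A f) : 0 ≤ A := by
  induction hf with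
  | one => exact zero_le_one
  | zero => exact le_rfl
  | ps_mul _ _ ih => exact ih
  | add _ _ h1 h2 => exact add_nonneg h1 h2
  | smul z _ ih => exact mul_nonneg (norm_nonneg z) ih
  | mono h _ ih => exact ih.trans h

lemma torusC1 (hf : PowerPoly n k A f) : TorusC1 f := by
  induction hf with
  | one => exact TorusC1.const 1
  | zero => exact TorusC1.const 0
  | ps_mul _ _ ih => exact (torusC1_ps _).mul ih
  | add _ _ h1 h2 => exact h1.add h2
  | smul z _ ih => exact (TorusC1.const z).mul ih
  | mono h _ ih => exact ih

lemma norm_le (hn : 1 ≤ n) (hf : PowerPoly n k A f) (y : Fin n → ℝ) : ‖f y‖ ≤ A * n ^ k := by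
  have hn' : (1 : ℝ) ≤ n := by exact_mod_cast hn
  induction hf with
  | one => simp
  | zero => simp
  | @ps_mul m k A f hm hf ih =>
    rw [norm_mul]
    calc ‖ps m y‖ * ‖f y‖ ≤ (n : ℝ) ^ m * (A * n ^ k) :=
          mul_le_mul ((norm_ps_le _ _).trans (le_self_pow₀ hn' (by omega))) ih (norm_nonneg _)
            (by positivity)
      _ = _ := by rw [pow_add]; ring
  | add _ _ h1 h2 => rw [add_mul]; exact (norm_add_le _ _).trans (add_le_add h1 h2)
  | smul z _ ih =>
    rw [norm_mul, mul_assoc]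
    exact mul_le_mul_of_nonneg_left ih (norm_nonneg _)
  | mono h _ ih => exact ih.trans (mul_le_mul_of_nonneg_right h (by positivity))

lemma cast {l : ℕ} {B : ℝ} {g : (Fin n → ℝ) → ℂ} (hf : PowerPoly n k A f) (hkl : k = l)
    (hAB : A ≤ B) (hfg : ∀ y, g y = f y) : PowerPoly n l B g := by
  obtain rfl := hkl
  obtain rfl : g = f := funext hfg
  exact hf.mono hAB

lemma sum {ι : Type*} (s : Finset ι) {F : ι → (Fin n → ℝ) → ℂ}
    (hF : ∀ i ∈ s, PowerPoly n k A (F i)) :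
    PowerPoly n k (s.card * A) fun y => ∑ i ∈ s, F i y := by
  classical
  induction s using Finset.induction_on with
  | empty => simpa using zero k
  | insert a s ha ih =>
    refine ((hF a (Finset.mem_insert_self _ _)).add
      (ih fun i hi => hF i (Finset.mem_insert_of_mem hi))).cast rfl (le_of_eq ?_) fun y => ?_
    · rw [Finset.card_insert_of_notMem ha]; push_cast; ring
    · rw [Finset.sum_insert ha]

lemma powD (hf : PowerPoly n k A f) (m : ℕ) : PowerPoly n (k + m) (k * A) (powD m f) := by
  have hconst : ∀ z : ℂ, ∀ y, _root_.powD m (fun _ : Fin n → ℝ => z) y = 0 := by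
    simp [_root_.powD, pd_const]
  induction hf with
  | one => exact (zero _).cast rfl (by simp) (hconst 1)
  | zero k => exact (zero _).cast rfl (by simp) (hconst 0)
  | @ps_mul j k A f hj hf ih =>
    refine (((hf.ps_mul (m := m + j) (by omega)).smul (Complex.I * j)).add
      ((ih.ps_mul hj).cast (l := k + (m + j)) (by omega) le_rfl fun _ => rfl)).cast (B := ((k + j : ℕ) : ℝ) * A) (by omega) (le_of_eq ?_) fun y => ?_
    · simp; ring
    · rw [powD_mul m (torusC1_ps _) hf.torusC1, powD_ps]
      push_cast
      ring
  | @add k A B f g hf hg h1 h2 =>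
    refine (h1.add h2).cast rfl (by rw [mul_add]) fun y => ?_
    simp only [_root_.powD, pd_add hf.torusC1 hg.torusC1, mul_add, Finset.sum_add_distrib]
  | @smul k A f z hf ih =>
    refine (ih.smul z).cast rfl (le_of_eq (by ring)) fun y => ?_
    rw [powD_mul m (TorusC1.const z) hf.torusC1, hconst]
    ring
  | mono h hf ih => exact ih.mono (mul_le_mul_of_nonneg_left h (Nat.cast_nonneg _))

end PowerPoly

/-- The Dirichlet form `∫ ∑_j ∂_j f ∂_j H`. -/
def dirichlet {n : ℕ} (l : ℝ) (f H : (Fin n → ℝ) → ℂ) : ℂ :=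
  wInt (fun _ => l) fun y => ∑ j, pd j f y * pd j H y

section dirichlet

variable {n : ℕ} {l : ℝ}

lemma dirichlet_const (z : ℂ) (H : (Fin n → ℝ) → ℂ) : dirichlet l (fun _ => z) H = 0 := by
  simp [dirichlet, pd_const, wInt]

lemma continuous_dirichlet {f H : (Fin n → ℝ) → ℂ} (hf : TorusC1 f) (hH : TorusC1 H) :
    Continuous fun y => ∑ j, pd j f y * pd j H y :=
  continuous_finsetSum _ fun j _ => (hf.continuous_pd j).mul (hH.continuous_pd j)

lemma dirichlet_add (hl : 0 ≤ l) {f g H : (Fin n → ℝ) → ℂ} (hf : TorusC1 f) (hg : TorusC1 g)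
    (hH : TorusC1 H) :
    dirichlet l (fun y => f y + g y) H = dirichlet l f H + dirichlet l g H := by
  unfold dirichlet
  rw [← wInt_add (fun _ => hl) (continuous_dirichlet hf hH) (continuous_dirichlet hg hH)]
  simp only [pd_add hf hg, add_mul, Finset.sum_add_distrib]

lemma dirichlet_const_mul {f H : (Fin n → ℝ) → ℂ} (hf : TorusC1 f) (z : ℂ) :
    dirichlet l (fun y => z * f y) H = z * dirichlet l f H := by
  unfold dirichlet
  rw [← wInt_const_mul]
  congr 1
  funext y
  rw [Finset.mul_sum]
  refine Finset.sum_congr rfl fun j _ => ?_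
  rw [pd_mul (TorusC1.const z) hf, pd_const]
  ring

lemma dirichlet_ps_mul (hl : 0 ≤ l) (m : ℕ) {f H : (Fin n → ℝ) → ℂ} (hf : TorusC1 f)
    (hH : TorusC1 H) :
    dirichlet l (fun y => ps m y * f y) H = dirichlet l f (fun y => ps m y * H y)
      + Complex.I * m * (wInt (fun _ => l) (powD m (fun y => f y * H y))
        - 2 * wInt (fun _ => l) (fun y => powD m f y * H y)) := by
  have hc : ∀ p : Fin n × Fin n, 0 ≤ (fun _ => l : Fin n × Fin n → ℝ) p := fun _ => hl
  have h1 := (continuous_powD m (hf.mul hH))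
  have h2 : Continuous fun y => powD m f y * H y := (continuous_powD m hf).mul hH.continuous
  have h2' : Continuous fun y => 2 * (powD m f y * H y) := continuous_const.mul h2
  have h3 := continuous_dirichlet hf ((torusC1_ps m).mul hH)
  unfold dirichlet
  rw [← wInt_const_mul 2, ← wInt_sub hc h1 h2', ← wInt_const_mul,
    ← wInt_add hc h3 (by fun_prop)]
  congr 1
  funext y
  rw [powD_mul m hf hH]
  simp only [pd_mul (torusC1_ps m) hf, pd_mul (torusC1_ps m) hH, pd_ps, powD]
  simp only [Finset.mul_sum, Finset.sum_mul, ← Finset.sum_add_distrib, ← Finset.sum_sub_distrib]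
  refine Finset.sum_congr rfl fun j _ => ?_
  push_cast
  ring

/-- On power sum polynomials the generator is a multiple of `n` up to a bounded error. -/
theorem exists_dirichlet_eq (hl : 0 ≤ l) {k : ℕ} {A : ℝ} {f : (Fin n → ℝ) → ℂ}
    (hf : PowerPoly n k A f) :
    ∃ g, PowerPoly n k ((1 + 2 * l) * k ^ 2 * A) g ∧ ∀ H : (Fin n → ℝ) → ℂ, TorusC1 H →
      dirichlet l f H = wInt (fun _ => l) fun y => (l * n * k * f y + g y) * H y := by
  have hc : ∀ p : Fin n × Fin n, 0 ≤ (fun _ => l : Fin n × Fin n → ℝ) p := fun _ => hl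
  induction hf with
  | one =>
    refine ⟨fun _ => 0, (PowerPoly.zero 0).mono (by simp), fun H _ => ?_⟩
    rw [dirichlet_const]
    simp [wInt]
  | zero k =>
    refine ⟨fun _ => 0, (PowerPoly.zero k).mono (by simp), fun H _ => ?_⟩
    rw [dirichlet_const]
    simp [wInt]
  | @ps_mul m k A f hm hf ih =>
    obtain ⟨g, hg, hgH⟩ := ih
    have hA := hf.nonneg
    refine ⟨fun y => ps m y * g y + ((-2 * Complex.I * m) * powD m f y
      + (((m : ℂ) ^ 2 - l * m ^ 2) * (ps m y * f y)
        + (l * m) * ∑ r ∈ Finset.Ico 1 m, ps r y * (ps (m - r : ℕ) y * f y))), ?_, ?_⟩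
    · refine ((hg.ps_mul hm).add (((hf.powD m).smul _).add
        (((hf.ps_mul hm).smul _).add (PowerPoly.smul _ (PowerPoly.sum (k := k + m) (A := A) _ fun r hr => ?_))))).cast
          rfl ?_ fun y => rfl
      · rw [Finset.mem_Ico] at hr
        exact ((hf.ps_mul (m := m - r) (by omega)).ps_mul hr.1).cast (by omega) le_rfl fun y => rfl
      · have e1 : ‖(-2 * Complex.I * m : ℂ)‖ = 2 * m := by simp
        have e2 : ‖((m : ℂ) ^ 2 - l * m ^ 2)‖ ≤ (1 + l) * m ^ 2 := by
          refine (norm_sub_le _ _).trans (le_of_eq ?_)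
          simp [abs_of_nonneg hl]; ring
        have e3 : ‖(l * m : ℂ)‖ = l * m := by simp [abs_of_nonneg hl]
        have e4 : (((Finset.Ico 1 m).card : ℕ) : ℝ) ≤ m := by simp
        rw [e1, e3]
        have e5 : l * m * ((Finset.Ico 1 m).card * A) ≤ l * m * (m * A) := by gcongr
        have e6 := mul_le_mul_of_nonneg_right e2 hA
        have e7 : 0 ≤ l * m * k * A := by positivity
        push_cast
        nlinarith
    · intro H hH
      have hcp : ∀ k : ℤ, Continuous (ps (n := n) k) := fun k => (torusC1_ps k).continuous
      have hfc := hf.torusC1.continuous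
      have hgc := hg.torusC1.continuous
      have hHc := hH.continuous
      have hDc := continuous_powD m hf.torusC1
      have hsc : Continuous fun y : Fin n → ℝ => ∑ r ∈ Finset.range m, ps r y * ps (m - r : ℕ) y :=
        continuous_finsetSum _ fun r _ => (hcp _).mul (hcp _)
      rw [dirichlet_ps_mul hl m hf.torusC1 hH, hgH _ ((torusC1_ps m).mul hH),
        wInt_powD hl m (hf.torusC1.mul hH), ← wInt_const_mul, ← wInt_const_mul,
        ← wInt_sub hc (by fun_prop) (by fun_prop), ← wInt_const_mul,
        ← wInt_add hc (by fun_prop) (by fun_prop)]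
      congr 1
      funext y
      have hr : ∑ r ∈ Finset.range m, ps r y * ps (m - r : ℕ) y
          = n * ps m y + ∑ r ∈ Finset.Ico 1 m, ps r y * ps (m - r : ℕ) y := by
        rw [Finset.range_eq_Ico, ← Finset.sum_Ioo_add_eq_sum_Ico (by omega), add_comm]
        simp [ps_zero]
        rfl
      have hr2 : ∑ r ∈ Finset.Ico 1 m, ps r y * (ps (m - r : ℕ) y * f y)
          = (∑ r ∈ Finset.Ico 1 m, ps r y * ps (m - r : ℕ) y) * f y := by
        rw [Finset.sum_mul]
        exact Finset.sum_congr rfl fun r _ => by ring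
      beta_reduce
      rw [hr, hr2]
      generalize ∑ r ∈ Finset.Ico 1 m, ps r y * ps (m - r : ℕ) y = S
      push_cast
      linear_combination (-(m * ((m * ps m y + l * (n * ps m y + S - m * ps m y)) * (f y * H y)))) * Complex.I_sq
  | @add k A B f g hf hg h1 h2 =>
    obtain ⟨u, hu, huH⟩ := h1
    obtain ⟨v, hv, hvH⟩ := h2
    refine ⟨fun y => u y + v y, (hu.add hv).mono (by rw [mul_add]), fun H hH => ?_⟩
    have hfc := hf.torusC1.continuous
    have hgc := hg.torusC1.continuous
    have huc := hu.torusC1.continuous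
    have hvc := hv.torusC1.continuous
    have hHc := hH.continuous
    rw [dirichlet_add hl hf.torusC1 hg.torusC1 hH, huH H hH, hvH H hH,
      ← wInt_add hc (by fun_prop) (by fun_prop)]
    congr 1
    funext y
    ring
  | @smul k A f z hf ih =>
    obtain ⟨g, hg, hgH⟩ := ih
    refine ⟨fun y => z * g y, (hg.smul z).mono (le_of_eq (by ring)), fun H hH => ?_⟩
    rw [dirichlet_const_mul hf.torusC1, hgH H hH, ← wInt_const_mul]
    congr 1
    funext y
    ring
  | @mono k A B f h hf ih =>
    obtain ⟨g, hg, hgH⟩ := ih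
    exact ⟨g, hg.mono (by gcongr), hgH⟩

end dirichlet

lemma le_mul_of_sq_le_mul {u : ℕ → ℝ} {M r : ℝ} (hu : ∀ j, 0 ≤ u j) (hr : 0 < r)
    (hconv : ∀ j, u (j + 1) ^ 2 ≤ u j * u (j + 2)) (hbound : ∀ j, u j ≤ M * r ^ j) :
    u 1 ≤ r * u 0 := by
  by_contra! hlt
  have h1 : 0 < u 1 := lt_of_le_of_lt (mul_nonneg hr.le (hu 0)) hlt
  have h0 : 0 < u 0 := by
    refine lt_of_le_of_ne (hu 0) fun h => ?_
    have := hconv 0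
    rw [← h, zero_mul] at this
    nlinarith
  have hq : 0 < u 1 / u 0 := div_pos h1 h0
  have hstep : ∀ j, 0 < u j ∧ u 1 / u 0 * u j ≤ u (j + 1) := by
    intro j
    induction j with
    | zero => exact ⟨h0, by rw [div_mul_cancel₀ _ h0.ne']⟩
    | succ j ih =>
      have hj : 0 < u (j + 1) := lt_of_lt_of_le (mul_pos hq ih.1) ih.2
      refine ⟨hj, ?_⟩
      have h2 := hconv j
      have h3 : u 1 / u 0 * u j * u (j + 1) ≤ u j * u (j + 2) := by
        refine le_trans ?_ h2
        rw [sq]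
        exact mul_le_mul_of_nonneg_right ih.2 hj.le
      have h4 : u j * (u 1 / u 0 * u (j + 1)) ≤ u j * u (j + 2) := by linarith
      exact le_of_mul_le_mul_left h4 ih.1
  have hpow : ∀ j, (u 1 / u 0) ^ j * u 0 ≤ u j := by
    intro j
    induction j with
    | zero => simp
    | succ j ih =>
      refine le_trans ?_ (hstep j).2
      rw [pow_succ', mul_assoc]
      exact mul_le_mul_of_nonneg_left ih hq.le
  have hone : 1 < u 1 / u 0 / r := by
    rw [lt_div_iff₀ hr, lt_div_iff₀ h0]
    linarith
  obtain ⟨j, hj⟩ := pow_unbounded_of_one_lt (M / u 0) hone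
  have := (hpow j).trans (hbound j)
  rw [div_pow, div_lt_div_iff₀ h0 (pow_pos hr j)] at hj
  linarith

/-- The unnormalized second moment `∫ ‖f‖² · weight`. -/
def wSq {n : ℕ} (l : ℝ) (f : (Fin n → ℝ) → ℂ) : ℝ :=
  ∫ y, ‖f y‖ ^ 2 * weight 0 (fun _ => l) y ∂(boxMeasure n)

section wSq

variable {n : ℕ} {l : ℝ}

lemma wSq_nonneg (f : (Fin n → ℝ) → ℂ) : 0 ≤ wSq l f :=
  integral_nonneg fun y => mul_nonneg (by positivity) (weight_nonneg le_rfl y)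

lemma integrable_mul_weight_real {c : Fin n × Fin n → ℝ} (hc : ∀ p, 0 ≤ c p)
    {F : (Fin n → ℝ) → ℝ} (hF : Continuous F) :
    Integrable (fun y => F y * weight 0 c y) (boxMeasure n) :=
  (hF.mul (continuous_weight hc 0)).integrable_boxMeasure

lemma wInt_mul_star_self (f : (Fin n → ℝ) → ℂ) :
    wInt (fun _ => l) (fun y => f y * star (f y)) = (wSq l f : ℂ) := by
  rw [wInt, wSq, ← integral_complex_ofReal]
  congr 1
  funext y
  rw [Complex.star_def, Complex.mul_conj, Complex.normSq_eq_norm_sq]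
  push_cast
  rfl

lemma norm_wInt_mul_star_sq_le (hl : 0 ≤ l) {f g : (Fin n → ℝ) → ℂ} (hf : Continuous f)
    (hg : Continuous g) :
    ‖wInt (fun _ => l) (fun y => f y * star (g y))‖ ^ 2 ≤ wSq l f * wSq l g := by
  have hc : ∀ p : Fin n × Fin n, 0 ≤ (fun _ => l : Fin n × Fin n → ℝ) p := fun _ => hl
  set b := ∫ y, ‖f y‖ * ‖g y‖ * weight 0 (fun _ => l) y ∂(boxMeasure n) with hb
  have h1 : ‖wInt (fun _ => l) (fun y => f y * star (g y))‖ ≤ b := by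
    refine (norm_integral_le_integral_norm _).trans (le_of_eq ?_)
    rw [hb]
    congr 1
    funext y
    rw [norm_mul, norm_mul, norm_star, Complex.norm_real, Real.norm_of_nonneg (weight_nonneg le_rfl y)]
  have h2 : ∀ t : ℝ, 0 ≤ wSq l f * (t * t) + (-2 * b) * t + wSq l g := by
    intro t
    have hi1 := integrable_mul_weight_real hc (F := fun y => ‖f y‖ ^ 2) (by fun_prop)
    have hi2 := integrable_mul_weight_real hc (F := fun y => ‖f y‖ * ‖g y‖) (by fun_prop)
    have hi3 := integrable_mul_weight_real hc (F := fun y => ‖g y‖ ^ 2) (by fun_prop)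
    have : wSq l f * (t * t) + (-2 * b) * t + wSq l g
        = ∫ y, (t * ‖f y‖ - ‖g y‖) ^ 2 * weight 0 (fun _ => l) y ∂(boxMeasure n) := by
      rw [wSq, wSq, hb, mul_comm (-2 : ℝ), mul_assoc, ← integral_mul_const, ← integral_mul_const,
        ← integral_add (hi1.mul_const _) (hi2.mul_const _), ← integral_add _ hi3]
      · congr 1
        funext y
        ring
      · exact (hi1.mul_const _).add (hi2.mul_const _)
    rw [this]
    exact integral_nonneg fun y => mul_nonneg (sq_nonneg _) (weight_nonneg le_rfl y)
  have h3 := discrim_le_zero h2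
  rw [discrim] at h3
  calc _ ≤ b ^ 2 := pow_le_pow_left₀ (norm_nonneg _) h1 2
    _ ≤ _ := by linarith

lemma PowerPoly.wSq_le (hl : 0 ≤ l) (hn : 1 ≤ n) {k : ℕ} {A : ℝ} {f : (Fin n → ℝ) → ℂ}
    (hf : PowerPoly n k A f) : wSq l f ≤ (A * n ^ k) ^ 2 * wSq (n := n) l fun _ => 1 := by
  have hc : ∀ p : Fin n × Fin n, 0 ≤ (fun _ => l : Fin n × Fin n → ℝ) p := fun _ => hl
  unfold wSq
  rw [← integral_const_mul]
  refine integral_mono (integrable_mul_weight_real hc (hf.torusC1.continuous.norm.pow 2))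
    ((integrable_mul_weight_real hc (by fun_prop)).const_mul _) fun y => ?_
  have h1 := pow_le_pow_left₀ (norm_nonneg _) (hf.norm_le hn y) 2
  have h2 := mul_le_mul_of_nonneg_right h1 (weight_nonneg (c := fun _ => l) le_rfl y)
  simpa using h2

lemma star_dirichlet {f g : (Fin n → ℝ) → ℂ} (hf : TorusC1 f) (hg : TorusC1 g) :
    star (dirichlet l f fun y => star (g y)) = dirichlet l g fun y => star (f y) := by
  rw [dirichlet, dirichlet, ← wInt_star]
  congr 1
  funext y
  rw [star_sum]
  refine Finset.sum_congr rfl fun j _ => ?_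
  rw [pd_star hf, pd_star hg, star_mul, star_star]

lemma exists_generator_seq (hl : 0 ≤ l) {k : ℕ} (hk : 1 ≤ k) :
    ∃ F : ℕ → (Fin n → ℝ) → ℂ, F 0 = ps k ∧
      (∀ j, PowerPoly n k (((1 + 2 * l) * k ^ 2) ^ j) (F j)) ∧
      ∀ j, ∀ H : (Fin n → ℝ) → ℂ, TorusC1 H →
        dirichlet l (F j) H = wInt (fun _ => l) fun y => (l * n * k * F j y + F (j + 1) y) * H y := by
  have h0 : PowerPoly n k 1 (ps k) :=
    (PowerPoly.one.ps_mul hk).cast (by omega) le_rfl fun y => by simp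
  choose! g hg using fun (A : ℝ) (f : (Fin n → ℝ) → ℂ) (hf : PowerPoly n k A f) =>
    exists_dirichlet_eq hl hf
  set R : ℝ := (1 + 2 * l) * k ^ 2 with hR
  let F : ℕ → (Fin n → ℝ) → ℂ := fun j => Nat.rec (ps k) (fun j f => g (R ^ j) f) j
  have hF : ∀ j, PowerPoly n k (R ^ j) (F j) := by
    intro j
    induction j with
    | zero => simpa [F] using h0
    | succ j ih => exact (hg _ _ ih).1.mono (le_of_eq (by rw [pow_succ']))
  exact ⟨F, rfl, hF, fun j H hH => (hg _ _ (hF j)).2 H hH⟩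

/-- Second moments of low power sums, from the spectral bound for the generator. -/
theorem abs_wSq_ps_sub_le (hl : 0 ≤ l) (hn : 1 ≤ n) {k : ℕ} (hk : 1 ≤ k) :
    |k * n * (wSq (n := n) l fun _ => 1) - l * n * wSq (n := n) l (ps k)|
      ≤ (1 + 2 * l) * k * wSq (n := n) l (ps k) := by
  have hc : ∀ p : Fin n × Fin n, 0 ≤ (fun _ => l : Fin n × Fin n → ℝ) p := fun _ => hl
  obtain ⟨F, hF0, hF, hD⟩ := exists_generator_seq (n := n) hl hk
  set R : ℝ := (1 + 2 * l) * k ^ 2 with hR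
  have hk' : (0 : ℝ) < k := by exact_mod_cast hk
  have hRpos : 0 < R := by positivity
  have hC : ∀ j, Continuous (F j) := fun j => (hF j).torusC1.continuous
  have hdir : ∀ i j, wInt (fun _ => l) (fun y => F (i + 1) y * star (F j y))
      = dirichlet l (F i) (fun y => star (F j y))
        - l * n * k * wInt (fun _ => l) (fun y => F i y * star (F j y)) := by
    intro i j
    have := hC i
    have := hC j
    have := hC (i + 1)
    rw [hD i _ (hF j).torusC1.star, ← wInt_const_mul, ← wInt_sub hc (by fun_prop) (by fun_prop)]
    congr 1
    funext y
    ring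
  have hsymm : ∀ i j, wInt (fun _ => l) (fun y => F (i + 1) y * star (F j y))
      = wInt (fun _ => l) (fun y => F i y * star (F (j + 1) y)) := by
    intro i j
    have hs : ∀ i j, star (wInt (fun _ => l) (fun y => F i y * star (F j y)))
        = wInt (fun _ => l) (fun y => F j y * star (F i y)) := by
      intro i j
      rw [← wInt_star]
      congr 1
      funext y
      rw [star_mul, star_star]
    rw [hdir i j, ← hs (j + 1) i, hdir j i, star_sub, star_dirichlet (hF j).torusC1 (hF i).torusC1,
      star_mul, hs]
    simp
    ring
  have hmain : wSq l (F 1) ≤ R ^ 2 * wSq l (F 0) := by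
    refine le_mul_of_sq_le_mul (u := fun j => wSq l (F j))
      (M := (n ^ k : ℝ) ^ 2 * wSq (n := n) l fun _ => 1) (fun j => wSq_nonneg _) (by positivity)
      (fun j => ?_) (fun j => ?_)
    · have h1 := norm_wInt_mul_star_sq_le hl (hC (j + 2)) (hC j)
      rw [hsymm, wInt_mul_star_self, Complex.norm_real, Real.norm_eq_abs, sq_abs] at h1
      linarith
    · refine ((hF j).wSq_le hl hn).trans (le_of_eq ?_)
      rw [mul_pow, ← pow_mul R j 2, ← pow_mul R 2 j, mul_comm j 2]
      ring
  have hcs : ‖wInt (fun _ => l) (fun y => F 1 y * star (F 0 y))‖ ≤ R * wSq l (F 0) := by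
    refine le_of_sq_le_sq ?_ (mul_nonneg hRpos.le (wSq_nonneg _))
    refine (norm_wInt_mul_star_sq_le hl (hC 1) (hC 0)).trans ?_
    have := mul_le_mul_of_nonneg_right hmain (wSq_nonneg (l := l) (F 0))
    linarith
  have hdir0 : dirichlet (n := n) l (ps k) (fun y => star (ps k y))
      = ((k ^ 2 * n * wSq (n := n) l fun _ => 1 : ℝ) : ℂ) := by
    push_cast
    rw [← wInt_mul_star_self, ← wInt_const_mul, dirichlet]
    congr 1
    funext y
    have : ∀ j : Fin n, pd j (ps (n := n) k) y * pd j (fun y => star (ps (n := n) k y)) y = k ^ 2 := by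
      intro j
      rw [pd_star (torusC1_ps _), pd_ps, Complex.star_def, Complex.mul_conj,
        Complex.normSq_eq_norm_sq]
      simp [norm_en]
    rw [Finset.sum_congr rfl fun j _ => this j]
    simp
    ring
  rw [show (1 : ℕ) = 0 + 1 from rfl, hdir 0 0, hF0, hdir0, wInt_mul_star_self] at hcs
  have hreal : ((k ^ 2 * n * (wSq (n := n) l fun _ => 1) : ℝ) : ℂ)
      - l * n * k * (wSq (n := n) l (ps k) : ℝ)
      = ((k * (k * n * (wSq (n := n) l fun _ => 1) - l * n * wSq (n := n) l (ps k)) : ℝ) : ℂ) := by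
    push_cast
    ring
  rw [hreal, Complex.norm_real, Real.norm_eq_abs, abs_mul, abs_of_pos hk'] at hcs
  refine le_of_mul_le_mul_left (hcs.trans (le_of_eq ?_)) hk'
  rw [hR]
  ring

end wSq

section fejer

variable {n : ℕ}

lemma norm_ps_sq (k : ℤ) (y : Fin n → ℝ) :
    ((‖ps k y‖ ^ 2 : ℝ) : ℂ) = ∑ i, ∑ j, en k (y i - y j) := by
  rw [← Complex.normSq_eq_norm_sq, ← Complex.mul_conj, ← Complex.star_def, star_ps, ps, ps,
    Finset.sum_mul_sum]
  simp only [en_mul_sub]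

/-- Positivity of the Fejér kernel: shifting the frequencies decreases the sum. -/
lemma sum_norm_ps_shift_le (K : ℕ) (s : ℤ) (y : Fin n → ℝ) :
    ∑ a ∈ Finset.range K, ∑ b ∈ Finset.range K, ‖ps (s + (a - b)) y‖ ^ 2
      ≤ ∑ a ∈ Finset.range K, ∑ b ∈ Finset.range K, ‖ps ((a : ℤ) - b) y‖ ^ 2 := by
  have key : ∀ s : ℤ, ((∑ a ∈ Finset.range K, ∑ b ∈ Finset.range K,
      ‖ps (s + (a - b)) y‖ ^ 2 : ℝ) : ℂ)
      = ∑ i, ∑ j, en s (y i - y j) *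
        ((‖∑ a ∈ Finset.range K, en a (y i - y j)‖ ^ 2 : ℝ) : ℂ) := by
    intro s
    have h1 : ∀ x : ℝ, ((‖∑ a ∈ Finset.range K, en a x‖ ^ 2 : ℝ) : ℂ)
        = ∑ a ∈ Finset.range K, ∑ b ∈ Finset.range K, en ((a : ℤ) - b) x := by
      intro x
      rw [← Complex.normSq_eq_norm_sq, ← Complex.mul_conj, ← Complex.star_def, star_sum,
        Finset.sum_mul_sum]
      simp only [star_en, en_mul, sub_eq_add_neg]
    simp only [h1, Finset.mul_sum, en_mul, Complex.ofReal_sum, norm_ps_sq]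
    symm
    calc _ = ∑ i, ∑ a ∈ Finset.range K, ∑ j, ∑ b ∈ Finset.range K,
          en (s + ((a : ℤ) - b)) (y i - y j) := Finset.sum_congr rfl fun i _ => Finset.sum_comm
      _ = ∑ i, ∑ a ∈ Finset.range K, ∑ b ∈ Finset.range K, ∑ j,
          en (s + ((a : ℤ) - b)) (y i - y j) := Finset.sum_congr rfl fun i _ =>
            Finset.sum_congr rfl fun a _ => Finset.sum_comm
      _ = ∑ a ∈ Finset.range K, ∑ i, ∑ b ∈ Finset.range K, ∑ j,
          en (s + ((a : ℤ) - b)) (y i - y j) := Finset.sum_comm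
      _ = _ := Finset.sum_congr rfl fun a _ => Finset.sum_comm
  have h0 : ∑ a ∈ Finset.range K, ∑ b ∈ Finset.range K, ‖ps ((a : ℤ) - b) y‖ ^ 2
      = ∑ i, ∑ j, ‖∑ a ∈ Finset.range K, en a (y i - y j)‖ ^ 2 := by
    have := key 0
    simp only [zero_add, en_zero, one_mul] at this
    exact_mod_cast this
  rw [h0]
  have h2 := congrArg norm (key s)
  rw [Complex.norm_real, Real.norm_of_nonneg (by positivity)] at h2
  rw [h2]
  refine (norm_sum_le _ _).trans (Finset.sum_le_sum fun i _ => ?_)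
  refine (norm_sum_le _ _).trans (Finset.sum_le_sum fun j _ => ?_)
  rw [norm_mul, norm_en, one_mul, Complex.norm_real, Real.norm_of_nonneg (by positivity)]

lemma integrable_wSq {l : ℝ} (hl : 0 ≤ l) {f : (Fin n → ℝ) → ℂ} (hf : Continuous f) :
    Integrable (fun y => ‖f y‖ ^ 2 * weight 0 (fun _ => l) y) (boxMeasure n) :=
  integrable_mul_weight_real (fun _ => hl) (F := fun y => ‖f y‖ ^ 2) (by fun_prop)

lemma sum_wSq_ps_shift_le {l : ℝ} (hl : 0 ≤ l) (K : ℕ) (s : ℤ) :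
    ∑ a ∈ Finset.range K, ∑ b ∈ Finset.range K, wSq (n := n) l (ps (s + (a - b)))
      ≤ ∑ a ∈ Finset.range K, ∑ b ∈ Finset.range K, wSq (n := n) l (ps ((a : ℤ) - b)) := by
  have hi : ∀ k : ℤ, Integrable
      (fun y => ‖ps k y‖ ^ 2 * weight 0 (fun _ => l) y) (boxMeasure n) :=
    fun k => integrable_wSq hl (torusC1_ps k).continuous
  have h : ∀ g : ℕ → ℕ → ℤ, ∑ a ∈ Finset.range K, ∑ b ∈ Finset.range K, wSq (n := n) l (ps (g a b))
      = ∫ y, (∑ a ∈ Finset.range K, ∑ b ∈ Finset.range K, ‖ps (g a b) y‖ ^ 2)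
        * weight 0 (fun _ => l) y ∂(boxMeasure n) := by
    intro g
    simp only [Finset.sum_mul]
    rw [integral_finsetSum _ fun a _ => integrable_finsetSum _ fun b _ => hi _]
    refine Finset.sum_congr rfl fun a _ => ?_
    rw [integral_finsetSum _ fun b _ => hi _]
    rfl
  rw [h fun a b => s + (a - b), h fun a b => (a : ℤ) - b]
  have hint : ∀ g : ℕ → ℕ → ℤ, Integrable (fun y => (∑ a ∈ Finset.range K, ∑ b ∈ Finset.range K,
      ‖ps (g a b) y‖ ^ 2) * weight 0 (fun _ => l) y) (boxMeasure n) := by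
    intro g
    simp only [Finset.sum_mul]
    exact integrable_finsetSum _ fun a _ => integrable_finsetSum _ fun b _ => hi _
  exact integral_mono (hint fun a b => s + (a - b)) (hint fun a b => (a : ℤ) - b) fun y =>
    mul_le_mul_of_nonneg_right (sum_norm_ps_shift_le K s y) (weight_nonneg le_rfl y)

lemma wSq_ps_neg {l : ℝ} (k : ℤ) : wSq (n := n) l (ps (-k)) = wSq (n := n) l (ps k) := by
  unfold wSq
  simp only [← star_ps, norm_star]

end fejer

/-- Tail bound for a sequence satisfying the Fejér inequality. -/
lemma sum_tail_le_of_fejer {S : ℤ → ℝ} (hS : ∀ k, 0 ≤ S k) (heven : ∀ k, S (-k) = S k) {K : ℕ}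
    (hK : 1 ≤ K) (hF : ∀ s : ℤ, ∑ a ∈ Finset.range K, ∑ b ∈ Finset.range K, S (s + (a - b))
      ≤ ∑ a ∈ Finset.range K, ∑ b ∈ Finset.range K, S ((a : ℤ) - b)) {M : ℝ}
    (hM : ∀ k : ℕ, 1 ≤ k → k < K → S k ≤ M) (hM0 : 0 ≤ M) (N : ℕ) :
    ∑ k ∈ Finset.Ico (2 * K) N, S k / (k : ℝ) ^ 2 ≤ 8 * (S 0 / K ^ 2 + M / K) := by
  have hK' : (0 : ℝ) < K := by exact_mod_cast hK
  set B := ∑ a ∈ Finset.range K, ∑ b ∈ Finset.range K, S ((a : ℤ) - b) with hB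
  have hBle : B ≤ K * S 0 + K ^ 2 * M := by
    have h1 : ∀ a ∈ Finset.range K, ∀ b ∈ Finset.range K,
        S ((a : ℤ) - b) ≤ (if a = b then S 0 else 0) + M := by
      intro a ha b hb
      rw [Finset.mem_range] at ha hb
      rcases lt_trichotomy a b with h | h | h
      · rw [if_neg h.ne, zero_add, ← heven, show -((a : ℤ) - b) = ((b - a : ℕ) : ℤ) by omega]
        exact hM _ (by omega) (by omega)
      · subst h
        simpa using hM0
      · rw [if_neg h.ne', zero_add, show ((a : ℤ) - b) = ((a - b : ℕ) : ℤ) by omega]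
        exact hM _ (by omega) (by omega)
    refine (Finset.sum_le_sum fun a ha => Finset.sum_le_sum fun b hb => h1 a ha b hb).trans
      (le_of_eq ?_)
    simp only [Finset.sum_add_distrib, Finset.sum_ite_eq]
    rw [Finset.sum_congr rfl fun a ha => if_pos ha]
    simp
    ring
  set T := ∑ k ∈ Finset.Ico (2 * K) N, S k / (k : ℝ) ^ 2 with hT
  have hshift : ∀ a ∈ Finset.range K, ∀ b ∈ Finset.range K,
      T ≤ 4 * ∑ s ∈ Finset.Ioo K (N + K), S (s + (a - b)) * ((s : ℝ) ^ 2)⁻¹ := by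
    intro a ha b hb
    rw [Finset.mem_range] at ha hb
    rw [Finset.mul_sum]
    have hinj : Set.InjOn (fun k => k + b - a) (Finset.Ico (2 * K) N : Finset ℕ) := by
      intro k hk k' hk' h
      simp only [Finset.coe_Ico, Set.mem_Ico] at hk hk' h
      omega
    calc T ≤ ∑ k ∈ Finset.Ico (2 * K) N,
          4 * (S ((k + b - a : ℕ) + (a - b)) * (((k + b - a : ℕ) : ℝ) ^ 2)⁻¹) := by
          refine Finset.sum_le_sum fun k hk => ?_
          rw [Finset.mem_Ico] at hk
          rw [show (((k + b - a : ℕ) : ℤ) + (a - b)) = (k : ℤ) by omega]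
          have h1 : ((k + b - a : ℕ) : ℝ) ≤ 2 * k := by exact_mod_cast (by omega : k + b - a ≤ 2 * k)
          have h2 : (0 : ℝ) < ((k + b - a : ℕ) : ℝ) := by
            exact_mod_cast (by omega : 0 < k + b - a)
          have h3 : (0 : ℝ) < k := by exact_mod_cast (by omega : 0 < k)
          have h4 : ((k : ℝ) ^ 2)⁻¹ ≤ 4 * (((k + b - a : ℕ) : ℝ) ^ 2)⁻¹ := by
            rw [← div_eq_mul_inv, inv_eq_one_div, div_le_div_iff₀ (by positivity) (by positivity)]
            nlinarith
          rw [div_eq_mul_inv]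
          calc _ ≤ S k * (4 * (((k + b - a : ℕ) : ℝ) ^ 2)⁻¹) := mul_le_mul_of_nonneg_left h4 (hS _)
            _ = _ := by ring
      _ = ∑ s ∈ (Finset.Ico (2 * K) N).image (fun k => k + b - a),
          4 * (S (s + (a - b)) * ((s : ℝ) ^ 2)⁻¹) := by
          rw [Finset.sum_image hinj]
      _ ≤ _ := by
          refine Finset.sum_le_sum_of_subset_of_nonneg ?_ fun s _ _ =>
            mul_nonneg (by norm_num) (mul_nonneg (hS _) (by positivity))
          intro s hs
          rw [Finset.mem_image] at hs
          obtain ⟨k, hk, rfl⟩ := hs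
          rw [Finset.mem_Ico] at hk
          rw [Finset.mem_Ioo]
          omega
  have hB0 : 0 ≤ B := Finset.sum_nonneg fun _ _ => Finset.sum_nonneg fun _ _ => hS _
  have hmain : (K : ℝ) ^ 2 * T ≤ 4 * (B * (2 / K)) := by
    calc (K : ℝ) ^ 2 * T = ∑ a ∈ Finset.range K, ∑ b ∈ Finset.range K, T := by
          simp; ring
      _ ≤ ∑ a ∈ Finset.range K, ∑ b ∈ Finset.range K,
          4 * ∑ s ∈ Finset.Ioo K (N + K), S (s + (a - b)) * ((s : ℝ) ^ 2)⁻¹ :=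
          Finset.sum_le_sum fun a ha => Finset.sum_le_sum fun b hb => hshift a ha b hb
      _ = 4 * ∑ s ∈ Finset.Ioo K (N + K), (∑ a ∈ Finset.range K, ∑ b ∈ Finset.range K,
          S (s + (a - b))) * ((s : ℝ) ^ 2)⁻¹ := by
          simp only [← Finset.mul_sum, Finset.sum_mul]
          congr 1
          exact .symm (Finset.sum_comm.trans (Finset.sum_congr rfl fun a _ => Finset.sum_comm))
      _ ≤ 4 * ∑ s ∈ Finset.Ioo K (N + K), B * ((s : ℝ) ^ 2)⁻¹ := by
          gcongr with s hs
          exact hF s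
      _ ≤ _ := by
          rw [← Finset.mul_sum]
          gcongr
          refine (sum_Ioo_inv_sq_le K (N + K)).trans ?_
          gcongr
          linarith
  have : T ≤ 4 * (B * (2 / K)) / K ^ 2 := by
    rw [le_div_iff₀ (by positivity)]
    linarith
  refine this.trans ?_
  calc 4 * (B * (2 / K)) / (K : ℝ) ^ 2 ≤ 4 * ((K * S 0 + K ^ 2 * M) * (2 / K)) / K ^ 2 := by gcongr
    _ = _ := by field_simp; ring

/-- Second moment bounds in the regime `k ≤ εn`. -/
lemma wSq_ps_bounds {n k : ℕ} {l : ℝ} (hl : 0 < l) (hn : 1 ≤ n) (hk : 1 ≤ k)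
    (hkn : 2 * (1 + 2 * l) * k ≤ l * n) :
    wSq (n := n) l (ps k) ≤ 2 / l * k * (wSq (n := n) l fun _ => 1) ∧
    |wSq (n := n) l (ps k) - k / l * (wSq (n := n) l fun _ => 1)|
      ≤ 2 * (1 + 2 * l) / l ^ 2 * (k ^ 2 / n) * (wSq (n := n) l fun _ => 1) := by
  have h := abs_wSq_ps_sub_le hl.le hn hk
  have hS := wSq_nonneg (n := n) (l := l) (ps k)
  set S := wSq (n := n) l (ps k)
  set Z := wSq (n := n) l fun _ => 1
  have hn' : (0 : ℝ) < n := by exact_mod_cast hn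
  have hk' : (0 : ℝ) < k := by exact_mod_cast hk
  have h1 : S ≤ 2 / l * k * Z := by
    have h2 := neg_le_of_abs_le h
    have h3 := mul_le_mul_of_nonneg_right hkn hS
    have h4 : n * (l * S) ≤ n * (2 * k * Z) := by linarith
    have h5 := le_of_mul_le_mul_left h4 hn'
    rw [div_mul_eq_mul_div, div_mul_eq_mul_div, le_div_iff₀ hl]
    linarith
  refine ⟨h1, ?_⟩
  have h6 : S - k / l * Z = -(k * n * Z - l * n * S) / (l * n) := by field_simp; ring
  rw [h6, abs_div, abs_neg, abs_of_pos (by positivity : 0 < l * (n : ℝ)), div_le_iff₀ (by positivity)]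
  refine h.trans ((mul_le_mul_of_nonneg_left h1 (by positivity)).trans (le_of_eq ?_))
  field_simp

lemma norm_one_sub_mul_sum_pow_div_le {z : ℂ} (hz : ‖z‖ = 1) {q m : ℕ} (hq : 1 ≤ q) (hqm : q ≤ m) :
    ‖(1 - z) * ∑ k ∈ Finset.Ico q m, z ^ k / k + z ^ m / m‖ ≤ 2 / q - 1 / m := by
  induction m, hqm using Nat.le_induction with
  | base =>
    simp only [Finset.Ico_self, Finset.sum_empty, mul_zero, zero_add, norm_div, norm_pow, hz,
      one_pow, Complex.norm_natCast]
    exact le_of_eq (by ring)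
  | succ m hqm ih =>
    have hm : (0 : ℝ) < m := by exact_mod_cast (by omega : 0 < m)
    have hmc : (m : ℂ) ≠ 0 := by exact_mod_cast hm.ne'
    have hmc' : ((m : ℂ) + 1) ≠ 0 := by exact_mod_cast (by omega : m + 1 ≠ 0)
    have h1 : (1 - z) * ∑ k ∈ Finset.Ico q (m + 1), z ^ k / k + z ^ (m + 1) / (m + 1 : ℕ)
        = ((1 - z) * ∑ k ∈ Finset.Ico q m, z ^ k / k + z ^ m / m)
          - z ^ (m + 1) * ((1 / m - 1 / (m + 1) : ℝ) : ℂ) := by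
      rw [Finset.sum_Ico_succ_top hqm]
      push_cast
      field_simp
      ring
    have h2 : (0 : ℝ) ≤ 1 / m - 1 / (m + 1) := by
      rw [sub_nonneg]
      gcongr
      linarith
    rw [h1]
    refine (norm_sub_le _ _).trans ?_
    rw [norm_mul, norm_pow, hz, one_pow, one_mul, Complex.norm_real, Real.norm_of_nonneg h2]
    push_cast
    linarith

lemma norm_one_sub_en_one {t : ℝ} (h0 : 0 < t) (h2 : t < 2 * Real.pi) :
    ‖1 - en 1 t‖ = 2 * Real.sin (t / 2) := by
  have hs : 0 < Real.sin (t / 2) := Real.sin_pos_of_pos_of_lt_pi (by linarith) (by linarith)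
  have h : ‖1 - en 1 t‖ ^ 2 = (2 * Real.sin (t / 2)) ^ 2 := by
    rw [← Complex.normSq_eq_norm_sq, en_one_eq, Complex.normSq_apply]
    have h1 : Real.cos t = 1 - 2 * Real.sin (t / 2) ^ 2 := by
      have := Real.cos_sq' (t / 2)
      have h3 := Real.cos_two_mul (t / 2)
      rw [mul_div_cancel₀ t (two_ne_zero)] at h3
      linarith
    have h2 := Real.sin_sq_add_cos_sq t
    simp only [Complex.sub_re, Complex.add_re, Complex.one_re, Complex.ofReal_re, Complex.mul_re,
      Complex.I_re, Complex.sub_im, Complex.add_im, Complex.one_im, Complex.ofReal_im,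
      Complex.mul_im, Complex.I_im]
    nlinarith
  exact (pow_left_inj₀ (norm_nonneg _) (by positivity) two_ne_zero).1 h

lemma sum_Ico_one_inv_eq_harmonic (m : ℕ) :
    ∑ k ∈ Finset.Ico 1 (m + 1), (1 : ℝ) / k = harmonic m := by
  rw [Finset.sum_Ico_eq_sum_range, harmonic]
  push_cast
  simp [add_comm]

lemma abs_sum_cos_div_le {t : ℝ} (h0 : 0 < t) (h2 : t < 2 * Real.pi) (m : ℕ) :
    |∑ k ∈ Finset.Ico 1 m, Real.cos (k * t) / k| ≤ 3 * (1 - Real.log (Real.sin (t / 2))) := by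
  have hs : 0 < Real.sin (t / 2) := Real.sin_pos_of_pos_of_lt_pi (by linarith) (by linarith)
  have hs1 : Real.sin (t / 2) ≤ 1 := Real.sin_le_one _
  have hlog : Real.log (Real.sin (t / 2)) ≤ 0 := Real.log_nonpos hs.le hs1
  set s := Real.sin (t / 2)
  set q := ⌈1 / s⌉₊ with hq
  have hq1 : 1 / s ≤ q := Nat.le_ceil _
  have hone : 1 ≤ 1 / s := by rw [le_div_iff₀ hs]; linarith
  have hq0 : 1 ≤ q := by exact_mod_cast hone.trans hq1
  have hq2 : (q : ℝ) ≤ 2 / s := by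
    have := (Nat.ceil_lt_add_one (by positivity : 0 ≤ 1 / s)).le
    rw [← hq] at this
    calc (q : ℝ) ≤ 1 / s + 1 / s := by linarith
      _ = _ := by ring
  have hlow : ∀ r ≤ q, |∑ k ∈ Finset.Ico 1 r, Real.cos (k * t) / k| ≤ 2 - Real.log s := by
    intro r hr
    have hlogq : Real.log q ≤ 1 - Real.log s := by
      refine (Real.log_le_log (by exact_mod_cast hq0) hq2).trans ?_
      rw [Real.log_div two_ne_zero hs.ne']
      have := Real.log_two_lt_d9
      linarith
    calc |∑ k ∈ Finset.Ico 1 r, Real.cos (k * t) / k|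
        ≤ ∑ k ∈ Finset.Ico 1 r, (1 : ℝ) / k := by
          refine (Finset.abs_sum_le_sum_abs _ _).trans (Finset.sum_le_sum fun k _ => ?_)
          rw [abs_div, Nat.abs_cast]
          exact div_le_div_of_nonneg_right (Real.abs_cos_le_one _) (Nat.cast_nonneg _)
      _ ≤ ∑ k ∈ Finset.Ico 1 (q + 1), (1 : ℝ) / k :=
          Finset.sum_le_sum_of_subset_of_nonneg (Finset.Ico_subset_Ico le_rfl (by omega))
            fun _ _ _ => by positivity
      _ ≤ _ := by
          rw [sum_Ico_one_inv_eq_harmonic]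
          have := harmonic_le_one_add_log q
          linarith
  rcases le_total m q with h | h
  · exact (hlow m h).trans (by linarith)
  · rw [← Finset.sum_Ico_consecutive _ hq0 h]
    refine (abs_add_le _ _).trans ?_
    have hz := norm_en 1 t
    have h3 := norm_one_sub_mul_sum_pow_div_le hz hq0 h
    have hm : (0 : ℝ) < m := by exact_mod_cast (by omega : 0 < m)
    have hqpos : (0 : ℝ) < q := by exact_mod_cast hq0
    have h4 : ‖(1 - en 1 t) * ∑ k ∈ Finset.Ico q m, en 1 t ^ k / k‖ ≤ 2 / q := by
      have h5 : (1 - en 1 t) * ∑ k ∈ Finset.Ico q m, en 1 t ^ k / k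
          = ((1 - en 1 t) * ∑ k ∈ Finset.Ico q m, en 1 t ^ k / k + en 1 t ^ m / m)
            - en 1 t ^ m / m := by ring
      rw [h5]
      refine (norm_sub_le _ _).trans ?_
      have h6 : ‖en 1 t ^ m / m‖ = 1 / m := by
        rw [norm_div, norm_pow, hz, one_pow, Complex.norm_natCast]
      linarith
    rw [norm_mul, norm_one_sub_en_one h0 h2] at h4
    have h7 : ‖∑ k ∈ Finset.Ico q m, en 1 t ^ k / k‖ ≤ 1 := by
      have h8 : 2 * s * ‖∑ k ∈ Finset.Ico q m, en 1 t ^ k / k‖ ≤ 2 * s * 1 := by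
        refine h4.trans ?_
        rw [div_le_iff₀ hqpos]
        rw [div_le_iff₀ hs] at hq1
        linarith
      exact le_of_mul_le_mul_left h8 (by positivity)
    have h9 : |∑ k ∈ Finset.Ico q m, Real.cos (k * t) / k| ≤ 1 := by
      refine le_trans (le_of_eq ?_) ((Complex.abs_re_le_norm _).trans h7)
      rw [Complex.re_sum]
      congr 1
      refine Finset.sum_congr rfl fun k _ => ?_
      rw [← en_natCast, Complex.div_natCast_re]
      congr 1
      have : en k t = en 1 (k * t) := by unfold en; push_cast; ring_nf
      rw [this, en_one_eq]
      simp only [Complex.add_re, Complex.ofReal_re, Complex.mul_re, Complex.I_re,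
        Complex.ofReal_im, Complex.I_im]
      ring
    linarith [hlow q le_rfl]

/-- The analytic estimate behind the logarithmic variance. -/
lemma exists_sum_bound {l ε C₁ D : ℝ} (hl : 0 < l) (hε : 0 < ε) (hε1 : ε ≤ 1) (hC : 0 ≤ C₁)
    (hD : 0 ≤ D) :
    ∃ C > 0, ∀ n : ℕ, 1 ≤ n → ∀ P : ℕ → ℝ, (∀ k, 0 ≤ P k) → (∀ k, P k ≤ (n : ℝ) ^ 2) →
      (∀ k : ℕ, 1 ≤ k → (k : ℝ) ≤ ε * n → |P k - k / l| ≤ C₁ * (k ^ 2 / n)) →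
      (∀ K : ℕ, 1 ≤ K → 2 * (K : ℝ) ≤ ε * n → ε * n ≤ 4 * K → ∀ N : ℕ,
        ∑ k ∈ Finset.Ico (2 * K) N, P k / (k : ℝ) ^ 2 ≤ D) →
      ∀ t : ℝ, 0 < t → t < 2 * Real.pi → ∀ N : ℕ, n ≤ N →
        |∑ k ∈ Finset.Ico 1 N, (1 - Real.cos (k * t)) / (Real.pi ^ 2 * k ^ 2) * P k
          - Real.log n / (Real.pi ^ 2 * l)| ≤ C * (1 - Real.log (Real.sin (t / 2))) := by
  refine ⟨(5 + |Real.log ε|) / l + 2 * C₁ + 2 * D + 16 / ε ^ 2 + 2 / (ε * l), by positivity, ?_⟩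
  intro n hn P hP0 hPn hPlow hPtail t h0 h2 N hN
  have hs : 0 < Real.sin (t / 2) := Real.sin_pos_of_pos_of_lt_pi (by linarith) (by linarith)
  have hlog : Real.log (Real.sin (t / 2)) ≤ 0 := Real.log_nonpos hs.le (Real.sin_le_one _)
  have hcos := abs_sum_cos_div_le h0 h2
  set L := 1 - Real.log (Real.sin (t / 2)) with hL
  have hL1 : 1 ≤ L := by linarith
  have hn' : (1 : ℝ) ≤ n := by exact_mod_cast hn
  have hpi : (1 : ℝ) ≤ Real.pi ^ 2 := by nlinarith [Real.pi_gt_three]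
  have hpi0 : (0 : ℝ) < Real.pi ^ 2 := by linarith
  have hv0 : ∀ k : ℕ, 0 ≤ (1 - Real.cos (k * t)) / (Real.pi ^ 2 * k ^ 2) := fun k =>
    div_nonneg (sub_nonneg.2 (Real.cos_le_one _)) (by positivity)
  have hv2 : ∀ k : ℕ, (1 - Real.cos (k * t)) / (Real.pi ^ 2 * k ^ 2) ≤ 2 * ((k : ℝ) ^ 2)⁻¹ := by
    intro k
    rw [div_eq_mul_inv, mul_inv, ← mul_assoc]
    refine mul_le_mul_of_nonneg_right ?_ (by positivity)
    have h1 : 1 - Real.cos (k * t) ≤ 2 := by linarith [Real.neg_one_le_cos (k * t)]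
    have h3 : 0 ≤ 1 - Real.cos (k * t) := by linarith [Real.cos_le_one (k * t)]
    have h4 : (Real.pi ^ 2)⁻¹ ≤ 1 := inv_le_one_of_one_le₀ hpi
    have h5 : (0 : ℝ) ≤ (Real.pi ^ 2)⁻¹ := by positivity
    nlinarith
  have hlogn : 0 ≤ Real.log n := Real.log_nonneg hn'
  set K := ⌊ε * n / 2⌋₊ with hK
  have hεn : 0 ≤ ε * n / 2 := by positivity
  have hKle : 2 * (K : ℝ) ≤ ε * n := by linarith [Nat.floor_le hεn]
  have hKlt : ε * n / 2 < K + 1 := Nat.lt_floor_add_one _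
  rcases Nat.eq_zero_or_pos K with hK0 | hK1
  · rw [hK0] at hKlt
    have hn2 : (n : ℝ) ≤ 2 / ε := by
      rw [le_div_iff₀ hε]
      push_cast at hKlt
      linarith
    have h3 : ∑ k ∈ Finset.Ico 1 N, (1 - Real.cos (k * t)) / (Real.pi ^ 2 * k ^ 2) * P k
        ≤ 16 / ε ^ 2 := by
      calc _ ≤ ∑ k ∈ Finset.Ico 1 N, 2 * (n : ℝ) ^ 2 * ((k : ℝ) ^ 2)⁻¹ := by
            refine Finset.sum_le_sum fun k _ => ?_
            calc _ ≤ 2 * ((k : ℝ) ^ 2)⁻¹ * (n : ℝ) ^ 2 :=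
                  mul_le_mul (hv2 k) (hPn k) (hP0 k) (by positivity)
              _ = _ := by ring
        _ = 2 * (n : ℝ) ^ 2 * ∑ k ∈ Finset.Ioo 0 N, ((k : ℝ) ^ 2)⁻¹ := by
            rw [Finset.mul_sum]
            rfl
        _ ≤ 2 * (n : ℝ) ^ 2 * 2 := by
            gcongr
            refine (sum_Ioo_inv_sq_le 0 N).trans (le_of_eq (by norm_num))
        _ ≤ 2 * (2 / ε) ^ 2 * 2 := by gcongr
        _ = _ := by ring
    have h4 : 0 ≤ ∑ k ∈ Finset.Ico 1 N, (1 - Real.cos (k * t)) / (Real.pi ^ 2 * k ^ 2) * P k :=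
      Finset.sum_nonneg fun k _ => mul_nonneg (hv0 k) (hP0 k)
    have h5 : 0 ≤ Real.log n / (Real.pi ^ 2 * l) := by positivity
    have h6 : Real.log n / (Real.pi ^ 2 * l) ≤ 2 / (ε * l) := by
      calc Real.log n / (Real.pi ^ 2 * l) ≤ (2 / ε) / (1 * l) := by
            gcongr
            exact (Real.log_le_self (by linarith)).trans hn2
        _ = _ := by field_simp
    have h7 : 0 ≤ (5 + |Real.log ε|) / l + 2 * C₁ + 2 * D := by positivity
    have h8 : 0 ≤ 2 / (ε * l) := by positivity
    have h9 : 0 ≤ 16 / ε ^ 2 := by positivity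
    calc _ ≤ 16 / ε ^ 2 + 2 / (ε * l) := by rw [abs_le]; constructor <;> linarith
      _ ≤ ((5 + |Real.log ε|) / l + 2 * C₁ + 2 * D + 16 / ε ^ 2 + 2 / (ε * l)) * 1 := by linarith
      _ ≤ _ := mul_le_mul_of_nonneg_left hL1 (by positivity)
  · have hK1' : (1 : ℝ) ≤ K := by exact_mod_cast hK1
    have hK4 : ε * n ≤ 4 * K := by linarith
    have hmn : 2 * K ≤ n := by
      have : 2 * (K : ℝ) ≤ n := hKle.trans (by nlinarith)
      exact_mod_cast this
    have hm : (0 : ℝ) < 2 * K := by linarith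
    rw [← Finset.sum_Ico_consecutive _ (by omega : 1 ≤ 2 * K) (hmn.trans hN)]
    have htail0 : 0 ≤ ∑ k ∈ Finset.Ico (2 * K) N,
        (1 - Real.cos (k * t)) / (Real.pi ^ 2 * k ^ 2) * P k :=
      Finset.sum_nonneg fun k _ => mul_nonneg (hv0 k) (hP0 k)
    have htail : ∑ k ∈ Finset.Ico (2 * K) N,
        (1 - Real.cos (k * t)) / (Real.pi ^ 2 * k ^ 2) * P k ≤ 2 * D := by
      refine le_trans ?_ (mul_le_mul_of_nonneg_left (hPtail K hK1 hKle hK4 N) zero_le_two)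
      rw [Finset.mul_sum]
      refine Finset.sum_le_sum fun k _ => ?_
      calc _ ≤ 2 * ((k : ℝ) ^ 2)⁻¹ * P k := mul_le_mul_of_nonneg_right (hv2 k) (hP0 k)
        _ = _ := by ring
    have hlowerr : |∑ k ∈ Finset.Ico 1 (2 * K), (1 - Real.cos (k * t)) / (Real.pi ^ 2 * k ^ 2)
        * (P k - k / l)| ≤ 2 * C₁ := by
      calc _ ≤ ∑ k ∈ Finset.Ico 1 (2 * K), 2 * C₁ / n := by
            refine (Finset.abs_sum_le_sum_abs _ _).trans (Finset.sum_le_sum fun k hk => ?_)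
            rw [Finset.mem_Ico] at hk
            have hk0 : (0 : ℝ) < k := by exact_mod_cast hk.1
            have hkK : (k : ℝ) ≤ 2 * K := by exact_mod_cast hk.2.le
            rw [abs_mul, abs_of_nonneg (hv0 k)]
            calc _ ≤ 2 * ((k : ℝ) ^ 2)⁻¹ * (C₁ * (k ^ 2 / n)) :=
                  mul_le_mul (hv2 k) (hPlow k hk.1 (hkK.trans hKle)) (abs_nonneg _) (by positivity)
              _ = _ := by field_simp
        _ = (2 * K - 1 : ℕ) * (2 * C₁ / n) := by simp
        _ ≤ n * (2 * C₁ / n) := by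
            gcongr
            exact (by omega : 2 * K - 1 ≤ n)
        _ = _ := by field_simp
    have hmain : ∑ k ∈ Finset.Ico 1 (2 * K), (1 - Real.cos (k * t)) / (Real.pi ^ 2 * k ^ 2)
        * (k / l) = 1 / (Real.pi ^ 2 * l) * (∑ k ∈ Finset.Ico 1 (2 * K), (1 : ℝ) / k
          - ∑ k ∈ Finset.Ico 1 (2 * K), Real.cos (k * t) / k) := by
      rw [← Finset.sum_sub_distrib, Finset.mul_sum]
      refine Finset.sum_congr rfl fun k hk => ?_
      rw [Finset.mem_Ico] at hk
      have hk0 : (0 : ℝ) < k := by exact_mod_cast hk.1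
      field_simp
    have hsplit : ∑ k ∈ Finset.Ico 1 (2 * K), (1 - Real.cos (k * t)) / (Real.pi ^ 2 * k ^ 2) * P k
        = ∑ k ∈ Finset.Ico 1 (2 * K), (1 - Real.cos (k * t)) / (Real.pi ^ 2 * k ^ 2)
            * (P k - k / l)
          + ∑ k ∈ Finset.Ico 1 (2 * K), (1 - Real.cos (k * t)) / (Real.pi ^ 2 * k ^ 2)
            * (k / l) := by
      rw [← Finset.sum_add_distrib]
      exact Finset.sum_congr rfl fun k _ => by ring
    have hharm : |∑ k ∈ Finset.Ico 1 (2 * K), (1 : ℝ) / k - Real.log n| ≤ 2 + |Real.log ε| := by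
      obtain ⟨m, hm'⟩ : ∃ m, 2 * K = m + 1 := ⟨2 * K - 1, by omega⟩
      have h3 := log_add_one_le_harmonic m
      have h4 := harmonic_le_one_add_log m
      have hmR : ((m : ℝ) + 1) = 2 * K := by exact_mod_cast hm'.symm
      have h4' : Real.log m ≤ Real.log (m + 1) := by
        have : 1 ≤ m := by omega
        exact Real.log_le_log (by exact_mod_cast this) (by linarith)
      rw [hm', sum_Ico_one_inv_eq_harmonic]
      rw [show (((m + 1 : ℕ) : ℝ)) = 2 * K by exact_mod_cast hm'.symm] at h3
      rw [hmR] at h4'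
      have h5 : Real.log (2 * K) ≤ Real.log ε + Real.log n := by
        rw [← Real.log_mul hε.ne' (by positivity)]
        exact Real.log_le_log hm hKle
      have h6 : Real.log ε + Real.log n ≤ Real.log 2 + Real.log (2 * K) := by
        rw [← Real.log_mul hε.ne' (by positivity), ← Real.log_mul two_ne_zero hm.ne']
        exact Real.log_le_log (by positivity) (by linarith)
      have h7 := Real.log_two_lt_d9
      have h8 := neg_abs_le (Real.log ε)
      have h9 := le_abs_self (Real.log ε)
      rw [abs_le]
      constructor <;> linarith
    have hfirst : |1 / (Real.pi ^ 2 * l) * (∑ k ∈ Finset.Ico 1 (2 * K), (1 : ℝ) / k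
          - ∑ k ∈ Finset.Ico 1 (2 * K), Real.cos (k * t) / k) - Real.log n / (Real.pi ^ 2 * l)|
        ≤ (5 + |Real.log ε|) / l * L := by
      have h3 : 1 / (Real.pi ^ 2 * l) * (∑ k ∈ Finset.Ico 1 (2 * K), (1 : ℝ) / k
          - ∑ k ∈ Finset.Ico 1 (2 * K), Real.cos (k * t) / k) - Real.log n / (Real.pi ^ 2 * l)
          = 1 / (Real.pi ^ 2 * l) * ((∑ k ∈ Finset.Ico 1 (2 * K), (1 : ℝ) / k - Real.log n)
          - ∑ k ∈ Finset.Ico 1 (2 * K), Real.cos (k * t) / k) := by ring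
      rw [h3, abs_mul, abs_of_pos (by positivity : 0 < 1 / (Real.pi ^ 2 * l))]
      have h4 : |(∑ k ∈ Finset.Ico 1 (2 * K), (1 : ℝ) / k - Real.log n)
          - ∑ k ∈ Finset.Ico 1 (2 * K), Real.cos (k * t) / k| ≤ (5 + |Real.log ε|) * L := by
        refine (abs_sub _ _).trans ?_
        have h5 := hcos (2 * K)
        have h6 : 2 + |Real.log ε| ≤ (2 + |Real.log ε|) * L :=
          le_mul_of_one_le_right (by positivity) hL1
        linarith
      calc _ ≤ 1 / (1 * l) * ((5 + |Real.log ε|) * L) := by gcongr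
        _ = _ := by ring
    have hrest : 2 * C₁ + 2 * D ≤ (2 * C₁ + 2 * D + 16 / ε ^ 2 + 2 / (ε * l)) * L := by
      have h3 : 0 ≤ 16 / ε ^ 2 := by positivity
      have h4 : 0 ≤ 2 / (ε * l) := by positivity
      refine le_trans ?_ (le_mul_of_one_le_right (by positivity) hL1)
      linarith
    rw [hsplit, hmain]
    have h3 := abs_le.1 hfirst
    have h4 := abs_le.1 hlowerr
    rw [abs_le]
    constructor <;> nlinarith

/-- Lebesgue measure on one period. -/
def arcMeasure : Measure ℝ := volume.restrict (Set.Ico 0 (2 * Real.pi))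

instance : IsFiniteMeasure arcMeasure := by
  unfold arcMeasure
  infer_instance

lemma boxMeasure_eq_pi (n : ℕ) : boxMeasure n = Measure.pi fun _ => arcMeasure := by
  unfold boxMeasure arcMeasure
  rw [volume_pi, Measure.restrict_pi_pi]

lemma arcMeasure_real_univ : arcMeasure.real Set.univ = 2 * Real.pi := by
  simp [arcMeasure, Real.pi_nonneg]

lemma Continuous.integrable_arcMeasure {E : Type*} [NormedAddCommGroup E] {f : ℝ → E}
    (hf : Continuous f) : Integrable f arcMeasure :=
  (hf.continuousOn.integrableOn_compact isCompact_Icc).mono_set Set.Ico_subset_Icc_self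

lemma continuous_en (k : ℤ) : Continuous (en k) := (contDiff_en k).continuous

lemma integral_Ico_en {a b : ℝ} (hab : a ≤ b) {k : ℤ} (hk : k ≠ 0) :
    ∫ x in Set.Ico a b, en k x = (en k b - en k a) / (Complex.I * k) := by
  have hk' : Complex.I * k ≠ 0 := mul_ne_zero Complex.I_ne_zero (Int.cast_ne_zero.2 hk)
  rw [integral_Ico_eq_integral_Ioc, ← intervalIntegral.integral_of_le hab]
  have h : ∀ x ∈ Set.uIcc a b, HasDerivAt (fun x => en k x / (Complex.I * k)) (en k x) x := by
    intro x _
    have := (hasDerivAt_en k x).div_const (Complex.I * k)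
    rwa [mul_div_cancel_left₀ _ hk'] at this
  rw [intervalIntegral.integral_eq_sub_of_hasDerivAt h
    ((continuous_en k).intervalIntegrable _ _), sub_div]

lemma integral_arcMeasure_en (k : ℤ) :
    ∫ x, en k x ∂arcMeasure = if k = 0 then ((2 * Real.pi : ℝ) : ℂ) else 0 := by
  split_ifs with hk
  · subst hk
    simp [arcMeasure_real_univ]
  · rw [arcMeasure, integral_Ico_en (by positivity) hk]
    have := en_add_two_pi k 0
    rw [zero_add] at this
    rw [this, sub_self, zero_div]

/-- The centered indicator function of the arc `[a, b)`. -/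
def arcFun (a b x : ℝ) : ℝ := (Set.Ico a b).indicator 1 x - (b - a) / (2 * Real.pi)

/-- The Fourier coefficients of `arcFun`. -/
def arcCoeff (a b : ℝ) (k : ℤ) : ℂ := (en (-k) a - en (-k) b) / (2 * Real.pi * Complex.I * k)

lemma measurable_arcFun (a b : ℝ) : Measurable (arcFun a b) :=
  (measurable_one.indicator measurableSet_Ico).sub_const _

lemma star_arcCoeff (a b : ℝ) (k : ℤ) : star (arcCoeff a b k) = arcCoeff a b (-k) := by
  have h1 := star_en (-k) a
  have h2 := star_en (-k) b
  simp only [Complex.star_def] at h1 h2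
  simp only [arcCoeff, Complex.star_def, map_div₀, map_sub, h1, h2, map_mul, Complex.conj_I,
    Complex.conj_ofReal, map_intCast, map_ofNat]
  push_cast
  ring

lemma norm_arcCoeff_sq (a b : ℝ) (k : ℤ) :
    ‖arcCoeff a b k‖ ^ 2 = (1 - Real.cos (k * (b - a))) / (2 * (Real.pi ^ 2 * k ^ 2)) := by
  have h : ‖en (-k) a - en (-k) b‖ ^ 2 = 2 - 2 * Real.cos (k * (b - a)) := by
    have e : ∀ x, en (-k) x = en 1 (-(k * x)) := by
      intro x; unfold en; push_cast; ring_nf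
    rw [e, e, ← Complex.normSq_eq_norm_sq, en_one_eq, en_one_eq, Complex.normSq_apply]
    simp only [Complex.sub_re, Complex.add_re, Complex.ofReal_re, Complex.mul_re,
      Complex.I_re, Complex.sub_im, Complex.add_im, Complex.ofReal_im,
      Complex.mul_im, Complex.I_im]
    rw [show (k : ℝ) * (b - a) = k * b - k * a by ring, Real.cos_sub, Real.cos_neg, Real.cos_neg,
      Real.sin_neg, Real.sin_neg]
    nlinarith [Real.sin_sq_add_cos_sq (k * a), Real.sin_sq_add_cos_sq (k * b)]
  rw [arcCoeff, norm_div, div_pow, h]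
  have h2 : ‖2 * (Real.pi : ℂ) * Complex.I * k‖ ^ 2 = 4 * (Real.pi ^ 2 * k ^ 2) := by
    simp only [norm_mul, Complex.norm_I, Complex.norm_real, Complex.norm_intCast, mul_pow,
      Complex.norm_ofNat, Real.norm_eq_abs, sq_abs]
    ring
  rw [h2]
  rcases eq_or_ne k 0 with rfl | hk
  · simp
  have : (k : ℝ) ≠ 0 := Int.cast_ne_zero.2 hk
  field_simp
  ring

section arc

variable {a b : ℝ}

lemma integrable_arcFun (a b : ℝ) : Integrable (arcFun a b) arcMeasure :=
  ((integrable_const (1 : ℝ)).indicator measurableSet_Ico).sub (integrable_const _)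

lemma integral_indicator_arc {E : Type*} [NormedAddCommGroup E] [NormedSpace ℝ E] (ha : 0 ≤ a)
    (hb : b ≤ 2 * Real.pi) (f : ℝ → E) :
    ∫ x, (Set.Ico a b).indicator f x ∂arcMeasure = ∫ x in Set.Ico a b, f x := by
  rw [arcMeasure, setIntegral_indicator measurableSet_Ico,
    Set.inter_eq_right.2 (Set.Ico_subset_Ico ha hb)]

lemma integral_arcFun_mul_en (ha : 0 ≤ a) (hab : a ≤ b) (hb : b ≤ 2 * Real.pi) {k : ℤ}
    (hk : k ≠ 0) :
    ∫ x, (arcFun a b x : ℂ) * en k x ∂arcMeasure = 2 * Real.pi * arcCoeff a b (-k) := by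
  have h : ∀ x, (arcFun a b x : ℂ) * en k x
      = (Set.Ico a b).indicator (en k) x - (((b - a) / (2 * Real.pi) : ℝ) : ℂ) * en k x := by
    intro x
    by_cases hx : x ∈ Set.Ico a b
    · simp [arcFun, hx, sub_mul]
    · simp [arcFun, hx]
  simp_rw [h]
  rw [integral_sub ((continuous_en k).integrable_arcMeasure.indicator measurableSet_Ico)
    ((continuous_en k).integrable_arcMeasure.const_mul _), integral_const_mul,
    integral_arcMeasure_en, if_neg hk, mul_zero, sub_zero, integral_indicator_arc ha hb,
    integral_Ico_en hab hk, arcCoeff, neg_neg]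
  have h1 : (Real.pi : ℂ) ≠ 0 := Complex.ofReal_ne_zero.2 Real.pi_ne_zero
  have h2 : (k : ℂ) ≠ 0 := Int.cast_ne_zero.2 hk
  push_cast
  field_simp
  ring

lemma integral_arcFun_sq (ha : 0 ≤ a) (hab : a ≤ b) (hb : b ≤ 2 * Real.pi) :
    ∫ x, arcFun a b x ^ 2 ∂arcMeasure = (b - a) - (b - a) ^ 2 / (2 * Real.pi) := by
  set r := (b - a) / (2 * Real.pi) with hr
  have h : ∀ x, arcFun a b x ^ 2 = (Set.Ico a b).indicator (fun _ => 1 - 2 * r) x + r ^ 2 := by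
    intro x
    by_cases hx : x ∈ Set.Ico a b
    · simp only [arcFun, ← hr, hx, Set.indicator_of_mem, Pi.one_apply]; ring
    · simp only [arcFun, ← hr, hx, not_false_eq_true, Set.indicator_of_notMem]; ring
  simp_rw [h]
  rw [integral_add ((integrable_const _).indicator measurableSet_Ico) (integrable_const _),
    integral_indicator_arc ha hb, integral_const, integral_const, arcMeasure_real_univ]
  simp only [measureReal_restrict_apply_univ, Real.volume_real_Ico_of_le hab, smul_eq_mul, hr]
  have := Real.pi_pos
  field_simp
  ring

/-- The Fourier partial sum of `arcFun` over frequencies in `s`. -/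
def arcSum (a b : ℝ) (s : Finset ℤ) (x : ℝ) : ℂ := ∑ k ∈ s, arcCoeff a b k * en k x

lemma continuous_arcSum (a b : ℝ) (s : Finset ℤ) : Continuous (arcSum a b s) :=
  continuous_finsetSum _ fun k _ => continuous_const.mul (continuous_en k)

lemma integral_norm_arcFun_sub_arcSum_sq (ha : 0 ≤ a) (hab : a ≤ b) (hb : b ≤ 2 * Real.pi)
    {s : Finset ℤ} (hs : 0 ∉ s) :
    ∫ x, ‖(arcFun a b x : ℂ) - arcSum a b s x‖ ^ 2 ∂arcMeasure
      = (b - a) - (b - a) ^ 2 / (2 * Real.pi) - 2 * Real.pi * ∑ k ∈ s, ‖arcCoeff a b k‖ ^ 2 := by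
  have hexp : ∀ x, ((‖(arcFun a b x : ℂ) - arcSum a b s x‖ ^ 2 : ℝ) : ℂ)
      = ((arcFun a b x ^ 2 : ℝ) : ℂ)
        - ∑ k ∈ s, arcCoeff a b (-k) * ((arcFun a b x : ℂ) * en (-k) x)
        - ∑ k ∈ s, arcCoeff a b k * ((arcFun a b x : ℂ) * en k x)
        + ∑ k ∈ s, ∑ j ∈ s, arcCoeff a b k * arcCoeff a b (-j) * en (k - j) x := by
    intro x
    have h1 : star (arcSum a b s x) = ∑ k ∈ s, arcCoeff a b (-k) * en (-k) x := by
      rw [arcSum, star_sum]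
      exact Finset.sum_congr rfl fun k _ => by rw [star_mul', star_arcCoeff, star_en]
    have h2 : ((‖(arcFun a b x : ℂ) - arcSum a b s x‖ ^ 2 : ℝ) : ℂ)
        = ((arcFun a b x : ℂ) - arcSum a b s x) * star ((arcFun a b x : ℂ) - arcSum a b s x) := by
      rw [Complex.star_def, Complex.mul_conj, Complex.normSq_eq_norm_sq]
    have h3 : ∑ k ∈ s, ∑ j ∈ s, arcCoeff a b k * arcCoeff a b (-j) * en (k - j) x
        = arcSum a b s x * ∑ j ∈ s, arcCoeff a b (-j) * en (-j) x := by
      rw [arcSum, Finset.sum_mul_sum]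
      refine Finset.sum_congr rfl fun k _ => Finset.sum_congr rfl fun j _ => ?_
      rw [sub_eq_add_neg, ← en_mul]
      ring
    have h4 : ∀ c : ℤ → ℂ, ∀ e : ℤ → ℂ, ∑ k ∈ s, c k * ((arcFun a b x : ℂ) * e k)
        = arcFun a b x * ∑ k ∈ s, c k * e k := by
      intro c e
      rw [Finset.mul_sum]
      exact Finset.sum_congr rfl fun k _ => by ring
    rw [h2, star_sub, h1, h3, h4 (fun k => arcCoeff a b (-k)) fun k => en (-k) x,
      h4 (fun k => arcCoeff a b k) fun k => en k x, Complex.star_def, Complex.conj_ofReal, ← arcSum]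
    push_cast
    ring
  have hi1 : ∀ k : ℤ, Integrable (fun x => (arcFun a b x : ℂ) * en k x) arcMeasure := by
    intro k
    refine (integrable_arcFun a b).ofReal.mul_bdd (c := 1)
      (continuous_en k).aestronglyMeasurable (ae_of_all _ fun x => (norm_en k x).le)
  have hsq : Integrable (fun x => arcFun a b x ^ 2) arcMeasure := by
    have hbd : ∀ x, ‖arcFun a b x‖ ≤ 1 + |(b - a) / (2 * Real.pi)| := by
      intro x
      refine (norm_sub_le _ _).trans (add_le_add ?_ le_rfl)
      by_cases hx : x ∈ Set.Ico a b <;> simp [hx]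
    simp_rw [pow_two]
    exact (integrable_arcFun a b).mul_bdd (measurable_arcFun a b).aestronglyMeasurable
      (ae_of_all _ hbd)
  have hmain : ((∫ x, ‖(arcFun a b x : ℂ) - arcSum a b s x‖ ^ 2 ∂arcMeasure : ℝ) : ℂ)
      = (((b - a) - (b - a) ^ 2 / (2 * Real.pi)
        - 2 * Real.pi * ∑ k ∈ s, ‖arcCoeff a b k‖ ^ 2 : ℝ) : ℂ) := by
    rw [← integral_complex_ofReal]
    simp_rw [hexp]
    have hA : Integrable (fun x => ((arcFun a b x ^ 2 : ℝ) : ℂ)) arcMeasure := hsq.ofReal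
    have hB : ∀ k ∈ s, Integrable
        (fun x => arcCoeff a b (-k) * ((arcFun a b x : ℂ) * en (-k) x)) arcMeasure :=
      fun k _ => (hi1 _).const_mul _
    have hC : ∀ k ∈ s, Integrable
        (fun x => arcCoeff a b k * ((arcFun a b x : ℂ) * en k x)) arcMeasure :=
      fun k _ => (hi1 _).const_mul _
    have hD' : ∀ k ∈ s, ∀ j ∈ s, Integrable
        (fun x => arcCoeff a b k * arcCoeff a b (-j) * en (k - j) x) arcMeasure :=
      fun k _ j _ => (continuous_en _).integrable_arcMeasure.const_mul _
    have hD : ∀ k ∈ s, Integrable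
        (fun x => ∑ j ∈ s, arcCoeff a b k * arcCoeff a b (-j) * en (k - j) x) arcMeasure :=
      fun k hk => integrable_finsetSum _ (hD' k hk)
    have hAB : Integrable (fun x => ((arcFun a b x ^ 2 : ℝ) : ℂ)
        - ∑ k ∈ s, arcCoeff a b (-k) * ((arcFun a b x : ℂ) * en (-k) x)) arcMeasure :=
      hA.sub (integrable_finsetSum _ hB)
    have hABC : Integrable (fun x => ((arcFun a b x ^ 2 : ℝ) : ℂ)
        - ∑ k ∈ s, arcCoeff a b (-k) * ((arcFun a b x : ℂ) * en (-k) x)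
        - ∑ k ∈ s, arcCoeff a b k * ((arcFun a b x : ℂ) * en k x)) arcMeasure :=
      hAB.sub (integrable_finsetSum _ hC)
    rw [integral_add hABC (integrable_finsetSum _ hD), integral_sub hAB
      (integrable_finsetSum _ hC), integral_sub hA (integrable_finsetSum _ hB),
      integral_complex_ofReal, integral_arcFun_sq ha hab hb, integral_finsetSum _ hB,
      integral_finsetSum _ hC, integral_finsetSum _ hD]
    have e1 : ∀ k ∈ s, ∫ x, arcCoeff a b (-k) * ((arcFun a b x : ℂ) * en (-k) x) ∂arcMeasure
        = 2 * Real.pi * (‖arcCoeff a b k‖ ^ 2 : ℝ) := by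
      intro k hk
      have hk0 : k ≠ 0 := fun h => hs (h ▸ hk)
      rw [integral_const_mul, integral_arcFun_mul_en ha hab hb (neg_ne_zero.2 hk0), neg_neg,
        ← star_arcCoeff, Complex.star_def, ← Complex.normSq_eq_norm_sq, ← Complex.mul_conj]
      ring
    have e2 : ∀ k ∈ s, ∫ x, arcCoeff a b k * ((arcFun a b x : ℂ) * en k x) ∂arcMeasure
        = 2 * Real.pi * (‖arcCoeff a b k‖ ^ 2 : ℝ) := by
      intro k hk
      have hk0 : k ≠ 0 := fun h => hs (h ▸ hk)
      rw [integral_const_mul, integral_arcFun_mul_en ha hab hb hk0,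
        ← star_arcCoeff, Complex.star_def, ← Complex.normSq_eq_norm_sq, ← Complex.mul_conj]
      ring
    have e3 : ∀ k ∈ s, ∫ x, ∑ j ∈ s, arcCoeff a b k * arcCoeff a b (-j) * en (k - j) x ∂arcMeasure
        = 2 * Real.pi * (‖arcCoeff a b k‖ ^ 2 : ℝ) := by
      intro k hk
      rw [integral_finsetSum _ (hD' k hk)]
      simp_rw [integral_const_mul, integral_arcMeasure_en, sub_eq_zero, mul_ite, mul_zero]
      rw [Finset.sum_ite_eq, if_pos hk,
        ← star_arcCoeff, Complex.star_def, ← Complex.normSq_eq_norm_sq, ← Complex.mul_conj]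
      push_cast
      ring
    rw [Finset.sum_congr rfl e1, Finset.sum_congr rfl e2, Finset.sum_congr rfl e3, ← Finset.mul_sum]
    push_cast
    ring
  exact_mod_cast hmain

end arc

lemma integral_boxMeasure_comp_eval {n : ℕ} (i : Fin n) {f : ℝ → ℝ}
    (hf : AEStronglyMeasurable f arcMeasure) :
    ∫ y, f (y i) ∂(boxMeasure n) = (2 * Real.pi) ^ (n - 1) * ∫ x, f x ∂arcMeasure := by
  have h1 : (boxMeasure n).map (Function.eval i)
      = (∏ _j ∈ Finset.univ.erase i, arcMeasure Set.univ) • arcMeasure := by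
    rw [boxMeasure_eq_pi, Measure.pi_map_eval]
  have h2 : AEStronglyMeasurable f ((boxMeasure n).map (Function.eval i)) := by
    rw [h1]
    exact hf.smul_measure _
  have h3 := integral_map (μ := boxMeasure n) (measurable_pi_apply i).aemeasurable h2
  rw [h1] at h3
  refine h3.symm.trans ?_
  rw [integral_smul_measure, Finset.prod_const, Finset.card_erase_of_mem (Finset.mem_univ _),
    Finset.card_univ, Fintype.card_fin, ENNReal.toReal_pow, smul_eq_mul, ← Measure.real,
    arcMeasure_real_univ]

lemma weight_const_le {n : ℕ} {l : ℝ} (hl : 0 ≤ l) (y : Fin n → ℝ) :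
    weight 0 (fun _ => l) y ≤ ∏ _p ∈ pairs n, (4 : ℝ) ^ l := by
  refine Finset.prod_le_prod (fun p _ => Real.rpow_nonneg ?_ _) fun p _ =>
    Real.rpow_le_rpow ?_ ?_ hl
  · simpa using chordSq_nonneg _ _
  · simpa using chordSq_nonneg _ _
  · have := Real.neg_one_le_cos (y p.1 - y p.2)
    unfold chordSq
    linarith

/-- The symmetric set of nonzero frequencies of absolute value less than `N`. -/
def freq (N : ℕ) : Finset ℤ :=
  (Finset.Ico 1 N).image (fun k : ℕ => (k : ℤ)) ∪ (Finset.Ico 1 N).image fun k : ℕ => -(k : ℤ)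

lemma zero_notMem_freq (N : ℕ) : 0 ∉ freq N := by
  simp only [freq, Finset.mem_union, Finset.mem_image, Finset.mem_Ico]
  rintro (⟨k, hk, h⟩ | ⟨k, hk, h⟩) <;> omega

lemma sum_freq {f : ℤ → ℝ} (hf : ∀ k, f (-k) = f k) (N : ℕ) :
    ∑ k ∈ freq N, f k = ∑ k ∈ Finset.Ico 1 N, 2 * f k := by
  rw [freq, Finset.sum_union, Finset.sum_image (by intro a _ b _ h; simpa using h),
    Finset.sum_image (by intro a _ b _ h; simpa using h), ← Finset.sum_add_distrib]
  · exact Finset.sum_congr rfl fun k _ => by rw [hf]; ring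
  · rw [Finset.disjoint_left]
    simp only [Finset.mem_image, Finset.mem_Ico]
    rintro x ⟨k, hk, rfl⟩ ⟨j, hj, h⟩
    omega

lemma tendsto_sum_one_sub_cos {t : ℝ} (h0 : 0 ≤ t) (h1 : t ≤ 2 * Real.pi) :
    Tendsto (fun N : ℕ => ∑ k ∈ Finset.Ico 1 N, (1 - Real.cos (k * t)) / (Real.pi ^ 2 * k ^ 2))
      atTop (nhds (t / (2 * Real.pi) - (t / (2 * Real.pi)) ^ 2)) := by
  have hpi := Real.pi_pos
  have hx : t / (2 * Real.pi) ∈ Set.Icc (0 : ℝ) 1 :=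
    ⟨by positivity, by rw [div_le_one (by positivity)]; exact h1⟩
  have hB : ∀ x : ℝ, (Polynomial.map (algebraMap ℚ ℝ) (Polynomial.bernoulli 2)).eval x
      = x ^ 2 - x + 1 / 6 := by
    intro x
    simp [Polynomial.bernoulli, Finset.sum_range_succ, bernoulli_two]
    ring
  have h2 := ((hasSum_zeta_two.sub (hasSum_one_div_nat_pow_mul_cos one_ne_zero hx)).div_const
    (Real.pi ^ 2)).tendsto_sum_nat
  rw [mul_one, hB] at h2
  have h3 : (Real.pi ^ 2 / 6 - (-1 : ℝ) ^ (1 + 1) * (2 * Real.pi) ^ 2 / 2 / (Nat.factorial 2 : ℕ) *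
      ((t / (2 * Real.pi)) ^ 2 - t / (2 * Real.pi) + 1 / 6)) / Real.pi ^ 2
      = t / (2 * Real.pi) - (t / (2 * Real.pi)) ^ 2 := by
    simp only [Nat.factorial]
    push_cast
    field_simp
    ring
  rw [h3] at h2
  refine h2.congr' ?_
  filter_upwards [eventually_ge_atTop 1] with N hN
  rw [Finset.range_eq_Ico, Finset.sum_eq_sum_Ico_succ_bot (by omega)]
  simp only [Nat.cast_zero, zero_add, ne_eq, OfNat.ofNat_ne_zero, not_false_eq_true, zero_pow,
    div_zero, zero_mul, sub_self, zero_div]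
  refine Finset.sum_congr rfl fun k hk => ?_
  have hk0 : (k : ℝ) ≠ 0 := by
    have := (Finset.mem_Ico.1 hk).1
    exact_mod_cast (by omega : k ≠ 0)
  rw [show 2 * Real.pi * k * (t / (2 * Real.pi)) = k * t by field_simp]
  field_simp

lemma centeredCount_eq_sum {n : ℕ} {a b : ℝ} (hab : a ≤ b) (y : Fin n → ℝ) :
    centeredCount n a b y = ∑ j, arcFun a b (y j) := by
  simp only [centeredCount, if_pos hab, arcFun, Finset.sum_sub_distrib, countIn,
    Finset.card_filter, Set.indicator_apply, Set.mem_Ico, Pi.one_apply]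
  simp
  ring

lemma abs_arcFun_le {a b : ℝ} (ha : 0 ≤ a) (hab : a ≤ b) (hb : b ≤ 2 * Real.pi) (x : ℝ) :
    |arcFun a b x| ≤ 1 := by
  have hpi := Real.pi_pos
  have h0 : 0 ≤ (b - a) / (2 * Real.pi) := div_nonneg (by linarith) (by positivity)
  have h1 : (b - a) / (2 * Real.pi) ≤ 1 := by
    rw [div_le_one (by positivity)]
    linarith
  unfold arcFun
  by_cases hx : x ∈ Set.Ico a b
  · simp only [hx, Set.indicator_of_mem, Pi.one_apply, abs_le]
    constructor <;> linarith
  · simp only [hx, not_false_eq_true, Set.indicator_of_notMem, abs_le]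
    constructor <;> linarith

section approximation

variable {n : ℕ} {a b l : ℝ}

/-- The truncated Fourier expansion of the centered counting function. -/
def countSum (a b : ℝ) (s : Finset ℤ) (y : Fin n → ℝ) : ℂ := ∑ k ∈ s, arcCoeff a b k * ps k y

lemma countSum_eq (a b : ℝ) (s : Finset ℤ) (y : Fin n → ℝ) :
    countSum a b s y = ∑ j, arcSum a b s (y j) := by
  simp only [countSum, arcSum, ps, Finset.mul_sum]
  exact Finset.sum_comm

lemma continuous_countSum (a b : ℝ) (s : Finset ℤ) : Continuous (countSum (n := n) a b s) :=
  continuous_finsetSum _ fun k _ => continuous_const.mul (torusC1_ps k).continuous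

lemma wSq_countSum (hl : 0 ≤ l) (s : Finset ℤ) :
    wSq (n := n) l (countSum a b s) = ∑ k ∈ s, ‖arcCoeff a b k‖ ^ 2 * wSq (n := n) l (ps k) := by
  have hc : ∀ p : Fin n × Fin n, 0 ≤ (fun _ => l : Fin n × Fin n → ℝ) p := fun _ => hl
  have hexp : (fun y : Fin n → ℝ => countSum a b s y * star (countSum a b s y))
      = fun y => ∑ k ∈ s, ∑ j ∈ s,
        (arcCoeff a b k * star (arcCoeff a b j)) * (ps k y * star (ps j y)) := by
    funext y
    rw [countSum, star_sum, Finset.sum_mul_sum]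
    refine Finset.sum_congr rfl fun k _ => Finset.sum_congr rfl fun j _ => ?_
    rw [star_mul']
    ring
  have hcont : ∀ k j : ℤ, Continuous fun y : Fin n → ℝ =>
      (arcCoeff a b k * star (arcCoeff a b j)) * (ps k y * star (ps j y)) := fun k j =>
    continuous_const.mul ((torusC1_ps k).continuous.mul (torusC1_ps j).star.continuous)
  have h : (wSq (n := n) l (countSum a b s) : ℂ)
      = ((∑ k ∈ s, ‖arcCoeff a b k‖ ^ 2 * wSq (n := n) l (ps k) : ℝ) : ℂ) := by
    rw [← wInt_mul_star_self, hexp, wInt_sum hc fun k _ =>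
      continuous_finsetSum _ fun j _ => hcont k j]
    push_cast
    refine Finset.sum_congr rfl fun k hk => ?_
    rw [wInt_sum hc fun j _ => hcont k j,
      Finset.sum_eq_single k]
    · rw [wInt_const_mul, wInt_mul_star_self, Complex.star_def, Complex.mul_conj,
        Complex.normSq_eq_norm_sq]
      push_cast
      ring
    · intro j _ hjk
      rw [wInt_const_mul, wInt_ps_mul_star_ps hl hjk.symm, mul_zero]
    · exact fun h => absurd hk h
  exact_mod_cast h

lemma measurable_sum_arcFun (a b : ℝ) : Measurable fun y : Fin n → ℝ => ∑ j, arcFun a b (y j) :=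
  Finset.measurable_fun_sum _ fun j _ => (measurable_arcFun a b).comp (measurable_pi_apply j)

lemma norm_sum_arcFun_le (ha : 0 ≤ a) (hab : a ≤ b) (hb : b ≤ 2 * Real.pi) (y : Fin n → ℝ) :
    ‖((∑ j, arcFun a b (y j) : ℝ) : ℂ)‖ ≤ n := by
  rw [Complex.norm_real]
  refine (norm_sum_le _ _).trans ?_
  refine (Finset.sum_le_sum fun j _ => abs_arcFun_le ha hab hb (y j)).trans ?_
  simp

lemma integrable_norm_sub_countSum_sq (hl : 0 ≤ l) (ha : 0 ≤ a) (hab : a ≤ b)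
    (hb : b ≤ 2 * Real.pi) (s : Finset ℤ) :
    Integrable (fun y : Fin n → ℝ =>
      ‖((∑ j, arcFun a b (y j) : ℝ) : ℂ) - countSum a b s y‖ ^ 2 * weight 0 (fun _ => l) y)
      (boxMeasure n) := by
  have hcs := continuous_countSum (n := n) a b s
  have hw : Continuous (weight (n := n) 0 fun _ => l) := continuous_weight (fun _ => hl) 0
  have hdom : Integrable (fun y : Fin n → ℝ =>
      ((n : ℝ) + ‖countSum a b s y‖) ^ 2 * weight 0 (fun _ => l) y) (boxMeasure n) := by
    refine Continuous.integrable_boxMeasure ?_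
    fun_prop
  refine hdom.mono' ?_ (ae_of_all _ fun y => ?_)
  · have := (Complex.measurable_ofReal.comp (measurable_sum_arcFun (n := n) a b))
    exact (((this.sub hcs.measurable).norm.pow_const 2).mul hw.measurable).aestronglyMeasurable
  · rw [Real.norm_of_nonneg (mul_nonneg (by positivity) (weight_nonneg le_rfl y))]
    refine mul_le_mul_of_nonneg_right ?_ (weight_nonneg le_rfl y)
    gcongr
    exact (norm_sub_le _ _).trans (add_le_add (norm_sum_arcFun_le ha hab hb y) le_rfl)

lemma exists_wSq_sub_countSum_le (hl : 0 ≤ l) (ha : 0 ≤ a) (hab : a ≤ b)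
    (hb : b ≤ 2 * Real.pi) :
    ∃ W : ℝ, ∀ s : Finset ℤ,
      wSq (n := n) l (fun y => ((∑ j, arcFun a b (y j) : ℝ) : ℂ) - countSum a b s y)
        ≤ W * ∫ x, ‖(arcFun a b x : ℂ) - arcSum a b s x‖ ^ 2 ∂arcMeasure := by
  set M : ℝ := ∏ _p ∈ pairs n, (4 : ℝ) ^ l with hM
  have hM0 : 0 ≤ M := Finset.prod_nonneg fun _ _ => by positivity
  refine ⟨M * n * (n * (2 * Real.pi) ^ (n - 1)), fun s => ?_⟩
  have hmeas : Measurable fun x => ‖(arcFun a b x : ℂ) - arcSum a b s x‖ ^ 2 :=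
    (((Complex.measurable_ofReal.comp (measurable_arcFun a b)).sub
      (continuous_arcSum a b s).measurable).norm.pow_const 2)
  have hint : Integrable (fun x => ‖(arcFun a b x : ℂ) - arcSum a b s x‖ ^ 2) arcMeasure := by
    have hcs := continuous_arcSum a b s
    have hdom : Integrable (fun x => (1 + ‖arcSum a b s x‖) ^ 2) arcMeasure := by
      refine Continuous.integrable_arcMeasure ?_
      fun_prop
    refine hdom.mono' hmeas.aestronglyMeasurable (ae_of_all _ fun x => ?_)
    rw [Real.norm_of_nonneg (by positivity)]
    gcongr
    refine (norm_sub_le _ _).trans (add_le_add ?_ le_rfl)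
    rw [Complex.norm_real]
    exact abs_arcFun_le ha hab hb x
  have hint' : ∀ j : Fin n, Integrable (fun y : Fin n → ℝ =>
      ‖(arcFun a b (y j) : ℂ) - arcSum a b s (y j)‖ ^ 2) (boxMeasure n) := by
    intro j
    rw [boxMeasure_eq_pi]
    exact integrable_comp_eval (μ := fun _ : Fin n => arcMeasure) (i := j) hint
  calc wSq (n := n) l (fun y => ((∑ j, arcFun a b (y j) : ℝ) : ℂ) - countSum a b s y)
      ≤ ∫ y, M * n * ∑ j, ‖(arcFun a b (y j) : ℂ) - arcSum a b s (y j)‖ ^ 2 ∂(boxMeasure n) := by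
        refine integral_mono (integrable_norm_sub_countSum_sq hl ha hab hb s)
          ((integrable_finsetSum _ fun j _ => hint' j).const_mul _) fun y => ?_
        have h1 : ‖((∑ j, arcFun a b (y j) : ℝ) : ℂ) - countSum a b s y‖ ^ 2
            ≤ n * ∑ j, ‖(arcFun a b (y j) : ℂ) - arcSum a b s (y j)‖ ^ 2 := by
          rw [countSum_eq, Complex.ofReal_sum, ← Finset.sum_sub_distrib]
          have h2 : ‖∑ j, ((arcFun a b (y j) : ℂ) - arcSum a b s (y j))‖ ^ 2
              ≤ (∑ j, ‖(arcFun a b (y j) : ℂ) - arcSum a b s (y j)‖) ^ 2 := by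
            gcongr
            exact norm_sum_le _ _
          refine h2.trans (sq_sum_le_card_mul_sum_sq.trans (le_of_eq ?_))
          simp
        calc _ ≤ (n * ∑ j, ‖(arcFun a b (y j) : ℂ) - arcSum a b s (y j)‖ ^ 2) * M :=
              mul_le_mul h1 (weight_const_le hl y) (weight_nonneg le_rfl y) (by positivity)
          _ = _ := by ring
    _ = _ := by
        rw [integral_const_mul, integral_finsetSum _ fun j _ => hint' j]
        simp_rw [fun j : Fin n => integral_boxMeasure_comp_eval j
          (f := fun x => ‖(arcFun a b x : ℂ) - arcSum a b s x‖ ^ 2) hmeas.aestronglyMeasurable]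
        simp
        ring

lemma abs_wSq_sub_wSq_countSum_le (hl : 0 ≤ l) (ha : 0 ≤ a) (hab : a ≤ b)
    (hb : b ≤ 2 * Real.pi) (s : Finset ℤ) {δ : ℝ} (hδ : 0 < δ) :
    |wSq (n := n) l (fun y => ((∑ j, arcFun a b (y j) : ℝ) : ℂ)) - wSq (n := n) l (countSum a b s)|
      ≤ (1 + n / δ) * wSq (n := n) l
          (fun y => ((∑ j, arcFun a b (y j) : ℝ) : ℂ) - countSum a b s y)
        + n * δ * wSq (n := n) l fun _ => 1 := by
  have hU : Integrable (fun y : Fin n → ℝ =>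
      ‖((∑ j, arcFun a b (y j) : ℝ) : ℂ)‖ ^ 2 * weight 0 (fun _ => l) y) (boxMeasure n) := by
    simpa [countSum] using integrable_norm_sub_countSum_sq (n := n) hl ha hab hb ∅
  have hT := integrable_wSq (n := n) hl (continuous_countSum a b s)
  have hD := integrable_norm_sub_countSum_sq (n := n) hl ha hab hb s
  have h1 := integrable_wSq (n := n) hl (continuous_const (y := (1 : ℂ)))
  unfold wSq
  rw [← integral_sub hU hT, ← integral_const_mul, ← integral_const_mul,
    ← integral_add (hD.const_mul _) (h1.const_mul _)]
  refine (abs_integral_le_integral_abs).trans (integral_mono (hU.sub hT).abs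
    ((hD.const_mul _).add (h1.const_mul _)) fun y => ?_)
  have hw := weight_nonneg (n := n) (c := fun _ => l) le_rfl y
  simp only
  rw [← sub_mul, abs_mul, abs_of_nonneg hw, norm_one, one_pow, one_mul, ← mul_assoc, ← add_mul]
  refine mul_le_mul_of_nonneg_right ?_ hw
  set u := ((∑ j, arcFun a b (y j) : ℝ) : ℂ)
  set v := countSum a b s y
  have hu : ‖u‖ ≤ n := norm_sum_arcFun_le ha hab hb y
  have huv : |‖u‖ - ‖v‖| ≤ ‖u - v‖ := abs_norm_sub_norm_le u v
  have h2 : 2 * ‖u - v‖ ≤ δ + ‖u - v‖ ^ 2 / δ := by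
    have : 0 ≤ (‖u - v‖ - δ) ^ 2 / δ := by positivity
    have e : (‖u - v‖ - δ) ^ 2 / δ = δ + ‖u - v‖ ^ 2 / δ - 2 * ‖u - v‖ := by
      field_simp
      ring
    linarith
  have h3 : |‖u‖ ^ 2 - ‖v‖ ^ 2| ≤ ‖u - v‖ ^ 2 + n * (2 * ‖u - v‖) := by
    have e : ‖u‖ ^ 2 - ‖v‖ ^ 2 = (‖u‖ - ‖v‖) * (2 * ‖u‖ - (‖u‖ - ‖v‖)) := by ring
    rw [e, abs_mul]
    calc _ ≤ ‖u - v‖ * (2 * n + ‖u - v‖) := by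
          refine mul_le_mul huv ((abs_sub _ _).trans (add_le_add ?_ huv)) (abs_nonneg _)
            (norm_nonneg _)
          rw [abs_of_nonneg (by positivity)]
          linarith
      _ = _ := by ring
  calc _ ≤ ‖u - v‖ ^ 2 + n * (δ + ‖u - v‖ ^ 2 / δ) := h3.trans (by gcongr)
    _ = _ := by ring

/-- Parseval expansion of the number variance. -/
theorem tendsto_variance_sum (hl : 0 ≤ l) (ha : 0 ≤ a) (hab : a ≤ b) (hb : b ≤ 2 * Real.pi) :
    Tendsto (fun N : ℕ => ∑ k ∈ Finset.Ico 1 N,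
        (1 - Real.cos (k * (b - a))) / (Real.pi ^ 2 * k ^ 2) * wSq (n := n) l (ps k)) atTop
      (nhds (∫ y, centeredCount n a b y ^ 2 * weight 0 (fun _ => l) y ∂(boxMeasure n))) := by
  have hpi := Real.pi_pos
  have hcos : ∀ k : ℤ, ‖arcCoeff a b (-k)‖ ^ 2 = ‖arcCoeff a b k‖ ^ 2 := fun k => by
    rw [← star_arcCoeff, norm_star]
  set U : ℝ := wSq (n := n) l (fun y => ((∑ j, arcFun a b (y j) : ℝ) : ℂ)) with hU
  have hU' : ∫ y, centeredCount n a b y ^ 2 * weight 0 (fun _ => l) y ∂(boxMeasure n) = U := by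
    rw [hU, wSq]
    congr 1
    funext y
    rw [centeredCount_eq_sum hab, Complex.norm_real, Real.norm_eq_abs, sq_abs]
  have hT : ∀ N : ℕ, wSq (n := n) l (countSum a b (freq N)) = ∑ k ∈ Finset.Ico 1 N,
      (1 - Real.cos (k * (b - a))) / (Real.pi ^ 2 * k ^ 2) * wSq (n := n) l (ps k) := by
    intro N
    rw [wSq_countSum hl, sum_freq (f := fun k => ‖arcCoeff a b k‖ ^ 2 * wSq (n := n) l (ps k))
      fun k => by rw [hcos, wSq_ps_neg]]
    refine Finset.sum_congr rfl fun k _ => ?_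
    rw [norm_arcCoeff_sq]
    push_cast
    ring
  obtain ⟨W, hW⟩ := exists_wSq_sub_countSum_le (n := n) hl ha hab hb
  set E : ℕ → ℝ := fun N => W * ((b - a) - (b - a) ^ 2 / (2 * Real.pi) - 2 * Real.pi *
    ∑ k ∈ Finset.Ico 1 N, (1 - Real.cos (k * (b - a))) / (Real.pi ^ 2 * k ^ 2)) with hE
  have hEle : ∀ N, wSq (n := n) l (fun y => ((∑ j, arcFun a b (y j) : ℝ) : ℂ)
      - countSum a b (freq N) y) ≤ E N := by
    intro N
    refine (hW _).trans (le_of_eq ?_)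
    rw [integral_norm_arcFun_sub_arcSum_sq ha hab hb (zero_notMem_freq N), sum_freq hcos, hE]
    dsimp only
    congr 3
    refine Finset.sum_congr rfl fun k _ => ?_
    rw [norm_arcCoeff_sq]
    push_cast
    ring
  have hE0 : Tendsto E atTop (nhds 0) := by
    have := ((tendsto_sum_one_sub_cos (sub_nonneg.2 hab) (by linarith : b - a ≤ 2 * Real.pi)).const_mul
      (2 * Real.pi)).const_sub ((b - a) - (b - a) ^ 2 / (2 * Real.pi)) |>.const_mul W
    convert! this using 2
    field_simp
    ring
  rw [hU', tendsto_iff_norm_sub_tendsto_zero]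
  set Z := wSq (n := n) l fun _ => 1
  have hZ0 : 0 ≤ Z := wSq_nonneg _
  rw [Metric.tendsto_atTop]
  intro ε hε
  set δ : ℝ := ε / (2 * (n * Z + 1)) with hδ
  have hδ0 : 0 < δ := by positivity
  have h1 : Tendsto (fun N => (1 + n / δ) * E N) atTop (nhds 0) := by
    simpa using hE0.const_mul (1 + n / δ)
  obtain ⟨N₀, hN₀⟩ := (h1.eventually (gt_mem_nhds (half_pos hε))).exists_forall_of_atTop
  refine ⟨N₀, fun N hN => ?_⟩
  rw [← hT, Real.dist_eq, sub_zero, abs_of_nonneg (norm_nonneg _), Real.norm_eq_abs, abs_sub_comm]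
  refine (abs_wSq_sub_wSq_countSum_le hl ha hab hb (freq N) hδ0).trans_lt ?_
  have h2 : n * δ * Z ≤ ε / 2 := by
    have h3 : δ * (n * Z + 1) = ε / 2 := by
      rw [hδ]
      field_simp
    nlinarith
  have h4 := mul_le_mul_of_nonneg_left (hEle N) (by positivity : 0 ≤ 1 + n / δ)
  have h5 := hN₀ N hN
  linarith

end approximation

section esum

variable {ι : Type*}

/-- The elementary symmetric polynomial of degree `r` in the variables `x i`, `i ∈ A`. -/
def esum (x : ι → ℂ) (A : Finset ι) (r : ℕ) : ℂ := ∑ S ∈ A.powersetCard r, ∏ i ∈ S, x i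

variable (x : ι → ℂ)

lemma esum_zero (A : Finset ι) : esum x A 0 = 1 := by simp [esum]

lemma esum_card (A : Finset ι) : esum x A A.card = ∏ i ∈ A, x i := by simp [esum]

variable [DecidableEq ι]

lemma esum_insert {a : ι} {A : Finset ι} (ha : a ∉ A) (r : ℕ) :
    esum x (insert a A) (r + 1) = esum x A (r + 1) + x a * esum x A r := by
  unfold esum
  have hd : Disjoint (A.powersetCard (r + 1)) ((A.powersetCard r).image (insert a)) := by
    rw [Finset.disjoint_left]
    intro S hS hS'
    obtain ⟨T, -, rfl⟩ := Finset.mem_image.1 hS'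
    exact ha ((Finset.mem_powersetCard.1 hS).1 (Finset.mem_insert_self a T))
  have hn : ∀ T ∈ A.powersetCard r, a ∉ T := fun T hT h => ha ((Finset.mem_powersetCard.1 hT).1 h)
  rw [Finset.powersetCard_succ_insert ha, Finset.sum_union hd, Finset.sum_image, Finset.mul_sum]
  · congr 1
    exact Finset.sum_congr rfl fun T hT => Finset.prod_insert (hn T hT)
  · intro S hS T hT h
    rw [← Finset.erase_insert (hn S hS), ← Finset.erase_insert (hn T hT)]
    exact congrArg (fun U => U.erase a) h

lemma esum_erase {a : ι} {A : Finset ι} (ha : a ∈ A) (r : ℕ) :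
    esum x A (r + 1) = esum x (A.erase a) (r + 1) + x a * esum x (A.erase a) r := by
  rw [← esum_insert x (Finset.notMem_erase a A), Finset.insert_erase ha]

lemma sum_mul_esum_erase (A : Finset ι) (r : ℕ) :
    ∑ j ∈ A, x j * esum x (A.erase j) r = (r + 1) * esum x A (r + 1) := by
  induction A using Finset.induction_on generalizing r with
  | empty => simp [esum, Finset.powersetCard_eq_empty.2 (Finset.card_empty.trans_lt r.succ_pos)]
  | insert a A ha ih =>
    have he : ∀ j ∈ A, (insert a A).erase j = insert a (A.erase j) := fun j hj =>
      Finset.erase_insert_of_ne fun h => ha (h ▸ hj)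
    have hne : ∀ j ∈ A, a ∉ A.erase j := fun j _ h => ha (Finset.mem_of_mem_erase h)
    rw [Finset.sum_insert ha, Finset.erase_insert ha, esum_insert x ha]
    cases r with
    | zero =>
      have h := ih 0
      simp only [esum_zero] at h ⊢
      rw [h]
      push_cast; ring
    | succ r =>
      rw [Finset.sum_congr rfl (g := fun j => x j * esum x (A.erase j) (r + 1)
        + x a * (x j * esum x (A.erase j) r))]
      · rw [Finset.sum_add_distrib, ← Finset.mul_sum, ih, ih]
        push_cast; ring
      · intro j hj
        rw [he j hj, esum_insert x (hne j hj)]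
        ring

lemma sum_esum_erase (A : Finset ι) (r : ℕ) :
    ∑ j ∈ A, esum x (A.erase j) r = (A.card - r) * esum x A r := by
  cases r with
  | zero => simp [esum_zero]
  | succ r =>
    have h := sum_mul_esum_erase x A r
    rw [Finset.sum_congr rfl (g := fun j => esum x A (r + 1) - x j * esum x (A.erase j) r)]
    · rw [Finset.sum_sub_distrib, h]
      simp; ring
    · intro j hj
      rw [esum_erase x hj]; ring

lemma card_erase_cast {A : Finset ι} {j : ι} (hj : j ∈ A) : ((A.erase j).card : ℂ) = A.card - 1 := by
  rw [eq_sub_iff_add_eq]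
  exact_mod_cast Finset.card_erase_add_one hj

lemma sum_sum_esum_erase (A : Finset ι) (r : ℕ) :
    ∑ j ∈ A, ∑ k ∈ A.erase j, esum x ((A.erase j).erase k) r
      = (A.card - 1 - r) * ((A.card - r) * esum x A r) := by
  rw [← sum_esum_erase, Finset.mul_sum]
  exact Finset.sum_congr rfl fun j hj => by rw [sum_esum_erase, card_erase_cast hj]

lemma sum_sum_mul_esum_erase (A : Finset ι) (r : ℕ) :
    ∑ j ∈ A, ∑ k ∈ A.erase j, x j * esum x ((A.erase j).erase k) r
      = (A.card - 1 - r) * ((r + 1) * esum x A (r + 1)) := by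
  rw [← sum_mul_esum_erase, Finset.mul_sum]
  refine Finset.sum_congr rfl fun j hj => ?_
  rw [← Finset.mul_sum, sum_esum_erase, card_erase_cast hj]
  ring

lemma sum_sum_pair_esum_erase (A : Finset ι) (r : ℕ) :
    ∑ j ∈ A, ∑ k ∈ A.erase j, (2 - x j - x k) * esum x ((A.erase j).erase k) r
      = 2 * (A.card - 1 - r) * ((A.card - r) * esum x A r - (r + 1) * esum x A (r + 1)) := by
  have hc : ∑ j ∈ A, ∑ k ∈ A.erase j, x k * esum x ((A.erase j).erase k) r
      = ∑ j ∈ A, ∑ k ∈ A.erase j, x j * esum x ((A.erase j).erase k) r := by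
    rw [Finset.sum_comm' (t' := A) (s' := fun k => A.erase k)]
    · exact Finset.sum_congr rfl fun j _ => Finset.sum_congr rfl fun k _ => by
        rw [Finset.erase_right_comm]
    · intro j k
      simp only [Finset.mem_erase]
      tauto
  have h1 := sum_sum_esum_erase x A r
  have h2 := sum_sum_mul_esum_erase x A r
  have : ∑ j ∈ A, ∑ k ∈ A.erase j, (2 - x j - x k) * esum x ((A.erase j).erase k) r
      = 2 * ∑ j ∈ A, ∑ k ∈ A.erase j, esum x ((A.erase j).erase k) r
        - ∑ j ∈ A, ∑ k ∈ A.erase j, x j * esum x ((A.erase j).erase k) r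
        - ∑ j ∈ A, ∑ k ∈ A.erase j, x k * esum x ((A.erase j).erase k) r := by
    simp only [Finset.mul_sum, ← Finset.sum_sub_distrib]
    exact Finset.sum_congr rfl fun j _ => Finset.sum_congr rfl fun k _ => by ring
  rw [this, hc, h1, h2]
  ring

lemma mul_esum_erase_sub {A : Finset ι} {j k : ι} (hj : j ∈ A) (hk : k ∈ A) (hjk : j ≠ k) (r : ℕ) :
    x j * esum x (A.erase j) r - x k * esum x (A.erase k) r
      = (x j - x k) * esum x ((A.erase j).erase k) r := by
  cases r with
  | zero => simp [esum_zero]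
  | succ r =>
    rw [esum_erase x (Finset.mem_erase.2 ⟨hjk.symm, hk⟩), esum_erase x (Finset.mem_erase.2 ⟨hjk, hj⟩),
      Finset.erase_right_comm (a := k)]
    ring

end esum

lemma pd_eq_zero {n : ℕ} {F : (Fin n → ℝ) → ℂ} {j : Fin n} (hF : TorusC1 F)
    (h : ∀ y t, F (y + Pi.single j t) = F y) (y : Fin n → ℝ) : pd j F y = 0 := by
  rw [pd, ← (hF.differentiableAt y).lineDeriv_eq_fderiv, lineDeriv]
  have : (fun t : ℝ => F (y + t • Pi.single j (1 : ℝ))) = fun _ => F y := by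
    funext t
    rw [← Pi.single_smul, smul_eq_mul, mul_one, h]
  rw [this, deriv_const]

lemma sum_pairs_succ {M : Type*} [AddCommMonoid M] {N : ℕ} (f : Fin (N + 1) × Fin (N + 1) → M) :
    ∑ q ∈ pairs (N + 1), f q
      = ∑ j : Fin N, f (0, j.succ) + ∑ q ∈ pairs N, f (q.1.succ, q.2.succ) := by
  have h : ∀ (m : ℕ) (g : Fin m × Fin m → M),
      ∑ q ∈ pairs m, g q = ∑ i, ∑ j, if i < j then g (i, j) else 0 := by
    intro m g
    rw [pairs, Finset.sum_filter, ← Finset.univ_product_univ, Finset.sum_product]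
  simp [h, Fin.sum_univ_succ]

lemma prod_pairs_succ {M : Type*} [CommMonoid M] {N : ℕ} (f : Fin (N + 1) × Fin (N + 1) → M) :
    ∏ q ∈ pairs (N + 1), f q
      = (∏ j : Fin N, f (0, j.succ)) * ∏ q ∈ pairs N, f (q.1.succ, q.2.succ) :=
  sum_pairs_succ (M := Additive M) f

/-- The exponents equal to `p` on the pairs containing the particle `0` and to `l` elsewhere. -/
def impExp {N : ℕ} (p l : ℝ) (q : Fin (N + 1) × Fin (N + 1)) : ℝ := if q.1 = 0 then p else l

lemma impExp_nonneg {N : ℕ} {p l : ℝ} (hp : 0 ≤ p) (hl : 0 ≤ l) (q : Fin (N + 1) × Fin (N + 1)) :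
    0 ≤ impExp p l q := by
  unfold impExp; split_ifs <;> assumption

/-- The variables `1 - e^{i(y_{j+1} - y_0)}`. -/
def relVar {N : ℕ} (y : Fin (N + 1) → ℝ) (j : Fin N) : ℂ := 1 - en 1 (y j.succ) * en (-1) (y 0)

section relVar

variable {N : ℕ}

lemma torusC1_relVar (j : Fin N) : TorusC1 (fun y => relVar y j) := by
  have h := (TorusC1.const (n := N + 1) 1).add
    ((TorusC1.const (-1)).mul ((TorusC1.en 1 j.succ).mul (TorusC1.en (-1) 0)))
  convert! h using 2 with y
  simp [relVar]; ring

lemma pd_relVar (j : Fin N) (y : Fin (N + 1) → ℝ) :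
    pd j.succ (fun y => relVar y j) y = Complex.I * (relVar y j - 1) := by
  have h : (fun y : Fin (N + 1) → ℝ => relVar y j)
      = fun y => 1 + (-1) * (en 1 (y j.succ) * en (-1) (y 0)) := by
    funext y; simp [relVar]; ring
  rw [h, pd_add (TorusC1.const 1) ((TorusC1.const _).mul ((TorusC1.en _ _).mul (TorusC1.en _ _))),
    pd_mul (TorusC1.const _) ((TorusC1.en _ _).mul (TorusC1.en _ _)),
    pd_mul (TorusC1.en _ _) (TorusC1.en _ _), pd_const, pd_const, pd_en, pd_en,
    if_pos rfl, if_neg (Fin.succ_ne_zero j).symm, relVar]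
  push_cast; ring

lemma relVar_add_single {i j : Fin N} (h : i ≠ j) (y : Fin (N + 1) → ℝ) (t : ℝ) :
    relVar (y + Pi.single j.succ t) i = relVar y i := by
  simp [relVar, h, (Fin.succ_ne_zero j).symm]

lemma en_neg_one_mul (x : ℝ) : en (-1) x * en 1 x = 1 := by
  rw [en_mul]; simp

lemma sin_sub_eq (x y : ℝ) : ((2 * Real.sin (x - y) : ℝ) : ℂ)
    = -Complex.I * (en 1 x * en (-1) y - en (-1) x * en 1 y) := by
  have hx := en_one_eq x
  have hy := en_one_eq y
  have hx' : en (-1) x = star (en 1 x) := by rw [star_en]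
  have hy' : en (-1) y = star (en 1 y) := by rw [star_en]
  rw [hx', hy', hx, hy]
  apply Complex.ext <;>
  simp only [Real.sin_sub, Complex.ofReal_re, Complex.ofReal_im, Complex.mul_re, Complex.mul_im,
    Complex.neg_re, Complex.neg_im, Complex.sub_re, Complex.sub_im, Complex.add_re, Complex.add_im,
    Complex.star_def, Complex.conj_re, Complex.conj_im, Complex.I_re, Complex.I_im] <;> ring

lemma chordSq_eq (x y : ℝ) : (chordSq x y : ℂ)
    = 2 - (en 1 x * en (-1) y + en (-1) x * en 1 y) := by
  have hx := en_one_eq x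
  have hy := en_one_eq y
  have hx' : en (-1) x = star (en 1 x) := by rw [star_en]
  have hy' : en (-1) y = star (en 1 y) := by rw [star_en]
  rw [hx', hy', hx, hy, chordSq]
  apply Complex.ext <;>
  simp only [Real.cos_sub, Complex.ofReal_re, Complex.ofReal_im, Complex.mul_re, Complex.mul_im,
    Complex.sub_re, Complex.sub_im, Complex.add_re, Complex.add_im, Complex.re_ofNat,
    Complex.im_ofNat,
    Complex.star_def, Complex.conj_re, Complex.conj_im, Complex.I_re, Complex.I_im] <;> ring

lemma relVar_sub_mul_sin (y : Fin (N + 1) → ℝ) (j k : Fin N) :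
    (relVar y j - relVar y k) * ((2 * Real.sin (y j.succ - y k.succ) : ℝ) : ℂ)
      = (chordSq (y j.succ) (y k.succ) : ℂ) * (-Complex.I * (2 - relVar y j - relVar y k)) := by
  rw [sin_sub_eq, chordSq_eq]
  unfold relVar
  have h1 := en_neg_one_mul (y j.succ)
  have h2 := en_neg_one_mul (y k.succ)
  generalize en 1 (y j.succ) = a at *
  generalize en (-1) (y j.succ) = a' at *
  generalize en 1 (y k.succ) = b at *
  generalize en (-1) (y k.succ) = b' at *
  generalize en (-1) (y 0) = z at *
  linear_combination (-2 * Complex.I * b * z) * h1 - (2 * Complex.I * a * z) * h2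

lemma relVar_mul_sin (y : Fin (N + 1) → ℝ) (j : Fin N) :
    relVar y j * ((2 * Real.sin (y 0 - y j.succ) : ℝ) : ℂ)
      = (chordSq (y 0) (y j.succ) : ℂ) * (Complex.I * (2 - relVar y j)) := by
  rw [sin_sub_eq, chordSq_eq]
  unfold relVar
  have h1 := en_neg_one_mul (y j.succ)
  have h2 := en_neg_one_mul (y 0)
  generalize en 1 (y j.succ) = a at *
  generalize en (-1) (y j.succ) = a' at *
  generalize en 1 (y 0) = b at *
  generalize en (-1) (y 0) = b' at *
  linear_combination (2 * Complex.I * b' * b) * h1 + (2 * Complex.I) * h2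

lemma star_relVar_mul (y : Fin (N + 1) → ℝ) (j : Fin N) :
    star (relVar y j) * relVar y j = (chordSq (y 0) (y j.succ) : ℂ) := by
  rw [chordSq_eq]
  unfold relVar
  rw [star_sub, star_mul', star_en, star_en, star_one, neg_neg]
  have h1 := en_neg_one_mul (y j.succ)
  have h2 := en_neg_one_mul (y 0)
  generalize en 1 (y j.succ) = a at *
  generalize en (-1) (y j.succ) = a' at *
  generalize en 1 (y 0) = b at *
  generalize en (-1) (y 0) = b' at *
  linear_combination h1 + (a * a') * h2

lemma torusC1_esum_relVar (A : Finset (Fin N)) (r : ℕ) :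
    TorusC1 (fun y => esum (relVar y) A r) :=
  TorusC1.sum fun _ _ => TorusC1.prod fun i _ => torusC1_relVar i

lemma pd_esum_relVar (A : Finset (Fin N)) {j : Fin N} (hj : j ∉ A) (r : ℕ) (y : Fin (N + 1) → ℝ) :
    pd j.succ (fun y => esum (relVar y) A r) y = 0 := by
  refine pd_eq_zero (torusC1_esum_relVar A r) (fun y t => ?_) y
  refine Finset.sum_congr rfl fun S hS => Finset.prod_congr rfl fun i hi => ?_
  refine relVar_add_single (fun h => hj ?_) y t
  exact h ▸ (Finset.mem_powersetCard.1 hS).1 hi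

end relVar

section recurrence

variable {N : ℕ}

lemma sum_pairs_pair_esum (x : Fin N → ℂ) (r : ℕ) :
    ∑ q ∈ pairs N, (2 - x q.1 - x q.2) * esum x ((Finset.univ.erase q.1).erase q.2) r
      = (N - 1 - r) * ((N - r) * esum x Finset.univ r - (r + 1) * esum x Finset.univ (r + 1)) := by
  set f : Fin N → Fin N → ℂ := fun j k =>
    if k = j then 0 else (2 - x j - x k) * esum x ((Finset.univ.erase j).erase k) r with hf
  have hsymm : ∀ j k, f j k = f k j := by
    intro j k
    simp only [hf, eq_comm (a := k) (b := j)]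
    rw [Finset.erase_right_comm]
    split_ifs
    · rfl
    · ring
  have h1 := sum_sum_eq_two_mul_sum_pairs hsymm
  have h2 : ∑ j, ∑ k, f j k = ∑ j, ∑ k ∈ Finset.univ.erase j,
      (2 - x j - x k) * esum x ((Finset.univ.erase j).erase k) r := by
    refine Finset.sum_congr rfl fun j _ => ?_
    rw [← Finset.add_sum_erase _ _ (Finset.mem_univ j)]
    simp only [hf, if_true, zero_add]
    exact Finset.sum_congr rfl fun k hk => if_neg (Finset.ne_of_mem_erase hk)
  have h3 : ∑ q ∈ pairs N, f q.1 q.2 = ∑ q ∈ pairs N,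
      (2 - x q.1 - x q.2) * esum x ((Finset.univ.erase q.1).erase q.2) r :=
    Finset.sum_congr rfl fun q hq => if_neg (Finset.mem_filter.1 hq).2.ne'
  have h4 : ∑ j, f j j = 0 := by simp [hf]
  rw [h2, sum_sum_pair_esum_erase, h3, h4, Finset.card_univ, Fintype.card_fin] at h1
  linear_combination -h1 / 2

lemma wInt_mul_esum_succ {p l : ℝ} (hp : 0 ≤ p) (hl : 0 ≤ l) {Φ : (Fin (N + 1) → ℝ) → ℂ}
    (hΦ : TorusC1 Φ) {κ : ℂ}
    (hκ : ∀ (j : Fin N) y, pd j.succ Φ y * relVar y j = -Complex.I * κ * Φ y) (r : ℕ) :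
    (r + 1) * (1 + p + l * (N - 1 - r))
        * wInt (impExp p l) (fun y => Φ y * esum (relVar y) Finset.univ (r + 1))
      = (N - r) * (1 + κ + 2 * p + l * (N - 1 - r))
        * wInt (impExp p l) (fun y => Φ y * esum (relVar y) Finset.univ r) := by
  set E : Finset (Fin N) → ℕ → (Fin (N + 1) → ℝ) → ℂ := fun A r y => esum (relVar y) A r with hE
  have hEc : ∀ A r, TorusC1 (E A r) := fun A r => torusC1_esum_relVar A r
  set G : Fin (N + 1) → (Fin (N + 1) → ℝ) → ℂ := Fin.cons (fun _ => 0) fun j y =>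
    Φ y * (relVar y j * E (Finset.univ.erase j) r y) with hG
  set A : Fin (N + 1) × Fin (N + 1) → (Fin (N + 1) → ℝ) → ℂ := fun q =>
    Fin.cases (motive := fun _ => (Fin (N + 1) → ℝ) → ℂ)
      (Fin.cases (motive := fun _ => (Fin (N + 1) → ℝ) → ℂ) (fun _ => 0) (fun j y =>
        -Complex.I * Φ y * ((2 - relVar y j) * E (Finset.univ.erase j) r y)) q.2)
      (fun j => Fin.cases (motive := fun _ => (Fin (N + 1) → ℝ) → ℂ) (fun _ => 0) (fun k y =>
        -Complex.I * Φ y * ((2 - relVar y j - relVar y k)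
          * E ((Finset.univ.erase j).erase k) r y)) q.2) q.1 with hA
  have hrel : ∀ j : Fin N, Continuous fun y : Fin (N + 1) → ℝ => relVar y j :=
    fun j => (torusC1_relVar j).continuous
  have hΦc := hΦ.continuous
  have hEcont : ∀ B r, Continuous (E B r) := fun B r => (hEc B r).continuous
  have hGC : ∀ j, TorusC1 (G j) := by
    intro j
    refine Fin.cases (TorusC1.const 0) (fun j => ?_) j
    exact hΦ.mul ((torusC1_relVar j).mul (hEc _ _))
  have hAC : ∀ q, Continuous (A q) := by
    rintro ⟨i, k⟩
    refine Fin.cases ?_ (fun i => ?_) i <;> refine Fin.cases ?_ (fun k => ?_) k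
    · exact continuous_const
    · have := hrel k
      have := hEcont (Finset.univ.erase k) r
      simp only [hA, Fin.cases_zero, Fin.cases_succ]
      fun_prop
    · exact continuous_const
    · have := hrel k
      have := hrel i
      have := hEcont ((Finset.univ.erase i).erase k) r
      simp only [hA, Fin.cases_succ]
      fun_prop
  have hGA : ∀ q ∈ pairs (N + 1), ∀ y, (G q.1 y - G q.2 y) *
      ((2 * Real.sin (y q.1 - y q.2) : ℝ) : ℂ) = (chordSq (y q.1) (y q.2) : ℂ) * A q y := by
    rintro ⟨i, k⟩ hq y
    have hlt : i < k := (Finset.mem_filter.1 hq).2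
    clear hq
    induction i using Fin.cases with
    | zero =>
      induction k using Fin.cases with
      | zero => exact absurd hlt (lt_irrefl _)
      | succ k =>
        simp only [hG, hA, Fin.cons_zero, Fin.cons_succ, Fin.cases_zero, Fin.cases_succ]
        linear_combination (-Φ y * E (Finset.univ.erase k) r y) * relVar_mul_sin y k
    | succ i =>
      induction k using Fin.cases with
      | zero => exact absurd hlt (Fin.not_lt_zero _)
      | succ k =>
        have hik : i ≠ k := (Fin.succ_lt_succ_iff.1 hlt).ne
        simp only [hG, hA, Fin.cons_succ, Fin.cases_succ]
        have h := mul_esum_erase_sub (relVar y) (Finset.mem_univ i) (Finset.mem_univ k) hik r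
        linear_combination (Φ y * E ((Finset.univ.erase i).erase k) r y) * relVar_sub_mul_sin y i k
          + Φ y * ((2 * Real.sin (y i.succ - y k.succ) : ℝ) : ℂ) * h
  have key := integral_divergence_weight (impExp_nonneg hp hl) hGC hAC hGA
  have hpt : ∀ y, ∑ j, pd j (G j) y + ∑ q ∈ pairs (N + 1), (impExp p l q : ℂ) * A q y
      = Complex.I * ((r + 1) * (1 + p + l * (N - 1 - r))) * (Φ y * E Finset.univ (r + 1) y)
        - Complex.I * ((N - r) * (1 + κ + 2 * p + l * (N - 1 - r))) * (Φ y * E Finset.univ r y) := by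
    intro y
    have h1 := sum_mul_esum_erase (relVar y) Finset.univ r
    have h2 := sum_esum_erase (relVar y) Finset.univ r
    have h3 := sum_pairs_pair_esum (relVar y) r
    rw [Finset.card_univ, Fintype.card_fin] at h2
    have hpd : ∀ j : Fin N, pd j.succ (fun y => Φ y * (relVar y j * E (Finset.univ.erase j) r y)) y
        = Complex.I * Φ y * (relVar y j * E (Finset.univ.erase j) r y)
          - Complex.I * (1 + κ) * Φ y * E (Finset.univ.erase j) r y := by
      intro j
      rw [pd_mul hΦ ((torusC1_relVar j).mul (hEc _ _)), pd_mul (torusC1_relVar j) (hEc _ _),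
        pd_relVar, pd_esum_relVar _ (Finset.notMem_erase j _)]
      linear_combination E (Finset.univ.erase j) r y * hκ j y
    have hs : ∑ j, pd j (G j) y = Complex.I * Φ y * ((r + 1) * E Finset.univ (r + 1) y)
        - Complex.I * (1 + κ) * Φ y * ((N - r) * E Finset.univ r y) := by
      simp only [Fin.sum_univ_succ, hG, Fin.cons_zero, Fin.cons_succ, pd_const, zero_add, hpd]
      rw [Finset.sum_sub_distrib, ← Finset.mul_sum, ← Finset.mul_sum]
      simp only [hE]
      rw [h1, h2]
    rw [hs, sum_pairs_succ]
    simp only [hA, Fin.cases_zero, Fin.cases_succ, impExp, if_true, if_neg (Fin.succ_ne_zero _)]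
    have h4 : ∑ j : Fin N, (p : ℂ) * (-Complex.I * Φ y *
        ((2 - relVar y j) * E (Finset.univ.erase j) r y))
        = p * (-Complex.I * Φ y) * (2 * ((N - r) * E Finset.univ r y)
          - (r + 1) * E Finset.univ (r + 1) y) := by
      simp only [hE]
      rw [← h1, ← h2]
      simp only [Finset.mul_sum, ← Finset.sum_sub_distrib]
      exact Finset.sum_congr rfl fun j _ => by ring
    have h5 : ∑ q ∈ pairs N, (l : ℂ) * (-Complex.I * Φ y * ((2 - relVar y q.1 - relVar y q.2)
        * E ((Finset.univ.erase q.1).erase q.2) r y)) = l * (-Complex.I * Φ y) *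
        ((N - 1 - r) * ((N - r) * E Finset.univ r y - (r + 1) * E Finset.univ (r + 1) y)) := by
      simp only [hE]
      rw [← h3]
      simp only [Finset.mul_sum]
      exact Finset.sum_congr rfl fun j _ => by ring
    rw [h4, h5]
    ring
  have h0 : wInt (impExp p l) (fun y =>
      Complex.I * ((r + 1) * (1 + p + l * (N - 1 - r))) * (Φ y * E Finset.univ (r + 1) y)
        - Complex.I * ((N - r) * (1 + κ + 2 * p + l * (N - 1 - r))) * (Φ y * E Finset.univ r y))
      = 0 := by
    rw [← key, wInt]
    simp only [hpt]
  have hc1 := hEcont Finset.univ (r + 1)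
  have hc2 := hEcont Finset.univ r
  rw [wInt_sub (impExp_nonneg hp hl) (by fun_prop) (by fun_prop), wInt_const_mul,
    wInt_const_mul] at h0
  have hI := Complex.I_ne_zero
  refine mul_left_cancel₀ hI ?_
  linear_combination h0

/-- The ratio of the top to the bottom elementary symmetric average. -/
def topRatio (N : ℕ) (κ p l : ℝ) : ℝ :=
  ∏ j ∈ Finset.range N, (1 + κ + 2 * p + l * j) / (1 + p + l * j)

lemma wInt_mul_prod_relVar {p l : ℝ} (hp : 0 ≤ p) (hl : 0 ≤ l) {Φ : (Fin (N + 1) → ℝ) → ℂ}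
    (hΦ : TorusC1 Φ) {κ : ℝ}
    (hκ : ∀ (j : Fin N) y, pd j.succ Φ y * relVar y j = -Complex.I * κ * Φ y) :
    wInt (impExp p l) (fun y => Φ y * ∏ j, relVar y j)
      = topRatio N κ p l * wInt (impExp p l) Φ := by
  have hstep : ∀ r ≤ N, (∏ s ∈ Finset.range r, ((s : ℂ) + 1)) *
      wInt (impExp p l) (fun y => Φ y * esum (relVar y) Finset.univ r)
      = (∏ s ∈ Finset.range r, ((N : ℂ) - s)) *
        (∏ s ∈ Finset.range r, (((1 + κ + 2 * p + l * (N - 1 - s : ℕ)) /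
          (1 + p + l * (N - 1 - s : ℕ)) : ℝ) : ℂ)) * wInt (impExp p l) Φ := by
    intro r
    induction r with
    | zero => intro _; simp [esum_zero]
    | succ r ih =>
      intro hr
      have h := wInt_mul_esum_succ hp hl hΦ hκ r
      have hcast : ((N - 1 - r : ℕ) : ℂ) = N - 1 - r := by
        rw [show N - 1 - r = N - (r + 1) by omega, Nat.cast_sub hr]
        push_cast; ring
      have hne : (1 + p + l * (N - 1 - r) : ℂ) ≠ 0 := by
        rw [← hcast]
        have : (0 : ℝ) < 1 + p + l * (N - 1 - r : ℕ) := by positivity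
        exact_mod_cast this.ne'
      specialize ih (by omega)
      rw [Finset.prod_range_succ, Finset.prod_range_succ, Finset.prod_range_succ]
      push_cast
      push_cast at ih
      rw [hcast]
      generalize (∏ s ∈ Finset.range r, ((s : ℂ) + 1)) = f at *
      generalize (∏ s ∈ Finset.range r, ((1 + κ + 2 * p + l * (N - 1 - s : ℕ)) /
          (1 + p + l * (N - 1 - s : ℕ)) : ℂ)) = g at *
      refine mul_left_cancel₀ hne ?_
      field_simp
      linear_combination f * h
        + ((N - r) * (1 + κ + 2 * p + l * (N - 1 - r))) * ih
  have h := hstep N le_rfl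
  have hfac : ∏ s ∈ Finset.range N, ((N : ℂ) - s) = ∏ s ∈ Finset.range N, ((s : ℂ) + 1) := by
    rw [← Finset.prod_range_reflect]
    refine Finset.prod_congr rfl fun s hs => ?_
    rw [Finset.mem_range] at hs
    rw [show N - 1 - s = N - (s + 1) by omega, Nat.cast_sub (by omega)]
    push_cast; ring
  have hne : ∏ s ∈ Finset.range N, ((s : ℂ) + 1) ≠ 0 :=
    Finset.prod_ne_zero_iff.2 fun s _ => Nat.cast_add_one_ne_zero s
  have htop : ∀ y : Fin (N + 1) → ℝ, esum (relVar y) Finset.univ N = ∏ j, relVar y j := by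
    intro y
    rw [← esum_card (relVar y) Finset.univ, Finset.card_univ, Fintype.card_fin]
  have hprod : ∏ s ∈ Finset.range N, (((1 + κ + 2 * p + l * (N - 1 - s : ℕ)) /
          (1 + p + l * (N - 1 - s : ℕ)) : ℝ) : ℂ) = topRatio N κ p l := by
    rw [topRatio, Complex.ofReal_prod]
    exact Finset.prod_range_reflect
      (fun s : ℕ => (((1 + κ + 2 * p + l * s) / (1 + p + l * s) : ℝ) : ℂ)) N
  rw [hfac, hprod, mul_assoc] at h
  simpa only [htop] using mul_left_cancel₀ hne h

/-- The partition function with exponent `p` for the particle `0` and `l` for the others. -/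
def impZ (N : ℕ) (l p : ℝ) : ℝ := ∫ y, weight 0 (impExp (N := N) p l) y ∂(boxMeasure (N + 1))

lemma wInt_one_impExp {p l : ℝ} : wInt (impExp (N := N) p l) (fun _ => 1) = impZ N l p := by
  simp only [wInt, one_mul, impZ]
  exact integral_ofReal

lemma impZ_add_one {p l : ℝ} (hp : 0 ≤ p) (hl : 0 ≤ l) :
    impZ N l (p + 1) = topRatio N 1 p l * topRatio N 0 p l * impZ N l p := by
  have h0 := wInt_mul_prod_relVar (N := N) hp hl (TorusC1.const 1) (κ := 0) (by simp [pd_const])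
  have hstar : TorusC1 (fun y : Fin (N + 1) → ℝ => ∏ j : Fin N, star (relVar y j)) :=
    TorusC1.prod fun j _ => (torusC1_relVar j).star
  have h1 := wInt_mul_prod_relVar (N := N) hp hl hstar (κ := 1) (by
    intro j y
    have hsplit : (fun y : Fin (N + 1) → ℝ => ∏ i : Fin N, star (relVar y i))
        = fun y => star (relVar y j) * ∏ i ∈ Finset.univ.erase j, star (relVar y i) := by
      funext y
      rw [Finset.mul_prod_erase _ (fun i => star (relVar y i)) (Finset.mem_univ j)]
    have hrest : TorusC1 (fun y : Fin (N + 1) → ℝ => ∏ i ∈ Finset.univ.erase j, star (relVar y i)) :=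
      TorusC1.prod fun j _ => (torusC1_relVar j).star
    rw [← Finset.mul_prod_erase _ (fun i => star (relVar y i)) (Finset.mem_univ j), hsplit,
      pd_mul (torusC1_relVar j).star hrest, pd_star (torusC1_relVar j), pd_relVar,
      pd_eq_zero hrest]
    · have hx : star (relVar y j) * relVar y j = star (relVar y j) + relVar y j := by
        unfold relVar
        rw [star_sub, star_mul', star_en, star_en, star_one, neg_neg]
        have h1 := en_neg_one_mul (y j.succ)
        have h2 := en_neg_one_mul (y 0)
        generalize en 1 (y j.succ) = a at *
        generalize en (-1) (y j.succ) = a' at *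
        generalize en 1 (y 0) = b at *
        generalize en (-1) (y 0) = b' at *
        linear_combination (b' * b) * h1 + h2
      have hI : star Complex.I = -Complex.I := Complex.conj_I
      rw [star_mul', star_sub, star_one, hI]
      push_cast
      linear_combination (-Complex.I * ∏ i ∈ Finset.univ.erase j, star (relVar y i)) * hx
    · intro y t
      refine Finset.prod_congr rfl fun i hi => ?_
      rw [relVar_add_single (Finset.ne_of_mem_erase hi)])
  have hst : wInt (impExp (N := N) p l) (fun y => ∏ j : Fin N, star (relVar y j))
      = topRatio N 0 p l * impZ N l p := by
    have : (fun y : Fin (N + 1) → ℝ => ∏ j : Fin N, star (relVar y j))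
        = fun y => star (1 * ∏ j : Fin N, relVar y j) := by
      funext y; rw [one_mul, star_prod]
    rw [this, wInt_star, h0, wInt_one_impExp, Complex.star_def, map_mul, Complex.conj_ofReal,
      Complex.conj_ofReal]
  rw [hst] at h1
  have hl1 : wInt (impExp (N := N) p l)
      (fun y => (∏ j : Fin N, star (relVar y j)) * ∏ j : Fin N, relVar y j) = impZ N l (p + 1) := by
    rw [← wInt_one_impExp, wInt, wInt]
    refine integral_congr_ae (Eventually.of_forall fun y => ?_)
    simp only [one_mul, ← Finset.prod_mul_distrib, star_relVar_mul, ← Complex.ofReal_prod,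
      ← Complex.ofReal_mul, weight, zero_add, prod_pairs_succ, impExp, if_true,
      if_neg (Fin.succ_ne_zero _), ← mul_assoc]
    congr 3
    funext j
    rw [Real.rpow_add_one' (chordSq_nonneg _ _) (by positivity), mul_comm]
  rw [hl1] at h1
  rw [mul_assoc]
  exact_mod_cast h1

end recurrence

/-- The partition function with all exponents equal to `l`. -/
def circZ (n : ℕ) (l : ℝ) : ℝ := ∫ y, weight 0 (fun _ => l) y ∂(boxMeasure n)

lemma circZ_zero (l : ℝ) : circZ 0 l = 1 := by
  have h : ∀ y : Fin 0 → ℝ, weight 0 (fun _ => l) y = 1 := fun y => by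
    simp [weight, Subsingleton.elim (pairs 0) ∅]
  rw [circZ, boxMeasure_eq_pi]
  simp [h, Measure.real]

lemma impZ_self (N : ℕ) (l : ℝ) : impZ N l l = circZ (N + 1) l := by
  have : (impExp l l : Fin (N + 1) × Fin (N + 1) → ℝ) = fun _ => l := by
    funext q; simp [impExp]
  rw [impZ, this, circZ]

lemma impZ_zero (N : ℕ) (l : ℝ) : impZ N l 0 = 2 * Real.pi * circZ N l := by
  have h : ∀ y : Fin (N + 1) → ℝ, weight 0 (impExp 0 l) y
      = weight 0 (fun _ => l) (MeasurableEquiv.piFinSuccAbove (fun _ => ℝ) 0 y).2 := by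
    intro y
    simp only [weight, prod_pairs_succ, impExp, if_true, if_neg (Fin.succ_ne_zero _),
      Real.rpow_zero, Finset.prod_const_one, one_mul]
    rfl
  have hm := measurePreserving_piFinSuccAbove (n := N) (fun _ => arcMeasure) 0
  simp only [impZ, circZ, h, boxMeasure_eq_pi]
  rw [hm.integral_comp (MeasurableEquiv.measurableEmbedding _)
    (fun z : ℝ × (Fin N → ℝ) => weight 0 (fun _ => l) z.2),
    integral_fun_snd, arcMeasure_real_univ, smul_eq_mul]

lemma weight_convex_comb {n : ℕ} {c d : Fin n × Fin n → ℝ} (hc : ∀ p, 0 ≤ c p) (hd : ∀ p, 0 ≤ d p)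
    {s t : ℝ} (hs : 0 ≤ s) (ht : 0 ≤ t) (y : Fin n → ℝ) :
    weight 0 (fun p => s * c p + t * d p) y = weight 0 c y ^ s * weight 0 d y ^ t := by
  have h0 : ∀ p : Fin n × Fin n, 0 ≤ 0 + chordSq (y p.1) (y p.2) := fun p =>
    add_nonneg le_rfl (chordSq_nonneg _ _)
  unfold weight
  rw [← Real.finsetProd_rpow _ _ fun p _ => Real.rpow_nonneg (h0 p) _,
    ← Real.finsetProd_rpow _ _ fun p _ => Real.rpow_nonneg (h0 p) _, ← Finset.prod_mul_distrib]
  refine Finset.prod_congr rfl fun p _ => ?_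
  rw [Real.rpow_add_of_nonneg (h0 p) (mul_nonneg hs (hc p)) (mul_nonneg ht (hd p)),
    mul_comm s, mul_comm t, Real.rpow_mul (h0 p), Real.rpow_mul (h0 p)]

lemma integral_weight_convex_comb_le {n : ℕ} {c d : Fin n × Fin n → ℝ} (hc : ∀ p, 0 ≤ c p)
    (hd : ∀ p, 0 ≤ d p) {s t : ℝ} (hs : 0 < s) (ht : 0 < t) (hst : s + t = 1) :
    ∫ y, weight 0 (fun p => s * c p + t * d p) y ∂(boxMeasure n)
      ≤ (∫ y, weight 0 c y ∂(boxMeasure n)) ^ s * (∫ y, weight 0 d y ∂(boxMeasure n)) ^ t := by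
  have hnn : ∀ {c : Fin n × Fin n → ℝ} {s : ℝ}, 0 ≤ᵐ[boxMeasure n] fun y => weight 0 c y ^ s :=
    Eventually.of_forall fun y => Real.rpow_nonneg (weight_nonneg le_rfl y) _
  have hpow : ∀ {c : Fin n × Fin n → ℝ} {s : ℝ} (_ : 0 < s) (y : Fin n → ℝ),
      (weight 0 c y ^ s) ^ (1 / s) = weight 0 c y := fun hs y => by
    rw [← Real.rpow_mul (weight_nonneg le_rfl y), mul_one_div_cancel hs.ne', Real.rpow_one]
  have hLp : ∀ {c : Fin n × Fin n → ℝ} {s : ℝ} (_ : ∀ p, 0 ≤ c p) (_ : 0 < s),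
      MemLp (fun y => weight 0 c y ^ s) (ENNReal.ofReal (1 / s)) (boxMeasure n) := by
    intro c s hc hs
    have hcont : Continuous fun y => weight 0 c y ^ s :=
      (continuous_weight hc 0).rpow_const fun _ => Or.inr hs.le
    rw [← integrable_norm_rpow_iff hcont.aestronglyMeasurable
      (by rw [Ne, ENNReal.ofReal_eq_zero, not_le]; positivity) ENNReal.ofReal_ne_top,
      ENNReal.toReal_ofReal (by positivity)]
    refine (continuous_weight hc 0).integrable_boxMeasure.congr (Eventually.of_forall fun y => ?_)
    simp only [Real.norm_of_nonneg (Real.rpow_nonneg (weight_nonneg le_rfl y) _), hpow hs]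
  have h := integral_mul_le_Lp_mul_Lq_of_nonneg (Real.holderConjugate_one_div hs ht hst)
    (hnn (c := c) (s := s)) (hnn (c := d) (s := t)) (hLp hc hs) (hLp hd ht)
  simp only [hpow hs, hpow ht, one_div_one_div] at h
  simpa only [weight_convex_comb hc hd hs.le ht.le] using h

section impZ

variable {N : ℕ} {l : ℝ}

lemma impZ_nonneg (p : ℝ) : 0 ≤ impZ N l p := integral_nonneg fun y => weight_nonneg le_rfl y

lemma impZ_convex_comb_le (hl : 0 ≤ l) {p q s t : ℝ} (hp : 0 ≤ p) (hq : 0 ≤ q) (hs : 0 < s)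
    (ht : 0 < t) (hst : s + t = 1) :
    impZ N l (s * p + t * q) ≤ impZ N l p ^ s * impZ N l q ^ t := by
  have h := integral_weight_convex_comb_le (impExp_nonneg (N := N) hp hl)
    (impExp_nonneg (N := N) hq hl) hs ht hst
  have he : (fun r : Fin (N + 1) × Fin (N + 1) => s * impExp p l r + t * impExp q l r)
      = impExp (s * p + t * q) l := by
    funext r
    unfold impExp
    split_ifs
    · rfl
    · rw [← add_mul, hst, one_mul]
  rwa [he] at h

lemma topRatio_pos {κ p : ℝ} (hκ : 0 ≤ κ) (hp : 0 ≤ p) (hl : 0 ≤ l) : 0 < topRatio N κ p l :=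
  Finset.prod_pos fun j _ => by positivity

lemma impZ_pos (hl : 0 ≤ l) (h0 : 0 < circZ N l) {p : ℝ} (hp : 0 ≤ p) : 0 < impZ N l p := by
  have hnat : ∀ m : ℕ, 0 < impZ N l m := by
    intro m
    induction m with
    | zero => rw [Nat.cast_zero, impZ_zero]; positivity
    | succ m ih =>
      rw [Nat.cast_succ, impZ_add_one m.cast_nonneg hl]
      exact mul_pos (mul_pos (topRatio_pos zero_le_one m.cast_nonneg hl)
        (topRatio_pos le_rfl m.cast_nonneg hl)) ih
  refine (impZ_nonneg p).lt_of_ne fun hz => ?_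
  obtain ⟨m, hm⟩ := exists_nat_gt p
  have hd : 0 < m + 1 - p := by linarith
  have h := impZ_convex_comb_le (N := N) hl hp (q := m + 1) (by positivity)
    (s := 1 / (m + 1 - p)) (t := (m - p) / (m + 1 - p)) (by positivity)
    (div_pos (by linarith) hd) (by field_simp; ring)
  rw [show 1 / (m + 1 - p) * p + (m - p) / (m + 1 - p) * (m + 1) = (m : ℝ) by field_simp; ring,
    ← hz, Real.zero_rpow (by positivity), zero_mul] at h
  exact absurd (hnat m) h.not_gt

lemma convexOn_log_impZ (hl : 0 ≤ l) (h0 : 0 < circZ N l) :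
    ConvexOn ℝ (Set.Ici 0) fun p => Real.log (impZ N l p) := by
  refine convexOn_iff_forall_pos.2 ⟨convex_Ici 0, fun p hp q hq s t hs ht hst => ?_⟩
  have hpp := impZ_pos hl h0 hp
  have hqp := impZ_pos hl h0 hq
  have hpq : (0 : ℝ) ≤ s * p + t * q := add_nonneg (mul_nonneg hs.le hp) (mul_nonneg ht.le hq)
  simp only [smul_eq_mul]
  rw [← Real.log_rpow hpp, ← Real.log_rpow hqp,
    ← Real.log_mul (Real.rpow_pos_of_pos hpp _).ne' (Real.rpow_pos_of_pos hqp _).ne']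
  exact Real.log_le_log (impZ_pos hl h0 hpq) (impZ_convex_comb_le hl hp hq hs ht hst)

end impZ

section uniqueness

lemma add_natCast_eq_add_sum {f q : ℝ → ℝ} (hf : ∀ x, 0 ≤ x → f (x + 1) = f x + q x) {s : ℝ}
    (hs : 0 ≤ s) (m : ℕ) : f (m + s) = f s + ∑ i ∈ Finset.range m, q (i + s) := by
  induction m with
  | zero => simp
  | succ m ih =>
    rw [Nat.cast_succ, show (m : ℝ) + 1 + s = m + s + 1 by ring, hf _ (by positivity), ih,
      Finset.sum_range_succ, add_assoc]

lemma ConvexOn.sub_mem_of_shift {f q : ℝ → ℝ} (hc : ConvexOn ℝ (Set.Ici 0) f)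
    (hf : ∀ x, 0 ≤ x → f (x + 1) = f x + q x) {s : ℝ} (hs : 0 < s) (m : ℕ) :
    s * q m ≤ f (m + 1 + s) - f (m + 1) ∧ f (m + 1 + s) - f (m + 1) ≤ s * q (m + 1 + s) := by
  have hm : (0 : ℝ) ≤ m := m.cast_nonneg
  have h1 := hc.slope_mono_adjacent (x := m) (y := m + 1) (z := m + 1 + s) hm
    (Set.mem_Ici.2 (by positivity)) (by linarith) (by linarith)
  have h2 := hc.slope_mono_adjacent (x := m + 1) (y := m + 1 + s) (z := m + 1 + s + 1)
    (Set.mem_Ici.2 (by positivity)) (Set.mem_Ici.2 (by positivity)) (by linarith) (by linarith)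
  rw [hf m hm, show (m : ℝ) + 1 + s - (m + 1) = s by ring,
    show (m : ℝ) + 1 - m = 1 by ring, div_one, le_div_iff₀ hs] at h1
  rw [hf (m + 1 + s) (by positivity), show (m : ℝ) + 1 + s - (m + 1) = s by ring,
    show (m : ℝ) + 1 + s + 1 - (m + 1 + s) = 1 by ring, div_one, div_le_iff₀ hs] at h2
  have h3 := hf m hm
  constructor <;> linarith

/-- Convex solutions of `f (x + 1) = f x + q x` are unique up to constants if `q` grows slowly. -/
lemma ConvexOn.sub_eq_sub_of_shift {f g q : ℝ → ℝ} (hfc : ConvexOn ℝ (Set.Ici 0) f)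
    (hgc : ConvexOn ℝ (Set.Ici 0) g) (hf : ∀ x, 0 ≤ x → f (x + 1) = f x + q x)
    (hg : ∀ x, 0 ≤ x → g (x + 1) = g x + q x) {s : ℝ} (hs : 0 < s)
    (hq : Tendsto (fun m : ℕ => q (m + 1 + s) - q m) atTop (nhds 0)) :
    f s - f 0 = g s - g 0 := by
  have hb : ∀ m : ℕ, |(f s - f 0) - (g s - g 0)| ≤ s * (q (m + 1 + s) - q m) := by
    intro m
    obtain ⟨h1, h2⟩ := hfc.sub_mem_of_shift hf hs m
    obtain ⟨h3, h4⟩ := hgc.sub_mem_of_shift hg hs m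
    have e1 := add_natCast_eq_add_sum hf hs.le (m + 1)
    have e2 := add_natCast_eq_add_sum hg hs.le (m + 1)
    have e3 := add_natCast_eq_add_sum hf le_rfl (m + 1)
    have e4 := add_natCast_eq_add_sum hg le_rfl (m + 1)
    rw [add_zero] at e3 e4
    push_cast at e1 e2 e3 e4
    rw [abs_le]
    constructor <;> linarith
  have h0 : |(f s - f 0) - (g s - g 0)| ≤ 0 := by
    refine ge_of_tendsto' (x := atTop) ?_ hb
    simpa using hq.const_mul s
  exact sub_eq_zero.1 (abs_nonpos_iff.1 h0)

end uniqueness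

lemma convexOn_log_Gamma_comp {a b : ℝ} (ha : 0 ≤ a) (hb : 0 < b) :
    ConvexOn ℝ (Set.Ici 0) fun p => Real.log (Real.Gamma (b + a * p)) := by
  refine ⟨convex_Ici 0, fun p hp q hq s t hs ht hst => ?_⟩
  rw [Set.mem_Ici] at hp hq
  have h := Real.convexOn_log_Gamma.2 (x := b + a * p) (y := b + a * q)
    (Set.mem_Ioi.2 (by positivity)) (Set.mem_Ioi.2 (by positivity)) hs ht hst
  simp only [smul_eq_mul, Function.comp_apply] at h ⊢
  rwa [show s * (b + a * p) + t * (b + a * q) = b + a * (s * p + t * q) by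
    linear_combination b * hst] at h

lemma ConvexOn.finset_sum {ι : Type*} {D : Set ℝ} {f : ι → ℝ → ℝ} (A : Finset ι) (hD : Convex ℝ D)
    (h : ∀ i ∈ A, ConvexOn ℝ D (f i)) : ConvexOn ℝ D fun x => ∑ i ∈ A, f i x := by
  classical
  induction A using Finset.induction_on with
  | empty => simpa using convexOn_const (0 : ℝ) hD
  | insert a A ha ih =>
    simp only [Finset.sum_insert ha]
    exact (h a (Finset.mem_insert_self a A)).add (ih fun i hi => h i (Finset.mem_insert_of_mem hi))

lemma log_Gamma_add_one {x : ℝ} (hx : 0 < x) :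
    Real.log (Real.Gamma (x + 1)) = Real.log x + Real.log (Real.Gamma x) := by
  rw [Real.Gamma_add_one hx.ne', Real.log_mul hx.ne' (Real.Gamma_pos_of_pos hx).ne']

lemma log_topRatio {N : ℕ} {κ p l : ℝ} (hκ : 0 ≤ κ) (hp : 0 ≤ p) (hl : 0 ≤ l) :
    Real.log (topRatio N κ p l) = ∑ j ∈ Finset.range N,
      (Real.log (1 + κ + 2 * p + l * j) - Real.log (1 + p + l * j)) := by
  rw [topRatio, Real.log_prod fun j _ => by positivity]
  exact Finset.sum_congr rfl fun j _ => Real.log_div (by positivity) (by positivity)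

lemma log_circZ_succ {N : ℕ} {l : ℝ} (hl : 0 < l) (h0 : 0 < circZ N l) :
    Real.log (circZ (N + 1) l) = Real.log (2 * Real.pi) + Real.log (circZ N l)
      + Real.log (Real.Gamma (1 + l * (N + 1))) - Real.log (Real.Gamma (1 + l * N))
      - Real.log (Real.Gamma (1 + l)) := by
  set q : ℝ → ℝ := fun p => ∑ j ∈ Finset.range N,
    (Real.log (1 + 2 * p + l * j) + Real.log (2 + 2 * p + l * j)) with hq
  set f : ℝ → ℝ := fun p => Real.log (impZ N l p)
    + ∑ j ∈ Finset.range N, 2 * Real.log (Real.Gamma (1 + l * j + 1 * p)) with hf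
  set g : ℝ → ℝ := fun p => ∑ j ∈ Finset.range N, Real.log (Real.Gamma (1 + l * j + 2 * p)) with hg
  have hfc : ConvexOn ℝ (Set.Ici 0) f := by
    refine (convexOn_log_impZ hl.le h0).add (ConvexOn.finset_sum _ (convex_Ici 0) fun j _ => ?_)
    exact (convexOn_log_Gamma_comp zero_le_one (by positivity)).smul zero_le_two
  have hgc : ConvexOn ℝ (Set.Ici 0) g :=
    ConvexOn.finset_sum _ (convex_Ici 0) fun j _ =>
      convexOn_log_Gamma_comp zero_le_two (by positivity)
  have hfs : ∀ x, 0 ≤ x → f (x + 1) = f x + q x := by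
    intro x hx
    simp only [hf, hq]
    rw [impZ_add_one hx hl.le, mul_assoc,
      Real.log_mul (topRatio_pos zero_le_one hx hl.le).ne' (mul_pos (topRatio_pos le_rfl hx hl.le)
        (impZ_pos hl.le h0 hx)).ne',
      Real.log_mul (topRatio_pos le_rfl hx hl.le).ne' (impZ_pos hl.le h0 hx).ne',
      log_topRatio zero_le_one hx hl.le, log_topRatio le_rfl hx hl.le]
    have : ∀ j : ℕ, Real.log (Real.Gamma (1 + l * j + 1 * (x + 1)))
        = Real.log (1 + x + l * j) + Real.log (Real.Gamma (1 + l * j + 1 * x)) := fun j => by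
      rw [show 1 + l * j + 1 * (x + 1) = (1 + x + l * j) + 1 by ring,
        log_Gamma_add_one (by positivity), show 1 + x + l * j = 1 + l * j + 1 * x by ring]
    simp only [this]
    have hsum : ∑ j ∈ Finset.range N, (Real.log (1 + 1 + 2 * x + l * j) - Real.log (1 + x + l * j))
        + ∑ j ∈ Finset.range N, (Real.log (1 + 0 + 2 * x + l * j) - Real.log (1 + x + l * j))
        + ∑ j ∈ Finset.range N,
          2 * (Real.log (1 + x + l * j) + Real.log (Real.Gamma (1 + l * j + 1 * x)))
        = ∑ j ∈ Finset.range N, 2 * Real.log (Real.Gamma (1 + l * j + 1 * x))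
          + ∑ j ∈ Finset.range N, (Real.log (1 + 2 * x + l * j) + Real.log (2 + 2 * x + l * j)) := by
      simp only [← Finset.sum_add_distrib]
      exact Finset.sum_congr rfl fun j _ => by
        rw [show (1 : ℝ) + 1 + 2 * x + l * j = 2 + 2 * x + l * j by ring, add_zero]
        ring
    linarith
  have hgs : ∀ x, 0 ≤ x → g (x + 1) = g x + q x := by
    intro x hx
    simp only [hg, hq, ← Finset.sum_add_distrib]
    refine Finset.sum_congr rfl fun j _ => ?_
    rw [show 1 + l * j + 2 * (x + 1) = (1 + l * j + 2 * x + 1) + 1 by ring,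
      log_Gamma_add_one (by positivity), log_Gamma_add_one (by positivity),
      show 1 + l * j + 2 * x + 1 = 2 + 2 * x + l * j by ring,
      show 1 + 2 * x + l * j = 1 + l * j + 2 * x by ring]
    ring
  have hlim : Tendsto (fun m : ℕ => q (m + 1 + l) - q m) atTop (nhds 0) := by
    have hone : ∀ a : ℝ, Tendsto (fun m : ℕ => Real.log (a + 2 * (m + 1 + l))
        - Real.log (a + 2 * m)) atTop (nhds 0) := by
      intro a
      have ht : Tendsto (fun m : ℕ => a + 2 * (m : ℝ)) atTop atTop :=
        tendsto_atTop_add_const_left _ _ (tendsto_natCast_atTop_atTop.const_mul_atTop two_pos)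
      refine ((Real.tendsto_log_comp_add_sub_log (2 * (1 + l))).comp ht).congr fun m => ?_
      simp only [Function.comp_apply]
      congr 2; ring
    have hsum := tendsto_finsetSum (Finset.range N) fun j _ =>
      (hone (1 + l * j)).add (hone (2 + l * j))
    simp only [add_zero, Finset.sum_const_zero] at hsum
    refine hsum.congr fun m => ?_
    simp only [hq, ← Finset.sum_sub_distrib]
    refine Finset.sum_congr rfl fun j _ => ?_
    rw [show 1 + 2 * ((m : ℝ) + 1 + l) + l * j = 1 + l * j + 2 * (m + 1 + l) by ring,
      show 2 + 2 * ((m : ℝ) + 1 + l) + l * j = 2 + l * j + 2 * (m + 1 + l) by ring,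
      show 1 + 2 * (m : ℝ) + l * j = 1 + l * j + 2 * m by ring,
      show 2 + 2 * (m : ℝ) + l * j = 2 + l * j + 2 * m by ring]
    ring
  have key := ConvexOn.sub_eq_sub_of_shift hfc hgc hfs hgs hl hlim
  set L : ℕ → ℝ := fun j => Real.log (Real.Gamma (1 + l * j)) with hL
  have e1 : ∀ j : ℕ, Real.log (Real.Gamma (1 + l * j + 1 * l)) = L (j + 1) := fun j => by
    simp only [hL]; push_cast; congr 2; ring
  have e2 : ∀ j : ℕ, Real.log (Real.Gamma (1 + l * j + 2 * l)) = L (j + 2) := fun j => by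
    simp only [hL]; push_cast; congr 2; ring
  simp only [hf, hg, mul_zero, add_zero, e1, e2, impZ_self, impZ_zero] at key
  have hts := Finset.sum_range_sub (fun j => L (j + 1) - L j) N
  have hcomb : ∑ j ∈ Finset.range N, (L (j + 1 + 1) - L (j + 1) - (L (j + 1) - L j))
      = ∑ j ∈ Finset.range N, L (j + 2) - ∑ j ∈ Finset.range N, 2 * L (j + 1)
        + ∑ j ∈ Finset.range N, 2 * L j - ∑ j ∈ Finset.range N, L j := by
    simp only [← Finset.sum_sub_distrib, ← Finset.sum_add_distrib]
    exact Finset.sum_congr rfl fun j _ => by ring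
  have hL0 : L 0 = 0 := by simp [hL]
  have hL1 : L 1 = Real.log (Real.Gamma (1 + l)) := by simp [hL]
  have hLN : L (N + 1) = Real.log (Real.Gamma (1 + l * (N + 1))) := by simp [hL]
  rw [Real.log_mul (by positivity) h0.ne'] at key
  rw [← hL1, ← hLN]
  simp only [zero_add] at hts
  have hkey' : ∑ j ∈ Finset.range N, Real.log (Real.Gamma (1 + l * j))
      = ∑ j ∈ Finset.range N, L j := rfl
  have hkey'' : ∑ j ∈ Finset.range N, 2 * Real.log (Real.Gamma (1 + l * j))
      = ∑ j ∈ Finset.range N, 2 * L j := rfl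
  have hLN' : L N = Real.log (Real.Gamma (1 + l * N)) := rfl
  rw [hkey', hkey''] at key
  rw [← hLN']
  linarith

theorem circZ_eq {l : ℝ} (hl : 0 < l) (n : ℕ) :
    circZ n l = (2 * Real.pi) ^ n * Real.Gamma (1 + l * n) / Real.Gamma (1 + l) ^ n := by
  have hG1 : 0 < Real.Gamma (1 + l) := Real.Gamma_pos_of_pos (by positivity)
  induction n with
  | zero => simp [circZ_zero]
  | succ n ih =>
    have hGn : 0 < Real.Gamma (1 + l * n) := Real.Gamma_pos_of_pos (by positivity)
    have hGn' : 0 < Real.Gamma (1 + l * (n + 1)) := Real.Gamma_pos_of_pos (by positivity)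
    have h0 : 0 < circZ n l := by rw [ih]; positivity
    have hpos : 0 < circZ (n + 1) l := by
      rw [← impZ_self]; exact impZ_pos hl.le h0 hl.le
    have h := log_circZ_succ hl h0
    rw [← Real.log_mul (by positivity) h0.ne', ← Real.log_mul (by positivity) hGn'.ne',
      ← Real.log_div (by positivity) hGn.ne', ← Real.log_div (by positivity) hG1.ne'] at h
    rw [Real.log_injOn_pos (Set.mem_Ioi.2 hpos) (Set.mem_Ioi.2 (by positivity)) h, ih]
    push_cast
    field_simp
    ring

lemma norm_exp_sub_exp_sq (x y : ℝ) :
    ‖Complex.exp (Complex.I * x) - Complex.exp (Complex.I * y)‖ ^ 2 = chordSq x y := by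
  have h : ∀ t : ℝ, Complex.exp (Complex.I * t) = Complex.cos t + Complex.sin t * Complex.I :=
    fun t => by rw [mul_comm, Complex.exp_mul_I]
  rw [Complex.sq_norm, h, h, ← Complex.ofReal_cos, ← Complex.ofReal_sin, ← Complex.ofReal_cos,
    ← Complex.ofReal_sin, Complex.normSq_apply, chordSq, Real.cos_sub]
  simp only [Complex.sub_re, Complex.sub_im, Complex.add_re, Complex.add_im, Complex.mul_re,
    Complex.mul_im, Complex.ofReal_re, Complex.ofReal_im, Complex.I_re, Complex.I_im]
  linear_combination Real.cos_sq_add_sin_sq x + Real.cos_sq_add_sin_sq y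

lemma prod_norm_exp_sub_exp_rpow (β : ℝ) {n : ℕ} (y : Fin n → ℝ) :
    ∏ p ∈ Finset.univ.filter (fun p : Fin n × Fin n => p.1 < p.2),
        ‖Complex.exp (Complex.I * (y p.1 : ℂ)) - Complex.exp (Complex.I * (y p.2 : ℂ))‖ ^ β
      = weight 0 (fun _ => β / 2) y := by
  refine Finset.prod_congr rfl fun p _ => ?_
  rw [zero_add, ← norm_exp_sub_exp_sq, ← Real.rpow_natCast, ← Real.rpow_mul (norm_nonneg _)]
  congr 1
  push_cast; ring

lemma cbeConst_eq {β : ℝ} (hβ : 0 < β) (n : ℕ) : cbeConst β n = circZ n (β / 2) := by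
  rw [circZ_eq (by positivity), cbeConst, show β / 2 * n = β * n / 2 by ring]

lemma circZ_pos {l : ℝ} (hl : 0 < l) (n : ℕ) : 0 < circZ n l := by
  have h1 : 0 < Real.Gamma (1 + l * n) := Real.Gamma_pos_of_pos (by positivity)
  have h2 : 0 < Real.Gamma (1 + l) := Real.Gamma_pos_of_pos (by positivity)
  rw [circZ_eq hl]
  positivity

lemma integral_cbe {β : ℝ} (hβ : 0 < β) (n : ℕ) (f : (Fin n → ℝ) → ℝ) :
    ∫ y, f y ∂(cbe β n)
      = (∫ y, f y * weight 0 (fun _ => β / 2) y ∂(boxMeasure n)) / circZ n (β / 2) := by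
  have hZ := circZ_pos (half_pos hβ) n
  have hw : Continuous (weight (n := n) 0 fun _ => β / 2) := continuous_weight (fun _ => by positivity) 0
  rw [cbe, ← boxMeasure]
  simp only [prod_norm_exp_sub_exp_rpow, cbeConst_eq hβ]
  have hm : Measurable fun y : Fin n → ℝ =>
      ENNReal.ofReal (1 / circZ n (β / 2) * weight 0 (fun _ => β / 2) y) :=
    ENNReal.measurable_ofReal.comp (hw.measurable.const_mul _)
  rw [integral_withDensity_eq_integral_toReal_smul hm
    (Eventually.of_forall fun y => ENNReal.ofReal_lt_top), ← integral_div]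
  refine integral_congr_ae (Eventually.of_forall fun y => ?_)
  have h0 := weight_nonneg (c := fun _ => β / 2) le_rfl y
  simp only [smul_eq_mul]
  rw [ENNReal.toReal_ofReal (by positivity)]
  ring

lemma wSq_one (n : ℕ) (l : ℝ) : wSq (n := n) l (fun _ => 1) = circZ n l := by
  simp [wSq, circZ]

lemma wSq_ps_le {n : ℕ} {l : ℝ} (hl : 0 ≤ l) (k : ℤ) :
    wSq (n := n) l (ps k) ≤ n ^ 2 * circZ n l := by
  rw [circZ, ← integral_const_mul]
  refine integral_mono (integrable_wSq hl (torusC1_ps k).continuous)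
    ((continuous_weight (fun _ => hl) 0).integrable_boxMeasure.const_mul _) fun y => ?_
  have := norm_ps_le k y
  exact mul_le_mul_of_nonneg_right (by gcongr) (weight_nonneg le_rfl y)

lemma sum_wSq_ps_tail_le {n K : ℕ} {l ε : ℝ} (hl : 0 < l) (hε : 0 < ε)
    (hεl : 2 * (1 + 2 * l) * ε ≤ l) (hn : 1 ≤ n) (hK : 1 ≤ K) (hKn : (K : ℝ) ≤ ε * n)
    (hnK : ε * n ≤ 4 * K) (N : ℕ) :
    ∑ k ∈ Finset.Ico (2 * K) N, wSq (n := n) l (ps k) / circZ n l / (k : ℝ) ^ 2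
      ≤ 8 * (16 / ε ^ 2 + 2 / l) := by
  have hZ := circZ_pos hl n
  have hK' : (0 : ℝ) < K := by exact_mod_cast hK
  have hM : ∀ k : ℕ, 1 ≤ k → k < K → wSq (n := n) l (ps k) ≤ 2 / l * K * circZ n l := by
    intro k hk hkK
    have hkK' : (k : ℝ) ≤ K := by exact_mod_cast hkK.le
    have hkn : 2 * (1 + 2 * l) * k ≤ l * n := by
      calc 2 * (1 + 2 * l) * k ≤ 2 * (1 + 2 * l) * (ε * n) := by gcongr; linarith
        _ = 2 * (1 + 2 * l) * ε * n := by ring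
        _ ≤ l * n := by gcongr
    have h := (wSq_ps_bounds hl hn hk hkn).1
    rw [wSq_one] at h
    exact h.trans (by gcongr)
  have h := sum_tail_le_of_fejer (S := fun k => wSq (n := n) l (ps k)) (fun k => wSq_nonneg _)
    (fun k => wSq_ps_neg k) hK (sum_wSq_ps_shift_le hl.le K) hM (by positivity) N
  have h0 := wSq_ps_le (n := n) hl.le 0
  have hnK' : (n : ℝ) / K ≤ 4 / ε := by
    rw [div_le_div_iff₀ hK' hε]; linarith
  have hn2 : ((n : ℝ) / K) ^ 2 ≤ 16 / ε ^ 2 := by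
    calc ((n : ℝ) / K) ^ 2 ≤ (4 / ε) ^ 2 := by gcongr
      _ = 16 / ε ^ 2 := by rw [div_pow]; norm_num
  have he : ∑ k ∈ Finset.Ico (2 * K) N, wSq (n := n) l (ps k) / circZ n l / (k : ℝ) ^ 2
      = (∑ k ∈ Finset.Ico (2 * K) N, wSq (n := n) l (ps k) / (k : ℝ) ^ 2) / circZ n l := by
    rw [Finset.sum_div]
    exact Finset.sum_congr rfl fun k _ => by rw [div_right_comm]
  rw [he, div_le_iff₀ hZ]
  calc _ ≤ 8 * (wSq (n := n) l (ps 0) / K ^ 2 + 2 / l * K * circZ n l / K) := h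
    _ ≤ 8 * (n ^ 2 * circZ n l / K ^ 2 + 2 / l * K * circZ n l / K) := by gcongr
    _ = 8 * ((n / K) ^ 2 + 2 / l) * circZ n l := by field_simp
    _ ≤ 8 * (16 / ε ^ 2 + 2 / l) * circZ n l := by gcongr

lemma centeredCount_sq_comm {n : ℕ} {a b : ℝ} (h : a < b) (y : Fin n → ℝ) :
    centeredCount n b a y ^ 2 = centeredCount n a b y ^ 2 := by
  rw [centeredCount, centeredCount, if_neg h.not_ge, if_pos h.le, neg_sq]

lemma exists_variance_bound {l : ℝ} (hl : 0 < l) :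
    ∃ C > 0, ∀ n : ℕ, 1 ≤ n → ∀ a b : ℝ, 0 ≤ a → a < b → b < 2 * Real.pi →
      |(∫ y, centeredCount n a b y ^ 2 * weight 0 (fun _ => l) y ∂(boxMeasure n)) / circZ n l
        - Real.log n / (Real.pi ^ 2 * l)| ≤ C * (1 - Real.log (Real.sin ((b - a) / 2))) := by
  set ε : ℝ := l / (2 * (1 + 2 * l)) with hε
  have hεpos : 0 < ε := by positivity
  have hεl : 2 * (1 + 2 * l) * ε = l := by rw [hε]; field_simp
  have hε1 : ε ≤ 1 := by rw [hε, div_le_one (by positivity)]; linarith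
  obtain ⟨C, hC, h⟩ := exists_sum_bound (C₁ := 2 * (1 + 2 * l) / l ^ 2)
    (D := 8 * (16 / ε ^ 2 + 2 / l)) hl hεpos hε1 (by positivity) (by positivity)
  refine ⟨C, hC, fun n hn a b ha hab hb => ?_⟩
  have hZ := circZ_pos hl n
  have hn' : (0 : ℝ) < n := by exact_mod_cast hn
  have hlim := (tendsto_variance_sum (n := n) hl.le ha hab.le hb.le).div_const (circZ n l)
  refine le_of_tendsto (hlim.sub_const (Real.log n / (Real.pi ^ 2 * l))).abs ?_
  filter_upwards [eventually_ge_atTop n] with N hN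
  have hb := h n hn (fun k => wSq (n := n) l (ps k) / circZ n l)
    (fun k => div_nonneg (wSq_nonneg _) hZ.le)
    (fun k => (div_le_iff₀ hZ).2 (wSq_ps_le hl.le k))
    (fun k hk hkn => by
      have hkn' : 2 * (1 + 2 * l) * k ≤ l * n := by
        calc 2 * (1 + 2 * l) * k ≤ 2 * (1 + 2 * l) * (ε * n) := by gcongr
          _ = l * n := by rw [← mul_assoc, hεl]
      have hw := (wSq_ps_bounds hl hn hk hkn').2
      rw [wSq_one] at hw
      have he : wSq (n := n) l (ps k) / circZ n l - k / l
          = (wSq (n := n) l (ps k) - k / l * circZ n l) / circZ n l := by field_simp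
      rw [he, abs_div, abs_of_pos hZ, div_le_iff₀ hZ]
      exact hw)
    (fun K hK hKn hnK M => sum_wSq_ps_tail_le hl hεpos hεl.le hn hK
      (by have : (0 : ℝ) ≤ K := K.cast_nonneg
          linarith) hnK M)
    (b - a) (sub_pos.2 hab) (by linarith) N hN
  rw [Finset.sum_div]
  simpa only [mul_div_assoc] using hb

/-- For `a, b ∈ [0,2π)`, `a ≠ b`:
`|E[Ñ_n(a,b)²] − 2 ln n/(π²β)| ≤ C(1 − ln sin(|a−b|/2))`,
with `C` depending only on `β`. -/
theorem centered_counting_variance (β : ℝ) (hβ : 0 < β) :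
    ∃ C > 0, ∀ n : ℕ, 1 ≤ n →
      ∀ a ∈ Set.Ico (0:ℝ) (2 * Real.pi), ∀ b ∈ Set.Ico (0:ℝ) (2 * Real.pi), a ≠ b →
        |(∫ y, (centeredCount n a b y) ^ 2 ∂(cbe β n))
            - 2 * Real.log n / (Real.pi ^ 2 * β)|
          ≤ C * (1 - Real.log (Real.sin (|a - b| / 2))) := by
  obtain ⟨C, hC, h⟩ := exists_variance_bound (half_pos hβ)
  refine ⟨C, hC, fun n hn a ha b hb hab => ?_⟩
  rw [integral_cbe hβ, show 2 * Real.log n / (Real.pi ^ 2 * β)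
    = Real.log n / (Real.pi ^ 2 * (β / 2)) by field_simp]
  rcases hab.lt_or_gt with hlt | hlt
  · rw [abs_sub_comm a b, abs_of_pos (sub_pos.2 hlt)]
    exact h n hn a b ha.1 hlt hb.2
  · simp only [centeredCount_sq_comm hlt]
    rw [abs_of_pos (sub_pos.2 hlt)]
    exact h n hn b a hb.1 hlt ha.2
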